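/- (Segre's coarse classification of real Schläfli sixes) Consider the equivalence relation on real Schläfli sixes generated by: (i) two Schläfli sixes are equivalent if they are connected by a continuous family of real Schläfli sixes, and (ii) a Schläfli six is equivalent to each of its mirror images (images under linear maps A∈GL₄(ℝ) with det A<0). This relation has exactly 4 equivalence classes (formed respectively by hexagonal, bipartite, tripartite and icosahedral Schläfli sixes). -/

import Mathlib

open Submodule

abbrev V4 : Type := Fin 4 → ℝ

abbrev PLine : Type := Submodule ℝ V4

def IsLine (P : PLine) : Prop := Module.finrank ℝ P = 2

def Skew (P Q : PLine) : Prop := IsLine P ∧ IsLine Q ∧ P ⊓ Q = ⊥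

def PairwiseSkew {n : ℕ} (L : Fin n → PLine) : Prop :=
  ∀ i j : Fin n, i ≠ j → Skew (L i) (L j)

noncomputable def det2 (a b c d : V4) : ℝ := Matrix.det (Matrix.of ![a, b, c, d])

open Classical in
noncomputable def lk (P Q R : PLine) : ℝ :=
  if h : ∃ v : Fin 6 → V4,
      P = span ℝ {v 0, v 1} ∧ Q = span ℝ {v 2, v 3} ∧ R = span ℝ {v 4, v 5} then
    Real.sign (det2 (h.choose 0) (h.choose 1) (h.choose 2) (h.choose 3) *
      det2 (h.choose 0) (h.choose 1) (h.choose 4) (h.choose 5) *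
      det2 (h.choose 2) (h.choose 3) (h.choose 4) (h.choose 5))
  else 0

noncomputable def sgnOf {n : ℕ} (L : Fin n → PLine) : ℝ :=
  ∑ i : Fin n, ∑ j : Fin n, ∑ k : Fin n,
    if i < j ∧ j < k then lk (L i) (L j) (L k) else 0

def ContinuousLineFamily (L : ℝ → PLine) : Prop :=
  ∃ v w : ℝ → V4, ContinuousOn v (Set.Icc 0 1) ∧ ContinuousOn w (Set.Icc 0 1) ∧
    ∀ t ∈ Set.Icc (0:ℝ) 1, L t = span ℝ {v t, w t}

def Deformation {n : ℕ} (L L' : Fin n → PLine) : Prop :=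
  ∃ F : ℝ → Fin n → PLine,
    (∀ i, ContinuousLineFamily (fun t => F t i)) ∧
    (∀ t ∈ Set.Icc (0:ℝ) 1, PairwiseSkew (F t)) ∧
    F 0 = L ∧ F 1 = L'

def DeformEquiv {n : ℕ} (L L' : Fin n → PLine) : Prop :=
  ∃ π π' : Equiv.Perm (Fin n), Deformation (L ∘ π) (L' ∘ π')

def IsMirror {n : ℕ} (L L' : Fin n → PLine) : Prop :=
  ∃ A : V4 →ₗ[ℝ] V4, LinearMap.det A < 0 ∧ ∀ i, L' i = (L i).map A

def CoarseDeformEquiv {n : ℕ} (L L' : Fin n → PLine) : Prop :=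
  DeformEquiv L L' ∨ ∃ M : Fin n → PLine, IsMirror L' M ∧ DeformEquiv L M

noncomputable def joinConfig {n : ℕ} (σ : Equiv.Perm (Fin n)) : Fin n → PLine :=
  fun i => span ℝ {![1, (i.val : ℝ) + 1, 0, 0], ![0, 0, ((σ i).val : ℝ) + 1, 1]}

def IsSchlafliSix (L : Fin 6 → PLine) : Prop :=
  PairwiseSkew L ∧
  ∃ F : MvPolynomial (Fin 4) ℝ,
    F ≠ 0 ∧ F.IsHomogeneous 3 ∧
    (∀ i : Fin 6, ∀ x ∈ L i, MvPolynomial.eval x F = 0) ∧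
    (∀ z : Fin 4 → ℂ, z ≠ 0 →
      MvPolynomial.eval z (MvPolynomial.map (algebraMap ℝ ℂ) F) = 0 →
      ∃ j : Fin 4, MvPolynomial.eval z (MvPolynomial.map (algebraMap ℝ ℂ) (MvPolynomial.pderiv j F)) ≠ 0)

def Reducible {n : ℕ} (L : Fin n → PLine) : Prop :=
  ∃ i j : Fin n, i ≠ j ∧ ∃ F : ℝ → Fin n → PLine,
    (∀ k, ContinuousLineFamily (fun t => F t k)) ∧
    F 0 = L ∧
    (∀ t ∈ Set.Ico (0:ℝ) 1, PairwiseSkew (F t)) ∧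
    F 1 i = F 1 j ∧
    (∀ k l : Fin n, k ≠ l → ¬(k = i ∧ l = j) → ¬(k = j ∧ l = i) → Skew (F 1 k) (F 1 l))


def SchlafliDeformation (L L' : Fin 6 → PLine) : Prop :=
  ∃ π π' : Equiv.Perm (Fin 6), ∃ F : ℝ → Fin 6 → PLine,
    (∀ i, ContinuousLineFamily (fun t => F t i)) ∧
    (∀ t ∈ Set.Icc (0:ℝ) 1, IsSchlafliSix (F t)) ∧
    F 0 = L ∘ π ∧ F 1 = L' ∘ π'

def SchlafliCoarse : (Fin 6 → PLine) → (Fin 6 → PLine) → Prop :=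
  Relation.EqvGen (fun L L' => SchlafliDeformation L L' ∨
    ∃ π : Equiv.Perm (Fin 6), IsMirror (L ∘ π) L')

section Planar

variable {K : Type*} [Field K]

/-- The bracket (determinant) of three vectors. -/
def br (x y z : Fin 3 → K) : K :=
  x 0 * (y 1 * z 2 - y 2 * z 1) - x 1 * (y 0 * z 2 - y 2 * z 0) + x 2 * (y 0 * z 1 - y 1 * z 0)

theorem eq_zero_of_br_ne_zero {x y z w : Fin 3 → K} (h : br x y z ≠ 0)
    (hx : x ⬝ᵥ w = 0) (hy : y ⬝ᵥ w = 0) (hz : z ⬝ᵥ w = 0) : w = 0 := by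
  simp only [dotProduct, Fin.sum_univ_three] at hx hy hz
  have key : ∀ i, br x y z * w i = 0 := by
    intro i
    fin_cases i <;> simp only [br, Fin.zero_eta, Fin.mk_one, Fin.reduceFinMk] <;> grind
  ext i
  exact (mul_eq_zero.mp (key i)).resolve_left h

/-- Six points of the plane no three of which are collinear. -/
def GenPos (p : Fin 6 → Fin 3 → K) : Prop :=
  ∀ i j k, i ≠ j → i ≠ k → j ≠ k → br (p i) (p j) (p k) ≠ 0

theorem br_swap_left (x y z : Fin 3 → K) : br y x z = - br x y z := by simp only [br]; ring

theorem br_swap_right (x y z : Fin 3 → K) : br x z y = - br x y z := by simp only [br]; ring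

theorem GenPos.of_lt {p : Fin 6 → Fin 3 → K}
    (h : ∀ i j k, i < j → j < k → br (p i) (p j) (p k) ≠ 0) : GenPos p := by
  have h1 : ∀ i j k, i < j → i ≠ k → j ≠ k → br (p i) (p j) (p k) ≠ 0 := by
    intro i j k hij hik hjk
    rcases lt_or_gt_of_ne hjk with h1 | h1
    · exact h i j k hij h1
    · rw [br_swap_right, neg_ne_zero]
      rcases lt_or_gt_of_ne hik with h2 | h2
      · exact h i k j h2 h1
      · rw [br_swap_left, neg_ne_zero]
        exact h k i j h2 hij
  intro i j k hij hik hjk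
  rcases lt_or_gt_of_ne hij with h2 | h2
  · exact h1 i j k h2 hik hjk
  · rw [br_swap_left, neg_ne_zero]
    exact h1 j i k h2 hjk hik

theorem GenPos.card_le {p : Fin 6 → Fin 3 → K} [DecidableEq K] (h : GenPos p) {z : Fin 3 → K}
    (hz : z ≠ 0) : (Finset.univ.filter fun i => p i ⬝ᵥ z = 0).card ≤ 2 := by
  by_contra! hc
  obtain ⟨i, hi, j, hj, k, hk, hij, hik, hjk⟩ := Finset.two_lt_card.mp hc
  simp only [Finset.mem_filter, Finset.mem_univ, true_and] at hi hj hk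
  exact hz (eq_zero_of_br_ne_zero (h i j k hij hik hjk) hi hj hk)

/-- No nonzero rank one matrix `X` satisfies `qᵢᵀ X pᵢ = 0` for all `i`. -/
theorem rank_one_absurd {p q : Fin 6 → Fin 3 → K} (hp : GenPos p) (hq : GenPos q)
    {y z : Fin 3 → K} (hy : y ≠ 0) (hz : z ≠ 0)
    (h : ∀ i, (q i ⬝ᵥ y) * (p i ⬝ᵥ z) = 0) : False := by
  classical
  have h1 := hp.card_le hz
  have h2 := hq.card_le hy
  have h3 : (Finset.univ : Finset (Fin 6)) =
      (Finset.univ.filter fun i => q i ⬝ᵥ y = 0) ∪ (Finset.univ.filter fun i => p i ⬝ᵥ z = 0) := by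
    ext i
    simpa using mul_eq_zero.mp (h i)
  have h4 := congrArg Finset.card h3
  have h5 := Finset.card_union_le (Finset.univ.filter fun i => q i ⬝ᵥ y = 0)
    (Finset.univ.filter fun i => p i ⬝ᵥ z = 0)
  simp only [Finset.card_univ, Fintype.card_fin] at h4
  omega

open Matrix in
/-- A matrix of rank two or three: the kernel is at most one-dimensional. -/
theorem cross_eq_zero_of_mulVec_eq_zero {p q : Fin 6 → Fin 3 → K} (hp : GenPos p) (hq : GenPos q)
    {X : Matrix (Fin 3) (Fin 3) K} (hX : X ≠ 0) (h : ∀ i, q i ⬝ᵥ X *ᵥ p i = 0)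
    {u v : Fin 3 → K} (hu : X *ᵥ u = 0) (hv : X *ᵥ v = 0) : u ⨯₃ v = 0 := by
  by_contra hz
  have hrow : ∀ i, (u ⨯₃ v) ⨯₃ X i = 0 := by
    intro i
    have h1 := congrFun hu i
    have h2 := congrFun hv i
    simp only [mulVec, dotProduct, Fin.sum_univ_three, Pi.zero_apply] at h1 h2
    simp only [cross_apply]
    ext j
    fin_cases j <;> simp <;> grind
  obtain ⟨j, hj⟩ := Function.ne_iff.mp hz
  set z := u ⨯₃ v with hzdef
  have hXe : X = vecMulVec (fun i => X i j / z j) z := by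
    ext i k
    have h3 := hrow i
    rw [cross_apply] at h3
    have h30 := congrFun h3 0
    have h31 := congrFun h3 1
    have h32 := congrFun h3 2
    simp at h30 h31 h32 hj
    rw [vecMulVec_apply, div_mul_eq_mul_div, eq_div_iff hj]
    fin_cases j <;> fin_cases k <;> simp <;> grind
  refine rank_one_absurd (y := fun i => X i j / z j) hp hq ?_ hz ?_
  · rintro h0
    rw [h0] at hXe
    exact hX (by rw [hXe]; ext; simp [vecMulVec_apply])
  · intro i
    have h4 := h i
    rw [hXe, vecMulVec_mulVec] at h4
    rw [← h4, dotProduct_comm (p i) z]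
    simp [dotProduct, Fin.sum_univ_three]
    ring

end Planar

section Smooth

open Matrix

variable {K : Type*} [Field K]

theorem exists_smul_of_cross_eq_zero {u v : Fin 3 → K} (hu : u ≠ 0) (h : u ⨯₃ v = 0) :
    ∃ c : K, v = c • u := by
  obtain ⟨j, hj⟩ := Function.ne_iff.mp hu
  rw [cross_apply] at h
  have h0 := congrFun h 0
  have h1 := congrFun h 1
  have h2 := congrFun h 2
  simp at h0 h1 h2 hj
  refine ⟨v j / u j, ?_⟩
  ext k
  simp only [Pi.smul_apply, smul_eq_mul]
  rw [div_mul_eq_mul_div, eq_div_iff hj]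
  fin_cases j <;> fin_cases k <;> simp <;> grind

/-- If the columns of a matrix are pairwise proportional to `u`, it is an outer product. -/
theorem eq_vecMulVec_of_cols {A : Matrix (Fin 3) (Fin 3) K} {u : Fin 3 → K} (hu : u ≠ 0)
    (h : ∀ j, u ⨯₃ (fun i => A i j) = 0) : ∃ w, A = vecMulVec u w := by
  choose w hw using fun j => exists_smul_of_cross_eq_zero hu (h j)
  refine ⟨w, ?_⟩
  ext i j
  have := congrFun (hw j) i
  simp only [Pi.smul_apply, smul_eq_mul] at this
  rw [vecMulVec_apply, this, mul_comm]

theorem exists_orthogonal_pair (x y : Fin 3 → K) : ∃ z : Fin 3 → K, z ≠ 0 ∧ z ⬝ᵥ x = 0 ∧ z ⬝ᵥ y = 0 := by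
  have h : ∃ v, v ≠ 0 ∧ (Matrix.of ![x, y, 0] : Matrix (Fin 3) (Fin 3) K) *ᵥ v = 0 := by
    rw [exists_mulVec_eq_zero_iff, det_fin_three]
    simp
  obtain ⟨z, hz, h⟩ := h
  refine ⟨z, hz, ?_, ?_⟩
  · rw [dotProduct_comm]; exact congrFun h 0
  · rw [dotProduct_comm]; exact congrFun h 1

theorem cross_ne_zero_of_genPos {p : Fin 6 → Fin 3 → K} (hp : GenPos p) {i j : Fin 6} (hij : i ≠ j) :
    p i ⨯₃ p j ≠ 0 := by
  obtain ⟨k, hik, hjk⟩ : ∃ k : Fin 6, i ≠ k ∧ j ≠ k := by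
    revert i j; decide
  intro h
  apply hp i j k hij hik hjk
  rw [cross_apply] at h
  have h0 := congrFun h 0
  have h1 := congrFun h 1
  have h2 := congrFun h 2
  simp at h0 h1 h2
  simp only [br]
  grind

theorem ne_zero_of_genPos {p : Fin 6 → Fin 3 → K} (hp : GenPos p) (i : Fin 6) : p i ≠ 0 := by
  obtain ⟨k, hik⟩ : ∃ k : Fin 6, i ≠ k := by revert i; decide
  intro h
  exact cross_ne_zero_of_genPos hp hik (by simp [h])

/-- The linear determinantal representation `X ↦ det X` on `{X | ∀ i, qᵢᵀ X pᵢ = 0}` has no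
singular point `X` for which no kernel vector is one of the `pᵢ`. -/
theorem kernel_absurd {p q : Fin 6 → Fin 3 → K} (hp : GenPos p) (hq : GenPos q)
    (rel : ∑ i, vecMulVec (p i) (q i) = 0)
    (nc : ∀ c : Fin 6 → K, ∑ i, c i • vecMulVec (p i) (p i) = 0 → c = 0)
    {X : Matrix (Fin 3) (Fin 3) K} (hX : X ≠ 0) (h : ∀ i, q i ⬝ᵥ X *ᵥ p i = 0)
    {k : Fin 6} (hpk : X *ᵥ p k = 0) (hqk : q k ᵥ* X = 0) : False := by
  have hne : ∀ i, i ≠ k → X *ᵥ p i ≠ 0 := fun i hi h0 =>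
    cross_ne_zero_of_genPos hp hi (cross_eq_zero_of_mulVec_eq_zero hp hq hX h h0 hpk)
  have hc : ∀ i, ∃ c : K, (i ≠ k → c ≠ 0) ∧ q k ⨯₃ q i = c • X *ᵥ p i := by
    intro i
    by_cases hi : i = k
    · subst hi
      exact ⟨0, fun h => absurd rfl h, by simp⟩
    · have h1 : q k ⬝ᵥ X *ᵥ p i = 0 := by rw [dotProduct_mulVec, hqk, zero_dotProduct]
      have h2 : (X *ᵥ p i) ⨯₃ (q k ⨯₃ q i) = 0 := by
        have h3 := h i
        set y := X *ᵥ p i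
        simp only [dotProduct, Fin.sum_univ_three] at h1 h3
        rw [cross_apply, cross_apply]
        ext j
        fin_cases j <;> simp <;> grind
      obtain ⟨c, hc⟩ := exists_smul_of_cross_eq_zero (hne i hi) h2
      refine ⟨c, fun _ h0 => ?_, hc⟩
      rw [h0, zero_smul] at hc
      exact cross_ne_zero_of_genPos hq (Ne.symm hi) hc
  choose c hc0 hc using hc
  set S : Matrix (Fin 3) (Fin 3) K := ∑ i, c i • vecMulVec (p i) (p i) with hS
  have hXS : X * S = 0 := by
    have h1 : X * S = ∑ i, vecMulVec (q k ⨯₃ q i) (p i) := by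
      rw [hS, Finset.mul_sum]
      refine Finset.sum_congr rfl fun i _ => ?_
      rw [hc i, Matrix.mul_smul, mul_vecMulVec, smul_vecMulVec]
    rw [h1]
    have hr : ∀ a b, ∑ i, p i a * q i b = 0 := by
      intro a b
      have := congrFun (congrFun rel a) b
      simpa [Matrix.sum_apply, vecMulVec_apply] using this
    ext a b
    rw [Matrix.sum_apply]
    simp only [vecMulVec_apply, cross_apply, Matrix.zero_apply]
    have e0 := hr b 0
    have e1 := hr b 1
    have e2 := hr b 2
    simp only [Fin.sum_univ_six] at *
    fin_cases a <;> simp <;> grind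
  obtain ⟨w, hw⟩ := eq_vecMulVec_of_cols (A := S) (ne_zero_of_genPos hp k) (fun j => by
    refine cross_eq_zero_of_mulVec_eq_zero hp hq hX h hpk ?_
    ext i
    exact congrFun (congrFun hXS i) j)
  have hsymm : Sᵀ = S := by
    rw [hS, transpose_sum]
    refine Finset.sum_congr rfl fun i _ => ?_
    rw [transpose_smul, transpose_vecMulVec]
  have hw2 : p k ⨯₃ w = 0 := by
    have h1 : ∀ i j, p k i * w j = p k j * w i := by
      intro i j
      have := congrFun (congrFun hsymm i) j
      rw [hw] at this
      simpa [vecMulVec_apply] using this.symm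
    rw [cross_apply]
    ext j
    fin_cases j <;> simp [h1 1 2, h1 2 0, h1 0 1]
  obtain ⟨s, rfl⟩ := exists_smul_of_cross_eq_zero (ne_zero_of_genPos hp k) hw2
  obtain ⟨l, hl⟩ := exists_ne k
  have h0 := nc (Function.update c k (c k - s)) (by
    have : ∀ i, Function.update c k (c k - s) i • vecMulVec (p i) (p i) =
        c i • vecMulVec (p i) (p i) - if i = k then s • vecMulVec (p k) (p k) else 0 := by
      intro i
      by_cases hi : i = k
      · subst hi; simp [sub_smul]
      · simp [hi]
    simp only [this, Finset.sum_sub_distrib, Finset.sum_ite_eq', Finset.mem_univ, if_true]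
    rw [← hS, hw, vecMulVec_smul, sub_self])
  have := congrFun h0 l
  rw [Function.update_of_ne hl] at this
  exact hc0 l hl this

end Smooth

section Smooth

open Matrix

variable {K : Type*} [Field K]

theorem exists_smul_of_vecMulVec_eq {v w x y : Fin 3 → K} (hv : v ≠ 0) (hw : w ≠ 0) {c : K}
    (h : vecMulVec v w = c • vecMulVec x y) :
    (∃ s : K, x = s • v) ∧ ∃ s : K, y = s • w := by
  obtain ⟨a, ha⟩ := Function.ne_iff.mp hv
  obtain ⟨b, hb⟩ := Function.ne_iff.mp hw
  have hent : ∀ a b, v a * w b = c * (x a * y b) := by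
    intro a b
    have := congrFun (congrFun h a) b
    simpa [vecMulVec_apply] using this
  have h0 : c * (x a * y b) ≠ 0 := by rw [← hent]; exact mul_ne_zero ha hb
  have hc : c ≠ 0 := left_ne_zero_of_mul h0
  have hx : x a ≠ 0 := left_ne_zero_of_mul (right_ne_zero_of_mul h0)
  have hy : y b ≠ 0 := right_ne_zero_of_mul (right_ne_zero_of_mul h0)
  refine ⟨⟨w b / (c * y b), ?_⟩, ⟨v a / (c * x a), ?_⟩⟩
  · ext i
    simp only [Pi.smul_apply, smul_eq_mul]
    rw [div_mul_eq_mul_div, eq_div_iff (mul_ne_zero hc hy)]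
    linear_combination -hent i b
  · ext i
    simp only [Pi.smul_apply, smul_eq_mul]
    rw [div_mul_eq_mul_div, eq_div_iff (mul_ne_zero hc hx)]
    linear_combination -hent a i

/-- If a combination of `pᵢ qᵢᵀ` with at most two nonzero coefficients has rank one, then it
is a multiple of one `pₖ qₖᵀ`. -/
theorem rank_one_of_two_terms {p q : Fin 6 → Fin 3 → K} (hp : GenPos p) (hq : GenPos q)
    {v w : Fin 3 → K} (hv : v ≠ 0) (hw : w ≠ 0) {c : Fin 6 → K} {i j : Fin 6} (hij : i ≠ j)
    (hc : ∀ l, l ≠ i → l ≠ j → c l = 0)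
    (h : vecMulVec v w = ∑ l, c l • vecMulVec (p l) (q l)) :
    ∃ k, (∃ s : K, p k = s • v) ∧ ∃ s : K, q k = s • w := by
  have hsum : vecMulVec v w = c i • vecMulVec (p i) (q i) + c j • vecMulVec (p j) (q j) := by
    rw [h]
    refine Fintype.sum_eq_add i j hij fun l hl => ?_
    rw [hc l hl.1 hl.2, zero_smul]
  have hent : ∀ a b, v a * w b = c i * (p i a * q i b) + c j * (p j a * q j b) := by
    intro a b
    have := congrFun (congrFun hsum a) b
    simpa [vecMulVec_apply] using this
  have key : ∀ a a' b b', c i * c j * (p i a * p j a' - p i a' * p j a) *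
      (q i b * q j b' - q i b' * q j b) = 0 := by
    intro a a' b b'
    have : (v a * w b) * (v a' * w b') - (v a * w b') * (v a' * w b) = 0 := by ring
    rw [hent, hent, hent, hent] at this
    linear_combination this
  have hz : c i = 0 ∨ c j = 0 := by
    have h1 := cross_ne_zero_of_genPos hp hij
    have h2 := cross_ne_zero_of_genPos hq hij
    by_contra! hne
    have key' : ∀ a a' b b', p i a * p j a' - p i a' * p j a = 0 ∨
      q i b * q j b' - q i b' * q j b = 0 := fun a a' b b' => by
      simpa [hne.1, hne.2] using key a a' b b'
    apply h2
    obtain ⟨a, ha⟩ := Function.ne_iff.mp h1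
    obtain ⟨a1, a2, haa⟩ : ∃ a1 a2, p i a1 * p j a2 - p i a2 * p j a1 ≠ 0 := by
      rw [cross_apply] at ha
      fin_cases a
      · exact ⟨1, 2, by simpa using ha⟩
      · exact ⟨2, 0, by simpa using ha⟩
      · exact ⟨0, 1, by simpa using ha⟩
    have hq0 := fun b b' => (key' a1 a2 b b').resolve_left haa
    rw [cross_apply]
    ext b
    fin_cases b
    · simpa using hq0 1 2
    · simpa using hq0 2 0
    · simpa using hq0 0 1
  rcases hz with h0 | h0
  · rw [h0, zero_smul, zero_add] at hsum
    exact ⟨j, exists_smul_of_vecMulVec_eq hv hw hsum⟩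
  · rw [h0, zero_smul, add_zero] at hsum
    exact ⟨i, exists_smul_of_vecMulVec_eq hv hw hsum⟩

theorem exists_zeros_subset_pair {p : Fin 6 → Fin 3 → K} (hp : GenPos p) {z : Fin 3 → K}
    (hz : z ≠ 0) : ∃ i j, i ≠ j ∧ ∀ l, l ≠ i → l ≠ j → p l ⬝ᵥ z ≠ 0 := by
  by_contra! hc
  obtain ⟨i, -, -, hi⟩ := hc 0 1 (by decide)
  obtain ⟨j, hj0, -, hj⟩ := hc i (i + 1) (by simp)
  obtain ⟨k, hk0, hk1, hk⟩ := hc i j (Ne.symm hj0)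
  exact hz (eq_zero_of_br_ne_zero (hp i j k (Ne.symm hj0) (Ne.symm hk0) (Ne.symm hk1)) hi hj hk)

theorem row_cross_eq_zero {X : Matrix (Fin 3) (Fin 3) K} (h : X.adjugate = 0) (i j : Fin 3) :
    X i ⨯₃ X j = 0 := by
  have hm : ∀ a b, X.adjugate a b = 0 := fun a b => by rw [h]; rfl
  have m00 := hm 0 0
  have m01 := hm 0 1
  have m02 := hm 0 2
  have m10 := hm 1 0
  have m11 := hm 1 1
  have m12 := hm 1 2
  have m20 := hm 2 0
  have m21 := hm 2 1
  have m22 := hm 2 2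
  simp only [adjugate_fin_three, of_apply, cons_val] at m00 m01 m02 m10 m11 m12 m20 m21 m22
  rw [cross_apply]
  fin_cases i <;> fin_cases j <;>
    simp only [Fin.zero_eta, Fin.mk_one, Fin.reduceFinMk] <;>
    (ext k; fin_cases k) <;>
    simp only [Fin.zero_eta, Fin.mk_one, Fin.reduceFinMk, cons_val, Pi.zero_apply] <;>
    grind

/-- Smoothness of the determinantal cubic surface. -/
theorem singular_absurd {p q : Fin 6 → Fin 3 → K} (hp : GenPos p) (hq : GenPos q)
    (p0 : p 0 = ![1, 0, 0]) (p1 : p 1 = ![0, 1, 0]) (p2 : p 2 = ![0, 0, 1])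
    (rel : ∑ i, vecMulVec (p i) (q i) = 0)
    (nc : ∀ c : Fin 6 → K, ∑ i, c i • vecMulVec (p i) (p i) = 0 → c = 0)
    (nc' : ∀ y₁ y₂ y₃ : Fin 3 → K, (∀ i, (p i ⬝ᵥ y₁) * (p i ⬝ᵥ y₃) = (p i ⬝ᵥ y₂) ^ 2) →
      ∀ x, (x ⬝ᵥ y₁) * (x ⬝ᵥ y₃) = (x ⬝ᵥ y₂) ^ 2)
    {X : Matrix (Fin 3) (Fin 3) K} (hX : X ≠ 0) (h : ∀ i, q i ⬝ᵥ X *ᵥ p i = 0)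
    (hdet : X.det = 0) {μ : Fin 6 → K}
    (hadj : X.adjugate = ∑ i, μ i • vecMulVec (p i) (q i)) : False := by
  obtain ⟨v, hv, hXv⟩ := exists_mulVec_eq_zero_iff.mpr hdet
  obtain ⟨w, hw, hXw⟩ := exists_vecMul_eq_zero_iff.mpr hdet
  have hcols : ∀ j, v ⨯₃ (fun i => X.adjugate i j) = 0 := by
    intro j
    refine cross_eq_zero_of_mulVec_eq_zero hp hq hX h hXv ?_
    have h1 : X * X.adjugate = 0 := by rw [mul_adjugate, hdet, zero_smul]
    ext i
    exact congrFun (congrFun h1 i) j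
  obtain ⟨w', hw'⟩ := eq_vecMulVec_of_cols hv hcols
  -- the adjugate is nonzero
  have hw'0 : w' ≠ 0 := by
    rintro rfl
    have hadj0 : X.adjugate = 0 := by rw [hw']; ext; simp [vecMulVec_apply]
    obtain ⟨i, hi⟩ := Function.ne_iff.mp hX
    have hT : ∃ u, Xᵀ = vecMulVec (X i) u :=
      eq_vecMulVec_of_cols hi fun j => row_cross_eq_zero hadj0 i j
    obtain ⟨u, hu⟩ := hT
    have hu' : X = vecMulVec u (X i) := by
      rw [← transpose_vecMulVec, ← hu, transpose_transpose]
    refine rank_one_absurd hp hq (y := u) (z := X i) ?_ hi ?_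
    · rintro rfl
      exact hX (by rw [hu']; ext; simp [vecMulVec_apply])
    · intro l
      have h4 := h l
      rw [hu', vecMulVec_mulVec] at h4
      rw [← h4, dotProduct_comm (p l) (X i)]
      simp [dotProduct, Fin.sum_univ_three]
      ring
  rw [hw'] at hadj
  have hw'X : w' ᵥ* X = 0 := by
    have h1 : X.adjugate * X = 0 := by rw [adjugate_mul, hdet, zero_smul]
    rw [hw', vecMulVec_mul] at h1
    obtain ⟨a, ha⟩ := Function.ne_iff.mp hv
    ext j
    have : v a * (w' ᵥ* X) j = 0 := congrFun (congrFun h1 a) j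
    exact (mul_eq_zero.mp this).resolve_left ha
  -- the coefficients act as a diagonal matrix on the orthogonal complement of `v`
  set M : (Fin 3 → K) → (Fin 3 → K) := fun y => ![μ 0 * y 0, μ 1 * y 1, μ 2 * y 2] with hM
  have hrel : ∀ y : Fin 3 → K, ∑ i, (p i ⬝ᵥ y) • q i = 0 := by
    intro y
    have := congrArg (fun A => y ᵥ* A) rel
    simpa [vecMul_sum, vecMul_vecMulVec, dotProduct_comm] using this
  have hMp : ∀ y, y ⬝ᵥ v = 0 → ∀ i, p i ⬝ᵥ M y = μ i * (p i ⬝ᵥ y) := by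
    intro y hy
    have h1 : ∑ i, (μ i * (p i ⬝ᵥ y)) • q i = 0 := by
      have := congrArg (fun A => y ᵥ* A) hadj
      simp only [vecMul_sum, vecMul_smul, vecMul_vecMulVec, hy, zero_smul] at this
      rw [this]
      refine Finset.sum_congr rfl fun i _ => ?_
      rw [smul_smul, dotProduct_comm]
    have h2 : ∑ i, (μ i * (p i ⬝ᵥ y) - p i ⬝ᵥ M y) • q i = 0 := by
      simp only [sub_smul, Finset.sum_sub_distrib, h1, hrel, sub_zero]
    have z0 : p 0 ⬝ᵥ M y = μ 0 * (p 0 ⬝ᵥ y) := by simp [p0, hM, dotProduct, Fin.sum_univ_three]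
    have z1 : p 1 ⬝ᵥ M y = μ 1 * (p 1 ⬝ᵥ y) := by simp [p1, hM, dotProduct, Fin.sum_univ_three]
    have z2 : p 2 ⬝ᵥ M y = μ 2 * (p 2 ⬝ᵥ y) := by simp [p2, hM, dotProduct, Fin.sum_univ_three]
    rw [Fin.sum_univ_six, z0, z1, z2] at h2
    simp only [sub_self, zero_smul, zero_add] at h2
    have hq345 := hq 3 4 5 (by decide) (by decide) (by decide)
    have e0 := congrFun h2 0
    have e1 := congrFun h2 1
    have e2 := congrFun h2 2
    simp only [Pi.add_apply, Pi.smul_apply, smul_eq_mul, Pi.zero_apply] at e0 e1 e2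
    set c3 := μ 3 * (p 3 ⬝ᵥ y) - p 3 ⬝ᵥ M y with hc3
    set c4 := μ 4 * (p 4 ⬝ᵥ y) - p 4 ⬝ᵥ M y with hc4
    set c5 := μ 5 * (p 5 ⬝ᵥ y) - p 5 ⬝ᵥ M y with hc5
    have k3 : br (q 3) (q 4) (q 5) * c3 = 0 := by simp only [br]; grind
    have k4 : br (q 3) (q 4) (q 5) * c4 = 0 := by simp only [br]; grind
    have k5 : br (q 3) (q 4) (q 5) * c5 = 0 := by simp only [br]; grind
    replace k3 := (mul_eq_zero.mp k3).resolve_left hq345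
    replace k4 := (mul_eq_zero.mp k4).resolve_left hq345
    replace k5 := (mul_eq_zero.mp k5).resolve_left hq345
    intro i
    fin_cases i
    · exact z0
    · exact z1
    · exact z2
    · exact (sub_eq_zero.mp k3).symm
    · exact (sub_eq_zero.mp k4).symm
    · exact (sub_eq_zero.mp k5).symm
  obtain ⟨y, hy, hyv, hyM⟩ := exists_orthogonal_pair v ![μ 0 * v 0, μ 1 * v 1, μ 2 * v 2]
  have hMv : M y ⬝ᵥ v = 0 := by
    rw [← hyM]
    simp [hM, dotProduct, Fin.sum_univ_three]
    ring
  have hquad := nc' y (M y) (M (M y)) (fun i => by rw [hMp _ hMv, hMp _ hyv]; ring)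
  have hcr : y ⨯₃ M y = 0 := by
    have hz : ∀ x, x ⬝ᵥ y = 0 → x ⬝ᵥ M y = 0 := by
      intro x hx
      have := hquad x
      rw [hx, zero_mul] at this
      exact pow_eq_zero_iff (two_ne_zero) |>.mp this.symm
    have a0 := hz ![0, y 2, -y 1] (by simp [dotProduct, Fin.sum_univ_three]; ring)
    have a1 := hz ![-y 2, 0, y 0] (by simp [dotProduct, Fin.sum_univ_three]; ring)
    have a2 := hz ![y 1, -y 0, 0] (by simp [dotProduct, Fin.sum_univ_three]; ring)
    simp only [dotProduct, Fin.sum_univ_three, cons_val] at a0 a1 a2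
    rw [cross_apply]
    ext j
    fin_cases j
    · simp; linear_combination -a0
    · simp; linear_combination -a1
    · simp; linear_combination -a2
  obtain ⟨τ, hτ⟩ := exists_smul_of_cross_eq_zero hy hcr
  obtain ⟨i, j, hij, hl⟩ := exists_zeros_subset_pair hp hy
  have hμ : ∀ l, l ≠ i → l ≠ j → μ l - τ = 0 := by
    intro l h1 h2
    have h3 := hMp y hyv l
    rw [hτ, dotProduct_smul, smul_eq_mul] at h3
    rw [sub_eq_zero]
    exact (mul_right_cancel₀ (hl l h1 h2) h3).symm
  have hsum : vecMulVec v w' = ∑ l, (μ l - τ) • vecMulVec (p l) (q l) := by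
    simp only [sub_smul, Finset.sum_sub_distrib, ← Finset.smul_sum, rel, smul_zero, sub_zero, hadj]
  obtain ⟨k, ⟨s, hs⟩, s', hs'⟩ := rank_one_of_two_terms hp hq hv hw'0 hij hμ hsum
  refine kernel_absurd hp hq rel nc hX h (k := k) ?_ ?_
  · rw [hs, mulVec_smul, hXv, smul_zero]
  · rw [hs', smul_vecMul, hw'X, smul_zero]

end Smooth

section NormalForm

open Matrix

/-- The genericity conditions for the six points `e₀, e₁, e₂, (1,1,1), (1,a,c), (1,b,d)`:
no three collinear, not all on a conic. -/
structure NFGen {K : Type*} [Field K] (a b c d : K) : Prop where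
  a0 : a ≠ 0
  b0 : b ≠ 0
  c0 : c ≠ 0
  d0 : d ≠ 0
  a1 : a - 1 ≠ 0
  b1 : b - 1 ≠ 0
  c1 : c - 1 ≠ 0
  d1 : d - 1 ≠ 0
  ab : a - b ≠ 0
  cd : c - d ≠ 0
  ac : a - c ≠ 0
  bd : b - d ≠ 0
  adbc : a * d - b * c ≠ 0
  det : (a - 1) * (d - 1) - (b - 1) * (c - 1) ≠ 0
  conic : b * d * (a - c) + b * c * (1 - a) + d * a * (c - 1) ≠ 0

variable {K : Type*} [Field K]

theorem NFGen.map {K' : Type*} [Field K'] (f : K →+* K') {a b c d : K} (h : NFGen a b c d) :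
    NFGen (f a) (f b) (f c) (f d) := by
  have key : ∀ x y, x ≠ 0 → f x = y → y ≠ 0 := fun x y hx hy => hy ▸ (map_ne_zero f).mpr hx
  constructor
  · exact key _ _ h.a0 (by simp)
  · exact key _ _ h.b0 (by simp)
  · exact key _ _ h.c0 (by simp)
  · exact key _ _ h.d0 (by simp)
  · exact key _ _ h.a1 (by simp)
  · exact key _ _ h.b1 (by simp)
  · exact key _ _ h.c1 (by simp)
  · exact key _ _ h.d1 (by simp)
  · exact key _ _ h.ab (by simp)
  · exact key _ _ h.cd (by simp)
  · exact key _ _ h.ac (by simp)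
  · exact key _ _ h.bd (by simp)
  · exact key _ _ h.adbc (by simp)
  · exact key _ _ h.det (by simp)
  · exact key _ _ h.conic (by simp)

def nfP (a b c d : K) : Fin 6 → Fin 3 → K :=
  ![![1, 0, 0], ![0, 1, 0], ![0, 0, 1], ![1, 1, 1], ![1, a, c], ![1, b, d]]

def nfD (a b c d : K) : K := (a - 1) * (d - 1) - (b - 1) * (c - 1)

def nfQ (a b c d : K) : Fin 6 → Fin 3 → K :=
  ![![-nfD a b c d, 0, 0], ![0, -nfD a b c d, 0], ![0, 0, -nfD a b c d],
    ![a * d - b * c, c - d, b - a], ![b - d, d - 1, 1 - b], ![c - a, 1 - c, a - 1]]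

theorem nfP_genPos {a b c d : K} (h : NFGen a b c d) : GenPos (nfP a b c d) := by
  obtain ⟨a0, b0, c0, d0, a1, b1, c1, d1, ab, cd, ac, bd, adbc, det, -⟩ := h
  refine GenPos.of_lt fun i j k hij hjk => ?_
  fin_cases i <;> fin_cases j <;> (try exact absurd hij (by decide)) <;> fin_cases k <;>
    (try exact absurd hjk (by decide)) <;> simp [br, nfP] <;> grind

theorem nfQ_genPos {a b c d : K} (h : NFGen a b c d) : GenPos (nfQ a b c d) := by
  obtain ⟨a0, b0, c0, d0, a1, b1, c1, d1, ab, cd, ac, bd, adbc, det, -⟩ := h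
  have hD : nfD a b c d ≠ 0 := det
  refine GenPos.of_lt fun i j k hij hjk => ?_
  fin_cases i <;> fin_cases j <;> (try exact absurd hij (by decide)) <;> fin_cases k <;>
    (try exact absurd hjk (by decide)) <;> simp [br, nfQ] <;> grind

end NormalForm

section NormalForm

open Matrix

section Ring

variable {R : Type*} [CommRing R]

def nfN (a b c d : R) (x : Fin 4 → R) : R :=
  (a * d - b * c) * ((d - 1) * (x 0 + c * x 1) + (1 - b) * (x 2 + a * x 3)) -
    c * (b - d) * ((c - d) * (x 0 + x 1) + (b - a) * (x 2 + x 3))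

def nfM (a b c d : R) (x : Fin 4 → R) : R :=
  a * (b - d) * ((c - d) * (x 0 + x 1) + (b - a) * (x 2 + x 3)) -
    (a * d - b * c) * ((d - 1) * (x 0 + c * x 1) + (1 - b) * (x 2 + a * x 3))

def nfK (a b c d : R) : R := (a * d - b * c) * (b - d) * (c - a)

/-- The determinantal representation of a cubic surface attached to six points of the plane. -/
def nfT (a b c d : R) (x : Fin 4 → R) : Matrix (Fin 3) (Fin 3) R :=
  !![0, nfN a b c d x, nfM a b c d x;
     nfK a b c d * x 0, 0, nfK a b c d * x 1;
     nfK a b c d * x 2, nfK a b c d * x 3, 0]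

def nfF (a b c d : R) (x : Fin 4 → R) : R :=
  nfN a b c d x * x 1 * x 2 + nfM a b c d x * x 0 * x 3

theorem nfT_det (a b c d : R) (x : Fin 4 → R) :
    (nfT a b c d x).det = nfK a b c d ^ 2 * nfF a b c d x := by
  simp [det_fin_three, nfT, nfF]
  ring

end Ring

variable {K : Type*} [Field K]

theorem NFGen.k0 {a b c d : K} (h : NFGen a b c d) : nfK a b c d ≠ 0 :=
  mul_ne_zero (mul_ne_zero h.adbc h.bd) (by have := h.ac; grind)

theorem nf_rel (a b c d : K) : ∑ i, vecMulVec (nfP a b c d i) (nfQ a b c d i) = 0 := by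
  ext i j
  simp only [Fin.sum_univ_six, Matrix.add_apply, vecMulVec_apply]
  fin_cases i <;> fin_cases j <;> simp [nfP, nfQ, nfD] <;> ring

theorem nf_nonconic {a b c d : K} (h : NFGen a b c d) (k : Fin 6 → K)
    (hk : ∑ i, k i • vecMulVec (nfP a b c d i) (nfP a b c d i) = 0) : k = 0 := by
  have he : ∀ i j, ∑ l, k l * (nfP a b c d l i * nfP a b c d l j) = 0 := by
    intro i j
    have := congrFun (congrFun hk i) j
    simpa [Matrix.sum_apply, vecMulVec_apply] using this
  have e00 := he 0 0
  have e01 := he 0 1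
  have e02 := he 0 2
  have e11 := he 1 1
  have e12 := he 1 2
  have e22 := he 2 2
  simp [Fin.sum_univ_six, nfP] at e00 e01 e02 e11 e12 e22
  have hc := h.conic
  have k3 : (b * d * (a - c) + b * c * (1 - a) + d * a * (c - 1)) * k 3 = 0 := by
    linear_combination 
      (-(b * d * c) + d * a * c) * e01 + (b * d * a - b * a * c) * e02 + (b * c - a * d) * e12
  have k4 : (b * d * (a - c) + b * c * (1 - a) + d * a * (c - 1)) * k 4 = 0 := by
    linear_combination (b * d - d) * e01 - (b * d - b) * e02 + (d - b) * e12
  have k5 : (b * d * (a - c) + b * c * (1 - a) + d * a * (c - 1)) * k 5 = 0 := by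
    linear_combination -(a * c - c) * e01 + (a * c - a) * e02 - (c - a) * e12
  replace k3 := (mul_eq_zero.mp k3).resolve_left hc
  replace k4 := (mul_eq_zero.mp k4).resolve_left hc
  replace k5 := (mul_eq_zero.mp k5).resolve_left hc
  simp only [k3, k4, k5, zero_mul, add_zero] at e00 e11 e22
  ext i
  fin_cases i
  exacts [e00, e11, e22, k3, k4, k5]

theorem nf_nonconic' {a b c d : K} (h : NFGen a b c d) (y₁ y₂ y₃ : Fin 3 → K)
    (hy : ∀ i, (nfP a b c d i ⬝ᵥ y₁) * (nfP a b c d i ⬝ᵥ y₃) = (nfP a b c d i ⬝ᵥ y₂) ^ 2)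
    (x : Fin 3 → K) : (x ⬝ᵥ y₁) * (x ⬝ᵥ y₃) = (x ⬝ᵥ y₂) ^ 2 := by
  have h0 := hy 0
  have h1 := hy 1
  have h2 := hy 2
  have h3 := hy 3
  have h4 := hy 4
  have h5 := hy 5
  simp [nfP, dotProduct, Fin.sum_univ_three] at h0 h1 h2 h3 h4 h5
  simp only [dotProduct, Fin.sum_univ_three]
  have hc := h.conic
  set u := y₁ 0 * y₃ 1 + y₁ 1 * y₃ 0 - 2 * y₂ 0 * y₂ 1 with hu
  set v := y₁ 0 * y₃ 2 + y₁ 2 * y₃ 0 - 2 * y₂ 0 * y₂ 2 with hv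
  set w := y₁ 1 * y₃ 2 + y₁ 2 * y₃ 1 - 2 * y₂ 1 * y₂ 2 with hw
  have e3 : u + v + w = 0 := by rw [hu, hv, hw]; linear_combination h3 - h0 - h1 - h2
  have e4 : a * u + c * v + a * c * w = 0 := by
    rw [hu, hv, hw]; linear_combination h4 - h0 - a ^ 2 * h1 - c ^ 2 * h2
  have e5 : b * u + d * v + b * d * w = 0 := by
    rw [hu, hv, hw]; linear_combination h5 - h0 - b ^ 2 * h1 - d ^ 2 * h2
  have ku : (b * d * (a - c) + b * c * (1 - a) + d * a * (c - 1)) * u = 0 := by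
    linear_combination (-(b * d * c) + d * a * c) * e3 + (b * d - d) * e4 - (a * c - c) * e5
  have kv : (b * d * (a - c) + b * c * (1 - a) + d * a * (c - 1)) * v = 0 := by
    linear_combination (b * d * a - b * a * c) * e3 - (b * d - b) * e4 + (a * c - a) * e5
  have kw : (b * d * (a - c) + b * c * (1 - a) + d * a * (c - 1)) * w = 0 := by
    linear_combination (b * c - a * d) * e3 + (d - b) * e4 - (c - a) * e5
  replace ku := (mul_eq_zero.mp ku).resolve_left hc
  replace kv := (mul_eq_zero.mp kv).resolve_left hc
  replace kw := (mul_eq_zero.mp kw).resolve_left hc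
  rw [hu] at ku
  rw [hv] at kv
  rw [hw] at kw
  linear_combination x 0 ^ 2 * h0 + x 1 ^ 2 * h1 + x 2 ^ 2 * h2 + x 0 * x 1 * ku +
    x 0 * x 2 * kv + x 1 * x 2 * kw

theorem nfT_mem (a b c d : K) (x : Fin 4 → K) (i : Fin 6) :
    nfQ a b c d i ⬝ᵥ nfT a b c d x *ᵥ nfP a b c d i = 0 := by
  fin_cases i <;> simp [nfQ, nfP, nfT, nfN, nfM, nfK, nfD, dotProduct, mulVec,
    Fin.sum_univ_three] <;> ring

theorem nfT_surj {a b c d : K} (hD : nfD a b c d ≠ 0) (hk : nfK a b c d ≠ 0)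
    {X : Matrix (Fin 3) (Fin 3) K} (hX : ∀ i, nfQ a b c d i ⬝ᵥ X *ᵥ nfP a b c d i = 0) :
    ∃ x, nfT a b c d x = X := by
  have h0 := hX 0
  have h1 := hX 1
  have h2 := hX 2
  have h3 := hX 3
  have h4 := hX 4
  simp [nfQ, nfP, dotProduct, mulVec, Fin.sum_univ_three, hD] at h0 h1 h2 h3 h4
  rw [h0, h1, h2] at h3 h4
  refine ⟨fun i => ![X 1 0, X 1 2, X 2 0, X 2 1] i / nfK a b c d, ?_⟩
  have hk' := hk
  rw [nfK] at hk'
  ext i j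
  fin_cases i <;> fin_cases j <;> simp [nfT, nfN, nfM, h0, h1, h2, mul_div_cancel₀, hk]
  · field_simp
    rw [nfK]
    linear_combination (a * d - b * c) * h4 - c * (b - d) * h3
  · field_simp
    rw [nfK]
    linear_combination a * (b - d) * h3 - (a * d - b * c) * h4

theorem nfT_eq_zero {a b c d : K} (hk : nfK a b c d ≠ 0) {x : Fin 4 → K}
    (hx : nfT a b c d x = 0) : x = 0 := by
  have h0 := congrFun (congrFun hx 1) 0
  have h1 := congrFun (congrFun hx 1) 2
  have h2 := congrFun (congrFun hx 2) 0
  have h3 := congrFun (congrFun hx 2) 1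
  simp [nfT, hk] at h0 h1 h2 h3
  ext i
  fin_cases i
  exacts [h0, h1, h2, h3]

end NormalForm

section NormalForm

open Matrix

variable {K : Type*} [Field K]

/-- The derivative of `nfF` at `x` in the direction `y`. -/
def nfdF (a b c d : K) (x y : Fin 4 → K) : K :=
  nfN a b c d y * x 1 * x 2 + nfN a b c d x * y 1 * x 2 + nfN a b c d x * x 1 * y 2 +
    (nfM a b c d y * x 0 * x 3 + nfM a b c d x * y 0 * x 3 + nfM a b c d x * x 0 * y 3)

theorem trace_adjugate_nfT (a b c d : K) (x y : Fin 4 → K) :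
    ((nfT a b c d x).adjugate * nfT a b c d y).trace = nfK a b c d ^ 2 * nfdF a b c d x y := by
  simp [trace_fin_three, adjugate_fin_three, nfT, nfdF]
  ring

theorem nfF_smooth {a b c d : K} (h : NFGen a b c d) {z : Fin 4 → K} (hz : z ≠ 0)
    (hF : nfF a b c d z = 0) (hdF : ∀ y, nfdF a b c d z y = 0) : False := by
  have hX : nfT a b c d z ≠ 0 := fun h0 => hz (nfT_eq_zero h.k0 h0)
  set A := (nfT a b c d z).adjugate with hA
  set f : Fin 6 → Matrix (Fin 3) (Fin 3) K →ₗ[K] K := fun i =>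
    (dotProductBilin K K (nfQ a b c d i)) ∘ₗ ((mulVecBilin K K).flip (nfP a b c d i)) with hf
  set g : Matrix (Fin 3) (Fin 3) K →ₗ[K] K := (traceLinearMap (Fin 3) K K) ∘ₗ
    (LinearMap.mulLeft K A) with hg
  have hfi : ∀ i Y, f i Y = nfQ a b c d i ⬝ᵥ Y *ᵥ nfP a b c d i := fun i Y => rfl
  have hgi : ∀ Y, g Y = (A * Y).trace := fun Y => rfl
  have hspan : g ∈ Submodule.span K (Set.range f) := by
    refine mem_span_of_iInf_ker_le_ker fun Y hY => ?_
    simp only [Submodule.mem_iInf, LinearMap.mem_ker, hfi] at hY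
    obtain ⟨y, rfl⟩ := nfT_surj h.det h.k0 hY
    rw [LinearMap.mem_ker, hgi, trace_adjugate_nfT, hdF, mul_zero]
  obtain ⟨μ, hμ⟩ := (Submodule.mem_span_range_iff_exists_fun K).mp hspan
  have hadj : A = ∑ i, μ i • vecMulVec (nfP a b c d i) (nfQ a b c d i) := by
    ext i j
    have h1 : g (Matrix.single j i 1) = A i j := by
      rw [hgi, trace_mul_single]
      simp
    rw [← h1, ← hμ]
    simp only [LinearMap.sum_apply, LinearMap.smul_apply, hfi, Matrix.sum_apply, smul_eq_mul,
      Matrix.smul_apply, vecMulVec_apply]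
    refine Finset.sum_congr rfl fun l _ => ?_
    congr 1
    fin_cases i <;> fin_cases j <;>
      simp [mulVec, dotProduct, Fin.sum_univ_three, Matrix.single_apply] <;> ring
  exact singular_absurd (nfP_genPos h) (nfQ_genPos h) rfl rfl rfl (nf_rel a b c d)
    (nf_nonconic h) (nf_nonconic' h) hX (nfT_mem a b c d z)
    (by rw [nfT_det, hF, mul_zero]) hadj

/-- The cubic form `nfF` as a polynomial. -/
noncomputable def nfPoly (a b c d : K) : MvPolynomial (Fin 4) K :=
  nfF (MvPolynomial.C a) (MvPolynomial.C b) (MvPolynomial.C c) (MvPolynomial.C d) MvPolynomial.X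

theorem eval_nfPoly (a b c d : K) (x : Fin 4 → K) :
    MvPolynomial.eval x (nfPoly a b c d) = nfF a b c d x := by
  simp [nfPoly, nfF, nfN, nfM]

theorem map_nfPoly {K' : Type*} [Field K'] (f : K →+* K') (a b c d : K) :
    MvPolynomial.map f (nfPoly a b c d) = nfPoly (f a) (f b) (f c) (f d) := by
  simp [nfPoly, nfF, nfN, nfM]

theorem sum_pderiv_nfPoly (a b c d : K) (x y : Fin 4 → K) :
    ∑ j, y j * MvPolynomial.eval x (MvPolynomial.pderiv j (nfPoly a b c d)) = nfdF a b c d x y := by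
  simp [nfPoly, nfF, nfN, nfM, Fin.sum_univ_four, MvPolynomial.pderiv_X, nfdF, Pi.single_apply,
    Derivation.leibniz]
  ring

theorem nfPoly_isHomogeneous (a b c d : K) : (nfPoly a b c d).IsHomogeneous 3 := by
  have hX := fun i : Fin 4 => MvPolynomial.isHomogeneous_X K i
  have hC := fun x : K => MvPolynomial.isHomogeneous_C (Fin 4) x
  have key : ∀ n m : Fin 4 → K,
      ((∑ i, MvPolynomial.C (n i) * MvPolynomial.X i) * MvPolynomial.X 1 * MvPolynomial.X 2 +
        (∑ i, MvPolynomial.C (m i) * MvPolynomial.X i) * MvPolynomial.X 0 *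
          MvPolynomial.X 3 : MvPolynomial (Fin 4) K).IsHomogeneous 3 := by
    intro n m
    have hs : ∀ n : Fin 4 → K, (∑ i, MvPolynomial.C (n i) * MvPolynomial.X i :
        MvPolynomial (Fin 4) K).IsHomogeneous 1 := fun n =>
      MvPolynomial.IsHomogeneous.sum _ _ _ fun i _ => by simpa using (hC (n i)).mul (hX i)
    exact (((hs n).mul (hX 1)).mul (hX 2)).add (((hs m).mul (hX 0)).mul (hX 3))
  convert key (fun i => nfN a b c d (Pi.single i 1)) (fun i => nfM a b c d (Pi.single i 1)) using 1
  simp [nfPoly, nfF, nfN, nfM, Fin.sum_univ_four]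
  ring

end NormalForm

section NormalForm

open Matrix

/-- First spanning vectors of the six lines of the normal form. -/
def nfV (a b c d : ℝ) : Fin 6 → V4 :=
  ![![0, 1, 0, 0],
    ![(a * d - b * c) * ((d - 1) * c) - c * (b - d) * (c - d),
      -((a * d - b * c) * (d - 1) - c * (b - d) * (c - d)), 0, 0],
    ![0, 0, a * (b - d) * (b - a) - (a * d - b * c) * ((1 - b) * a),
      -(a * (b - d) * (b - a) - (a * d - b * c) * (1 - b))],
    ![-1, 1, 0, 0], ![-c, 1, 0, 0], ![-d, 1, 0, 0]]

/-- Second spanning vectors of the six lines of the normal form. -/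
def nfW (a b c d : ℝ) : Fin 6 → V4 :=
  ![![0, 0, 0, 1],
    ![(c - d) * (1 - b) - (b - a) * (c * (d - 1)), (b - a) * (d - 1) - (c - d) * (1 - b),
      (c - d) * (d - 1) * (c - 1), 0],
    ![(b - a) * (1 - b) * (a - 1), 0, (b - a) * (d - 1) - (c - d) * (a * (1 - b)),
      (c - d) * (1 - b) - (b - a) * (d - 1)],
    ![0, 0, -1, 1], ![0, 0, -a, 1], ![0, 0, -b, 1]]

/-- The six lines of the normal form. -/
def nfL (a b c d : ℝ) (i : Fin 6) : PLine := span ℝ {nfV a b c d i, nfW a b c d i}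

theorem nfT_smul_add (a b c d s t : ℝ) (x y : V4) :
    nfT a b c d (s • x + t • y) = s • nfT a b c d x + t • nfT a b c d y := by
  ext i j
  fin_cases i <;> fin_cases j <;> simp [nfT, nfN, nfM] <;> ring

theorem nfT_nfV (a b c d : ℝ) (i : Fin 6) :
    nfT a b c d (nfV a b c d i) *ᵥ nfP a b c d i = 0 := by
  ext j
  fin_cases i <;> fin_cases j <;>
    simp [nfT, nfN, nfM, nfK, nfV, nfP, mulVec, dotProduct, Fin.sum_univ_three] <;> ring

theorem nfT_nfW (a b c d : ℝ) (i : Fin 6) :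
    nfT a b c d (nfW a b c d i) *ᵥ nfP a b c d i = 0 := by
  ext j
  fin_cases i <;> fin_cases j <;>
    simp [nfT, nfN, nfM, nfK, nfW, nfP, mulVec, dotProduct, Fin.sum_univ_three] <;> ring

theorem mem_nfL {a b c d : ℝ} (h : NFGen a b c d) (i : Fin 6) (x : V4) :
    x ∈ nfL a b c d i ↔ nfT a b c d x *ᵥ nfP a b c d i = 0 := by
  rw [nfL, mem_span_pair]
  constructor
  · rintro ⟨s, t, rfl⟩
    rw [nfT_smul_add, add_mulVec, smul_mulVec, smul_mulVec, nfT_nfV, nfT_nfW]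
    simp
  · intro hx
    have hk := h.k0
    have e0 := congrFun hx 0
    have e1 := congrFun hx 1
    have e2 := congrFun hx 2
    fin_cases i
    · simp [nfT, nfP, mulVec, dotProduct, Fin.sum_univ_three, hk] at e1 e2
      refine ⟨x 1, x 3, ?_⟩
      ext j
      fin_cases j <;> simp [nfV, nfW, e1, e2]
    · simp [nfT, nfP, mulVec, dotProduct, Fin.sum_univ_three, hk] at e0 e2
      have hg : (c - d) * (d - 1) * (c - 1) ≠ 0 := mul_ne_zero (mul_ne_zero h.cd h.d1) h.c1
      obtain ⟨s, hs⟩ := mul_left_surjective₀ (mul_ne_zero hk hg) (-nfM a b c d x)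
      obtain ⟨t, ht⟩ := mul_left_surjective₀ hg (x 2)
      refine ⟨s, t, ?_⟩
      simp only [nfN, nfM, nfK, e2] at e0 hs hk
      ext j
      refine mul_left_cancel₀ (mul_ne_zero hk hg) ?_
      fin_cases j <;> simp [nfV, nfW, e2, -mul_eq_mul_left_iff]
      · linear_combination ((a * d - b * c) * ((d - 1) * c) - c * (b - d) * (c - d)) * hs +
          (a * d - b * c) * (b - d) * (c - a) * ((c - d) * (1 - b) - (b - a) * (c * (d - 1))) * ht -
          (a * (b - d) * (c - d) - (a * d - b * c) * ((d - 1) * c)) * e0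
      · linear_combination -((a * d - b * c) * (d - 1) - c * (b - d) * (c - d)) * hs +
          (a * d - b * c) * (b - d) * (c - a) * ((b - a) * (d - 1) - (c - d) * (1 - b)) * ht +
          (a * (b - d) * (c - d) - (a * d - b * c) * (d - 1)) * e0
      · linear_combination (a * d - b * c) * (b - d) * (c - a) * ((c - d) * (d - 1) * (c - 1)) * ht
    · simp [nfT, nfP, mulVec, dotProduct, Fin.sum_univ_three, hk] at e0 e1
      have hg : (b - a) * (1 - b) * (a - 1) ≠ 0 := by
        have := h.ab
        have := h.b1
        have := h.a1
        grind
      obtain ⟨s, hs⟩ := mul_left_surjective₀ (mul_ne_zero hk hg) (nfN a b c d x)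
      obtain ⟨t, ht⟩ := mul_left_surjective₀ hg (x 0)
      refine ⟨s, t, ?_⟩
      simp only [nfN, nfM, nfK, e1] at e0 hs hk
      ext j
      refine mul_left_cancel₀ (mul_ne_zero hk hg) ?_
      fin_cases j <;> simp [nfV, nfW, e1, -mul_eq_mul_left_iff]
      · linear_combination (a * d - b * c) * (b - d) * (c - a) * ((b - a) * (1 - b) * (a - 1)) * ht
      · linear_combination (a * (b - d) * (b - a) - (a * d - b * c) * ((1 - b) * a)) * hs +
          (a * d - b * c) * (b - d) * (c - a) * ((b - a) * (d - 1) - (c - d) * (a * (1 - b))) * ht +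
          ((a * d - b * c) * ((1 - b) * a) - c * (b - d) * (b - a)) * e0
      · linear_combination -(a * (b - d) * (b - a) - (a * d - b * c) * (1 - b)) * hs +
          (a * d - b * c) * (b - d) * (c - a) * ((c - d) * (1 - b) - (b - a) * (d - 1)) * ht -
          ((a * d - b * c) * (1 - b) - c * (b - d) * (b - a)) * e0
    · simp [nfT, nfP, mulVec, dotProduct, Fin.sum_univ_three] at e1 e2
      have f1 : x 0 = -x 1 := mul_left_cancel₀ hk (by linear_combination e1)
      have f2 : x 2 = -x 3 := mul_left_cancel₀ hk (by linear_combination e2)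
      refine ⟨x 1, x 3, ?_⟩
      ext j
      fin_cases j <;> simp [nfV, nfW, f1, f2]
    · simp [nfT, nfP, mulVec, dotProduct, Fin.sum_univ_three] at e1 e2
      have f1 : x 0 = -(x 1 * c) := mul_left_cancel₀ hk (by linear_combination e1)
      have f2 : x 2 = -(x 3 * a) := mul_left_cancel₀ hk (by linear_combination e2)
      refine ⟨x 1, x 3, ?_⟩
      ext j
      fin_cases j <;> simp [nfV, nfW, f1, f2]
    · simp [nfT, nfP, mulVec, dotProduct, Fin.sum_univ_three] at e1 e2
      have f1 : x 0 = -(x 1 * d) := mul_left_cancel₀ hk (by linear_combination e1)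
      have f2 : x 2 = -(x 3 * b) := mul_left_cancel₀ hk (by linear_combination e2)
      refine ⟨x 1, x 3, ?_⟩
      ext j
      fin_cases j <;> simp [nfV, nfW, f1, f2]

end NormalForm

section NormalForm

open Matrix

theorem nf_linearIndependent {a b c d : ℝ} (h : NFGen a b c d) (i : Fin 6) :
    LinearIndependent ℝ ![nfV a b c d i, nfW a b c d i] := by
  rw [LinearIndependent.pair_iff]
  intro s t hst
  have e0 := congrFun hst 0
  have e1 := congrFun hst 1
  have e2 := congrFun hst 2
  have e3 := congrFun hst 3
  fin_cases i
  · simp [nfV, nfW] at e1 e3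
    exact ⟨e1, e3⟩
  · have hg : (c - d) * (d - 1) * (c - 1) ≠ 0 := mul_ne_zero (mul_ne_zero h.cd h.d1) h.c1
    simp only [nfV, nfW, Pi.add_apply, Pi.smul_apply, cons_val, smul_eq_mul, Pi.zero_apply,
      Fin.mk_one] at e0 e1 e2
    have ht : t = 0 := by simpa [hg] using e2
    subst ht
    have : s * ((a * d - b * c) * (d - 1) * (c - 1)) = 0 := by linear_combination e0 + e1
    exact ⟨(mul_eq_zero.mp this).resolve_right
      (mul_ne_zero (mul_ne_zero h.adbc h.d1) h.c1), rfl⟩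
  · have hg : (b - a) * (1 - b) * (a - 1) ≠ 0 := by
      have := h.ab
      have := h.b1
      have := h.a1
      grind
    simp only [nfV, nfW, Pi.add_apply, Pi.smul_apply, cons_val, smul_eq_mul, Pi.zero_apply,
      Fin.reduceFinMk] at e0 e2 e3
    have ht : t = 0 := by simpa [hg] using e0
    subst ht
    have : s * ((a * d - b * c) * (b - 1) * (a - 1)) = 0 := by linear_combination e2 + e3
    exact ⟨(mul_eq_zero.mp this).resolve_right
      (mul_ne_zero (mul_ne_zero h.adbc h.b1) h.a1), rfl⟩
  all_goals
    simp [nfV, nfW] at e1 e3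
    exact ⟨e1, e3⟩

theorem finrank_span_pair {v w : V4} (h : LinearIndependent ℝ ![v, w]) :
    Module.finrank ℝ (span ℝ {v, w}) = 2 := by
  have := finrank_span_eq_card h
  rwa [range_cons_cons_empty, Fintype.card_fin] at this

theorem nf_pairwiseSkew {a b c d : ℝ} (h : NFGen a b c d) : PairwiseSkew (nfL a b c d) := by
  intro i j hij
  refine ⟨finrank_span_pair (nf_linearIndependent h i),
    finrank_span_pair (nf_linearIndependent h j), ?_⟩
  rw [eq_bot_iff]
  rintro x ⟨hxi, hxj⟩
  rw [SetLike.mem_coe, mem_nfL h] at hxi hxj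
  rw [mem_bot]
  refine nfT_eq_zero h.k0 ?_
  by_contra hX
  exact cross_ne_zero_of_genPos (nfP_genPos h) hij
    (cross_eq_zero_of_mulVec_eq_zero (nfP_genPos h) (nfQ_genPos h) hX (nfT_mem a b c d x) hxi hxj)

theorem nf_isSchlafliSix {a b c d : ℝ} (h : NFGen a b c d) : IsSchlafliSix (nfL a b c d) := by
  have hsm : ∀ z : Fin 4 → ℂ, z ≠ 0 →
      MvPolynomial.eval z (MvPolynomial.map (algebraMap ℝ ℂ) (nfPoly a b c d)) = 0 →
      ∃ j : Fin 4, MvPolynomial.eval z (MvPolynomial.map (algebraMap ℝ ℂ)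
        (MvPolynomial.pderiv j (nfPoly a b c d))) ≠ 0 := by
    intro z hz hF
    by_contra! hd
    rw [map_nfPoly, eval_nfPoly] at hF
    refine nfF_smooth (h.map (algebraMap ℝ ℂ)) hz hF fun y => ?_
    rw [← sum_pderiv_nfPoly]
    refine Finset.sum_eq_zero fun j _ => ?_
    have := hd j
    rw [← MvPolynomial.pderiv_map, map_nfPoly] at this
    rw [this, mul_zero]
  refine ⟨nf_pairwiseSkew h, nfPoly a b c d, ?_, nfPoly_isHomogeneous a b c d, ?_, hsm⟩
  · intro h0
    obtain ⟨j, hj⟩ := hsm 1 one_ne_zero (by rw [h0]; simp)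
    rw [h0] at hj
    simp at hj
  · intro i x hx
    rw [mem_nfL h] at hx
    rw [eval_nfPoly]
    have h1 : (nfT a b c d x).det = 0 :=
      exists_mulVec_eq_zero_iff.mp ⟨_, ne_zero_of_genPos (nfP_genPos h) i, hx⟩
    rw [nfT_det] at h1
    exact (mul_eq_zero.mp h1).resolve_left (pow_ne_zero 2 h.k0)

end NormalForm

section Linking

open Matrix

theorem det2_smul_add (a b c d : ℝ) (v w x y : V4) :
    det2 (a • v + b • w) (c • v + d • w) x y = (a * d - b * c) * det2 v w x y := by
  simp [det2, det_succ_row_zero, Fin.sum_univ_succ, Fin.succAbove]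
  ring

theorem det2_swap (v w x y : V4) : det2 x y v w = det2 v w x y := by
  simp [det2, det_succ_row_zero, Fin.sum_univ_succ, Fin.succAbove]
  ring

theorem det2_map (A : V4 →ₗ[ℝ] V4) (v w x y : V4) :
    det2 (A v) (A w) (A x) (A y) = LinearMap.det A * det2 v w x y := by
  rw [← LinearMap.det_toMatrix', det2, det2, mul_comm, ← det_transpose (LinearMap.toMatrix' A),
    ← det_mul]
  congr 1
  have h : ∀ u : V4, A u = u ᵥ* (LinearMap.toMatrix' A)ᵀ := by
    intro u
    rw [vecMul_transpose, LinearMap.toMatrix'_mulVec]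
  ext i j
  fin_cases i
  exacts [congrFun (h v) j, congrFun (h w) j, congrFun (h x) j, congrFun (h y) j]

/-- The product of determinants whose sign is the linking number of three lines. -/
noncomputable def linkProd (v : Fin 6 → V4) : ℝ :=
  det2 (v 0) (v 1) (v 2) (v 3) * det2 (v 0) (v 1) (v 4) (v 5) * det2 (v 2) (v 3) (v 4) (v 5)

theorem exists_det2_eq_mul {v w v' w' : V4} (h : span ℝ {v, w} ≤ span ℝ {v', w'}) :
    ∃ k : ℝ, ∀ x y, det2 v w x y = k * det2 v' w' x y := by
  obtain ⟨a, b, rfl⟩ := mem_span_pair.mp (h (subset_span (by simp : v ∈ ({v, w} : Set V4))))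
  obtain ⟨c, d, rfl⟩ := mem_span_pair.mp (h (subset_span (by simp : w ∈ ({_, w} : Set V4))))
  exact ⟨a * d - b * c, fun x y => det2_smul_add a b c d v' w' x y⟩

theorem exists_linkProd_eq_mul {v v' : Fin 6 → V4} (h0 : span ℝ {v 0, v 1} ≤ span ℝ {v' 0, v' 1})
    (h1 : span ℝ {v 2, v 3} ≤ span ℝ {v' 2, v' 3}) (h2 : span ℝ {v 4, v 5} ≤ span ℝ {v' 4, v' 5}) :
    ∃ k : ℝ, linkProd v = k ^ 2 * linkProd v' := by
  obtain ⟨k0, e0⟩ := exists_det2_eq_mul h0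
  obtain ⟨k1, e1⟩ := exists_det2_eq_mul h1
  obtain ⟨k2, e2⟩ := exists_det2_eq_mul h2
  refine ⟨k0 * k1 * k2, ?_⟩
  have f1 := fun x y => (det2_swap (v 2) (v 3) x y).trans (e1 x y)
  have f2 := fun x y => (det2_swap (v 4) (v 5) x y).trans (e2 x y)
  have g0 : det2 (v 0) (v 1) (v 2) (v 3) = k0 * k1 * det2 (v' 0) (v' 1) (v' 2) (v' 3) := by
    rw [e0, f1, det2_swap (v' 0), mul_assoc]
  have g1 : det2 (v 0) (v 1) (v 4) (v 5) = k0 * k2 * det2 (v' 0) (v' 1) (v' 4) (v' 5) := by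
    rw [e0, f2, det2_swap (v' 0), mul_assoc]
  have g2 : det2 (v 2) (v 3) (v 4) (v 5) = k1 * k2 * det2 (v' 2) (v' 3) (v' 4) (v' 5) := by
    rw [e1, f2, det2_swap (v' 2), mul_assoc]
  rw [linkProd, linkProd, g0, g1, g2]
  ring

theorem sign_eq_of_eq_sq_mul {x y k l : ℝ} (h : x = k ^ 2 * y) (h' : y = l ^ 2 * x) :
    Real.sign x = Real.sign y := by
  rcases lt_trichotomy x 0 with hx | rfl | hx
  · have : y < 0 := by nlinarith [sq_nonneg k, sq_nonneg l]
    rw [Real.sign_of_neg hx, Real.sign_of_neg this]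
  · simp [h']
  · have : 0 < y := by nlinarith [sq_nonneg k, sq_nonneg l]
    rw [Real.sign_of_pos hx, Real.sign_of_pos this]

theorem lk_eq {P Q R : PLine} (v : Fin 6 → V4) (hP : P = span ℝ {v 0, v 1})
    (hQ : Q = span ℝ {v 2, v 3}) (hR : R = span ℝ {v 4, v 5}) :
    lk P Q R = Real.sign (linkProd v) := by
  have h : ∃ v : Fin 6 → V4,
      P = span ℝ {v 0, v 1} ∧ Q = span ℝ {v 2, v 3} ∧ R = span ℝ {v 4, v 5} := ⟨v, hP, hQ, hR⟩
  rw [lk, dif_pos h]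
  obtain ⟨gP, gQ, gR⟩ := h.choose_spec
  set u := h.choose
  obtain ⟨k, hk⟩ := exists_linkProd_eq_mul (hP.symm.trans gP).symm.le (hQ.symm.trans gQ).symm.le
    (hR.symm.trans gR).symm.le
  obtain ⟨l, hl⟩ := exists_linkProd_eq_mul (hP.symm.trans gP).le (hQ.symm.trans gQ).le
    (hR.symm.trans gR).le
  exact sign_eq_of_eq_sq_mul hk hl

/-- A subspace spanned by two vectors. -/
def IsPair (P : PLine) : Prop := ∃ v w : V4, P = span ℝ {v, w}

theorem lk_eq_zero {P Q R : PLine} (h : ¬ (IsPair P ∧ IsPair Q ∧ IsPair R)) : lk P Q R = 0 := by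
  rw [lk, dif_neg]
  rintro ⟨v, hP, hQ, hR⟩
  exact h ⟨⟨_, _, hP⟩, ⟨_, _, hQ⟩, ⟨_, _, hR⟩⟩

theorem lk_swap_left (P Q R : PLine) : lk Q P R = lk P Q R := by
  by_cases h : IsPair P ∧ IsPair Q ∧ IsPair R
  · obtain ⟨⟨v0, v1, hP⟩, ⟨v2, v3, hQ⟩, ⟨v4, v5, hR⟩⟩ := h
    rw [lk_eq ![v0, v1, v2, v3, v4, v5] hP hQ hR, lk_eq ![v2, v3, v0, v1, v4, v5] hQ hP hR]
    congr 1
    simp [linkProd]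
    rw [det2_swap v0 v1 v2 v3]
    ring
  · rw [lk_eq_zero h, lk_eq_zero (fun h' => h ⟨h'.2.1, h'.1, h'.2.2⟩)]

theorem lk_swap_right (P Q R : PLine) : lk P R Q = lk P Q R := by
  by_cases h : IsPair P ∧ IsPair Q ∧ IsPair R
  · obtain ⟨⟨v0, v1, hP⟩, ⟨v2, v3, hQ⟩, ⟨v4, v5, hR⟩⟩ := h
    rw [lk_eq ![v0, v1, v2, v3, v4, v5] hP hQ hR, lk_eq ![v0, v1, v4, v5, v2, v3] hP hR hQ]
    congr 1
    simp [linkProd]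
    rw [det2_swap v2 v3 v4 v5]
    ring
  · rw [lk_eq_zero h, lk_eq_zero (fun h' => h ⟨h'.1, h'.2.2, h'.2.1⟩)]

theorem map_span_pair (A : V4 →ₗ[ℝ] V4) (v w : V4) :
    (span ℝ {v, w}).map A = span ℝ {A v, A w} := by
  rw [map_span, Set.image_pair]

theorem isPair_map_iff {A : V4 →ₗ[ℝ] V4} (hA : LinearMap.det A ≠ 0) (P : PLine) :
    IsPair (P.map A) ↔ IsPair P := by
  constructor
  · rintro ⟨v, w, h⟩
    obtain ⟨x, hx, rfl⟩ : v ∈ P.map A := by rw [h]; exact subset_span (by simp)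
    obtain ⟨y, hy, rfl⟩ : w ∈ P.map A := by rw [h]; exact subset_span (by simp)
    refine ⟨x, y, ?_⟩
    rw [← map_span_pair] at h
    exact map_injective_of_injective (LinearMap.ker_eq_bot.mp
      (LinearMap.equivOfDetNeZero A hA).ker) h
  · rintro ⟨v, w, rfl⟩
    exact ⟨A v, A w, map_span_pair A v w⟩

theorem lk_map {A : V4 →ₗ[ℝ] V4} (hA : LinearMap.det A < 0) (P Q R : PLine) :
    lk (P.map A) (Q.map A) (R.map A) = - lk P Q R := by
  by_cases h : IsPair P ∧ IsPair Q ∧ IsPair R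
  · obtain ⟨⟨v0, v1, rfl⟩, ⟨v2, v3, rfl⟩, ⟨v4, v5, rfl⟩⟩ := h
    have e : lk (span ℝ {v0, v1}) (span ℝ {v2, v3}) (span ℝ {v4, v5}) =
        Real.sign (linkProd ![v0, v1, v2, v3, v4, v5]) := lk_eq _ rfl rfl rfl
    rw [e, lk_eq ![A v0, A v1, A v2, A v3, A v4, A v5] (map_span_pair A _ _)
        (map_span_pair A _ _) (map_span_pair A _ _), ← Real.sign_neg]
    have : linkProd ![A v0, A v1, A v2, A v3, A v4, A v5] =
        (-(LinearMap.det A) ^ 3) * -linkProd ![v0, v1, v2, v3, v4, v5] := by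
      simp [linkProd, det2_map]
      ring
    rw [this]
    have h3 : 0 < -(LinearMap.det A) ^ 3 := by
      have := Odd.pow_neg (n := 3) (by decide) hA
      linarith
    rcases lt_trichotomy (-linkProd ![v0, v1, v2, v3, v4, v5]) 0 with hx | hx | hx
    · rw [Real.sign_of_neg hx, Real.sign_of_neg (mul_neg_of_pos_of_neg h3 hx)]
    · rw [hx, mul_zero]
    · rw [Real.sign_of_pos hx, Real.sign_of_pos (mul_pos h3 hx)]
  · rw [lk_eq_zero h, lk_eq_zero, neg_zero]
    rwa [isPair_map_iff hA.ne, isPair_map_iff hA.ne, isPair_map_iff hA.ne]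

/-- The sum of linking numbers over ordered triples of distinct indices. -/
noncomputable def orderedSgn {n : ℕ} (L : Fin n → PLine) : ℝ :=
  ∑ i, ∑ j, ∑ k, if i ≠ j ∧ i ≠ k ∧ j ≠ k then lk (L i) (L j) (L k) else 0

theorem orderedSgn_comp {n : ℕ} (L : Fin n → PLine) (τ : Equiv.Perm (Fin n)) :
    orderedSgn (L ∘ τ) = orderedSgn L := by
  rw [orderedSgn, orderedSgn]
  refine Fintype.sum_equiv τ _ _ fun i => Fintype.sum_equiv τ _ _ fun j =>
    Fintype.sum_equiv τ _ _ fun k => ?_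
  simp

theorem orderedSgn_eq {n : ℕ} (L : Fin n → PLine) : orderedSgn L = 6 * sgnOf L := by
  set f : Fin n → Fin n → Fin n → ℝ := fun i j k => lk (L i) (L j) (L k) with hf
  have hl : ∀ i j k, f j i k = f i j k := fun i j k => lk_swap_left _ _ _
  have hr : ∀ i j k, f i k j = f i j k := fun i j k => lk_swap_right _ _ _
  set g : Fin n → Fin n → Fin n → ℝ := fun i j k => if i < j ∧ j < k then f i j k else 0 with hg
  have hsum : ∀ i j k, (if i ≠ j ∧ i ≠ k ∧ j ≠ k then f i j k else 0) =
      g i j k + g i k j + g j i k + g j k i + g k i j + g k j i := by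
    intro i j k
    have e1 := hr i j k
    have e2 := hl i j k
    have e3 : f j k i = f i j k := by rw [hr, hl]
    have e4 : f k i j = f i j k := by rw [hl, hr]
    have e5 : f k j i = f i j k := by rw [hr, e4]
    simp only [hg, e1, e2, e3, e4, e5]
    rcases lt_trichotomy i j with h1 | h1 | h1 <;> rcases lt_trichotomy i k with h2 | h2 | h2 <;>
      rcases lt_trichotomy j k with h3 | h3 | h3 <;>
      (try subst h1) <;> (try subst h2) <;> (try subst h3) <;>
      simp_all [lt_asymm, ne_of_lt, ne_of_gt] <;> omega
  have hs : sgnOf L = ∑ i, ∑ j, ∑ k, g i j k := rfl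
  have ho : orderedSgn L = ∑ i, ∑ j, ∑ k, (if i ≠ j ∧ i ≠ k ∧ j ≠ k then f i j k else 0) := rfl
  rw [ho, hs]
  simp only [hsum, Finset.sum_add_distrib]
  have s1 : ∑ i, ∑ j, ∑ k, g i k j = ∑ i, ∑ j, ∑ k, g i j k :=
    Finset.sum_congr rfl fun i _ => Finset.sum_comm
  have s2 : ∑ i, ∑ j, ∑ k, g j i k = ∑ i, ∑ j, ∑ k, g i j k := Finset.sum_comm
  have s3 : ∑ i, ∑ j, ∑ k, g j k i = ∑ i, ∑ j, ∑ k, g i j k := by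
    rw [Finset.sum_comm]
    exact Finset.sum_congr rfl fun i _ => Finset.sum_comm
  have s4 : ∑ i, ∑ j, ∑ k, g k i j = ∑ i, ∑ j, ∑ k, g i j k := by
    calc _ = ∑ i, ∑ k, ∑ j, g k i j := Finset.sum_congr rfl fun i _ => Finset.sum_comm
      _ = _ := Finset.sum_comm
  have s5 : ∑ i, ∑ j, ∑ k, g k j i = ∑ i, ∑ j, ∑ k, g i j k := by
    rw [← s4]
    exact Finset.sum_comm
  rw [s1, s2, s3, s4, s5]
  ring

end Linking

section LinkInvariant

open Matrix Set

theorem det2_ne_zero_of_skew {v w x y : V4} (h : Skew (span ℝ {v, w}) (span ℝ {x, y})) :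
    det2 v w x y ≠ 0 := by
  obtain ⟨h1, h2, h3⟩ := h
  intro hd
  obtain ⟨c, hc, e⟩ := exists_vecMul_eq_zero_iff.mpr hd
  have li : ∀ a b : V4, IsLine (span ℝ {a, b}) → LinearIndependent ℝ ![a, b] := by
    intro a b hab
    rw [linearIndependent_iff_card_eq_finrank_span]
    simp only [Fintype.card_fin, Set.finrank]
    rw [Matrix.range_cons_cons_empty, hab]
  have e' : c 0 • v + c 1 • w = -(c 2 • x + c 3 • y) := by
    ext j
    have := congrFun e j
    simp [vecMul, dotProduct, Fin.sum_univ_succ] at this ⊢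
    linarith
  have m1 : c 0 • v + c 1 • w ∈ span ℝ {v, w} := mem_span_pair.mpr ⟨_, _, rfl⟩
  have m2 : c 0 • v + c 1 • w ∈ span ℝ {x, y} := by
    rw [e']
    exact neg_mem (mem_span_pair.mpr ⟨_, _, rfl⟩)
  have z : c 0 • v + c 1 • w = 0 := by
    have : c 0 • v + c 1 • w ∈ span ℝ {v, w} ⊓ span ℝ {x, y} := ⟨m1, m2⟩
    rwa [h3, mem_bot] at this
  have z' : c 2 • x + c 3 • y = 0 := by rw [z] at e'; exact neg_eq_zero.mp e'.symm
  have c1 := LinearIndependent.pair_iff.mp (li _ _ h1) _ _ z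
  have c2 := LinearIndependent.pair_iff.mp (li _ _ h2) _ _ z'
  apply hc
  ext i
  fin_cases i
  exacts [c1.1, c1.2, c2.1, c2.2]

theorem sign_eq_of_continuousOn {f : ℝ → ℝ} (hf : ContinuousOn f (Icc 0 1))
    (h0 : ∀ t ∈ Icc (0 : ℝ) 1, f t ≠ 0) : Real.sign (f 0) = Real.sign (f 1) := by
  have key : ∀ g : ℝ → ℝ, ContinuousOn g (Icc 0 1) → (∀ t ∈ Icc (0 : ℝ) 1, g t ≠ 0) →
      g 0 < 0 → g 1 < 0 := by
    intro g hg h hlt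
    by_contra hge
    obtain ⟨t, ht, e⟩ := intermediate_value_Icc (zero_le_one) hg ⟨hlt.le, not_lt.mp hge⟩
    exact h t ht e
  rcases lt_or_gt_of_ne (h0 0 (by simp)) with h | h
  · rw [Real.sign_of_neg h, Real.sign_of_neg (key f hf h0 h)]
  · have := key (fun t => - f t) hf.neg (fun t ht => neg_ne_zero.mpr (h0 t ht)) (by simpa using h)
    rw [Real.sign_of_pos h, Real.sign_of_pos (by simpa using this)]

theorem continuousOn_det2 {s : Set ℝ} {v w x y : ℝ → V4} (hv : ContinuousOn v s)
    (hw : ContinuousOn w s) (hx : ContinuousOn x s) (hy : ContinuousOn y s) :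
    ContinuousOn (fun t => det2 (v t) (w t) (x t) (y t)) s := by
  rw [continuousOn_pi] at hv hw hx hy
  simp only [det2, det_succ_row_zero, Fin.sum_univ_succ]
  simp
  fun_prop

theorem lk_eq_of_family {n : ℕ} {F : ℝ → Fin n → PLine}
    (hF : ∀ i, ContinuousLineFamily (fun t => F t i))
    (hs : ∀ t ∈ Icc (0 : ℝ) 1, PairwiseSkew (F t)) {i j k : Fin n} (hij : i ≠ j) (hik : i ≠ k)
    (hjk : j ≠ k) : lk (F 0 i) (F 0 j) (F 0 k) = lk (F 1 i) (F 1 j) (F 1 k) := by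
  choose v w hv hw h using hF
  have e : ∀ t ∈ Icc (0 : ℝ) 1, lk (F t i) (F t j) (F t k) =
      Real.sign (linkProd ![v i t, w i t, v j t, w j t, v k t, w k t]) :=
    fun t ht => lk_eq _ (h i t ht) (h j t ht) (h k t ht)
  rw [e 0 (by simp), e 1 (by simp)]
  apply sign_eq_of_continuousOn
    (f := fun t => linkProd ![v i t, w i t, v j t, w j t, v k t, w k t])
  · exact ((continuousOn_det2 (hv i) (hw i) (hv j) (hw j)).mul
      (continuousOn_det2 (hv i) (hw i) (hv k) (hw k))).mul
      (continuousOn_det2 (hv j) (hw j) (hv k) (hw k))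
  · intro t ht
    have nz : ∀ a b, a ≠ b → det2 (v a t) (w a t) (v b t) (w b t) ≠ 0 := by
      intro a b hab
      apply det2_ne_zero_of_skew
      have := hs t ht a b hab
      have ha : F t a = _ := h a t ht
      have hb : F t b = _ := h b t ht
      rwa [ha, hb] at this
    exact mul_ne_zero (mul_ne_zero (nz _ _ hij) (nz _ _ hik)) (nz _ _ hjk)

theorem sgnOf_eq_of_family {n m : ℕ} {F : ℝ → Fin n → PLine}
    (hF : ∀ i, ContinuousLineFamily (fun t => F t i))
    (hs : ∀ t ∈ Icc (0 : ℝ) 1, PairwiseSkew (F t)) {f : Fin m → Fin n}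
    (hf : Function.Injective f) : sgnOf (F 0 ∘ f) = sgnOf (F 1 ∘ f) := by
  refine Finset.sum_congr rfl fun i _ => Finset.sum_congr rfl fun j _ =>
    Finset.sum_congr rfl fun k _ => ?_
  split_ifs with h
  · exact lk_eq_of_family hF hs (hf.ne h.1.ne) (hf.ne (h.1.trans h.2).ne) (hf.ne h.2.ne)
  · rfl

theorem sgnOf_comp {n : ℕ} (L : Fin n → PLine) (τ : Equiv.Perm (Fin n)) :
    sgnOf (L ∘ τ) = sgnOf L := by
  have := orderedSgn_comp L τ
  rw [orderedSgn_eq, orderedSgn_eq] at this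
  linarith

theorem sgnOf_map {n : ℕ} {A : V4 →ₗ[ℝ] V4} (hA : LinearMap.det A < 0) {L L' : Fin n → PLine}
    (h : ∀ i, L' i = (L i).map A) : sgnOf L' = - sgnOf L := by
  simp only [sgnOf, ← Finset.sum_neg_distrib]
  refine Finset.sum_congr rfl fun i _ => Finset.sum_congr rfl fun j _ =>
    Finset.sum_congr rfl fun k _ => ?_
  rw [h, h, h, lk_map hA, neg_ite, neg_zero]

theorem exists_perm_succAbove {n : ℕ} (σ : Equiv.Perm (Fin (n + 1))) (i : Fin (n + 1)) :
    ∃ τ : Equiv.Perm (Fin n), ∀ j, σ (i.succAbove j) = (σ i).succAbove (τ j) := by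
  have h : ∀ j, ∃ l, (σ i).succAbove l = σ (i.succAbove j) := fun j =>
    Fin.exists_succAbove_eq (σ.injective.ne (Fin.succAbove_ne i j))
  choose τ hτ using h
  have inj : Function.Injective τ := by
    intro a b hab
    have := hτ a
    rw [hab, hτ b] at this
    exact (Fin.succAbove_right_injective (σ.injective this)).symm
  exact ⟨Equiv.ofBijective τ (Finite.injective_iff_bijective.mp inj), fun j => (hτ j).symm⟩

/-- The sum of the absolute values of the linking sums of the five-line subconfigurations. -/
noncomputable def absSgnSum {n : ℕ} (L : Fin (n + 1) → PLine) : ℝ :=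
  ∑ i : Fin (n + 1), |sgnOf (L ∘ i.succAbove)|

theorem absSgnSum_comp {n : ℕ} (L : Fin (n + 1) → PLine) (σ : Equiv.Perm (Fin (n + 1))) :
    absSgnSum (L ∘ σ) = absSgnSum L := by
  refine Fintype.sum_equiv σ _ _ fun i => ?_
  obtain ⟨τ, hτ⟩ := exists_perm_succAbove σ i
  have : (L ∘ σ) ∘ i.succAbove = (L ∘ (σ i).succAbove) ∘ τ := by
    ext1 j
    simp [hτ]
  rw [this, sgnOf_comp]

theorem absSgnSum_map {n : ℕ} {L L' : Fin (n + 1) → PLine} (h : IsMirror L L') :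
    absSgnSum L' = absSgnSum L := by
  obtain ⟨A, hA, h⟩ := h
  refine Finset.sum_congr rfl fun i _ => ?_
  have : sgnOf (L' ∘ i.succAbove) = -sgnOf (L ∘ i.succAbove) := sgnOf_map hA fun j => h _
  rw [this, abs_neg]

theorem absSgnSum_eq_of_deformation {L L' : Fin 6 → PLine} (h : SchlafliDeformation L L') :
    absSgnSum L = absSgnSum L' := by
  obtain ⟨π, π', F, hF, hs, h0, h1⟩ := h
  rw [← absSgnSum_comp L π, ← absSgnSum_comp L' π', ← h0, ← h1]
  refine Finset.sum_congr rfl fun i _ => ?_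
  rw [sgnOf_eq_of_family hF (fun t ht => (hs t ht).1) Fin.succAbove_right_injective]

theorem absSgnSum_eq_of_coarse {L L' : Fin 6 → PLine} (h : SchlafliCoarse L L') :
    absSgnSum L = absSgnSum L' := by
  induction h with
  | rel L L' h =>
    rcases h with h | ⟨π, h⟩
    · exact absSgnSum_eq_of_deformation h
    · rw [absSgnSum_map h, absSgnSum_comp]
  | refl => rfl
  | symm _ _ _ ih => exact ih.symm
  | trans _ _ _ _ _ ih1 ih2 => exact ih1.trans ih2

end LinkInvariant

section Representation

open Matrix

/-- A configuration of six lines given as the kernels, at six points of the plane, of a linear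
family of matrices. -/
structure SixRep (L : Fin 6 → PLine) (p q : Fin 6 → Fin 3 → ℝ)
    (T : V4 →ₗ[ℝ] Matrix (Fin 3) (Fin 3) ℝ) : Prop where
  genPos_left : GenPos p
  genPos_right : GenPos q
  rel : ∑ i, vecMulVec (p i) (q i) = 0
  inj : ∀ x, T x = 0 → x = 0
  form : ∀ i x, q i ⬝ᵥ T x *ᵥ p i = 0
  mem : ∀ i x, x ∈ L i ↔ T x *ᵥ p i = 0
  cross : ∀ i x, T x *ᵥ p i = 0 → q i ᵥ* T x = 0 → x = 0

/-- The linear map underlying `nfT`. -/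
def nfTLin (a b c d : ℝ) : V4 →ₗ[ℝ] Matrix (Fin 3) (Fin 3) ℝ where
  toFun := nfT a b c d
  map_add' x y := by simpa using nfT_smul_add a b c d 1 1 x y
  map_smul' s x := by simpa using nfT_smul_add a b c d s 0 x 0

theorem br_smul (r s t : ℝ) (x y z : Fin 3 → ℝ) :
    br (r • x) (s • y) (t • z) = r * s * t * br x y z := by
  simp [br]
  ring

theorem br_mulVec (g : Matrix (Fin 3) (Fin 3) ℝ) (x y z : Fin 3 → ℝ) :
    br (g *ᵥ x) (g *ᵥ y) (g *ᵥ z) = g.det * br x y z := by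
  simp [br, mulVec, dotProduct, det_fin_three, Fin.sum_univ_three]
  ring

theorem SixRep.comp {L : Fin 6 → PLine} {p q : Fin 6 → Fin 3 → ℝ}
    {T : V4 →ₗ[ℝ] Matrix (Fin 3) (Fin 3) ℝ} (h : SixRep L p q T) (σ : Equiv.Perm (Fin 6)) :
    SixRep (L ∘ σ) (p ∘ σ) (q ∘ σ) T where
  genPos_left _ _ _ hij hik hjk :=
    h.genPos_left _ _ _ (σ.injective.ne hij) (σ.injective.ne hik) (σ.injective.ne hjk)
  genPos_right _ _ _ hij hik hjk :=
    h.genPos_right _ _ _ (σ.injective.ne hij) (σ.injective.ne hik) (σ.injective.ne hjk)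
  rel := (Equiv.sum_comp σ fun i => vecMulVec (p i) (q i)).trans h.rel
  inj := h.inj
  form i := h.form (σ i)
  mem i := h.mem (σ i)
  cross i := h.cross (σ i)

theorem SixRep.changeBasis {L : Fin 6 → PLine} {p q p' : Fin 6 → Fin 3 → ℝ}
    {T : V4 →ₗ[ℝ] Matrix (Fin 3) (Fin 3) ℝ} (h : SixRep L p q T) {g : Matrix (Fin 3) (Fin 3) ℝ}
    (hg : g.det ≠ 0) {r : Fin 6 → ℝ} (hr : ∀ i, r i ≠ 0) (hp : ∀ i, p i = r i • g *ᵥ p' i) :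
    ∃ q' T', SixRep L p' q' T' := by
  have hinj : Function.Injective (g *ᵥ ·) := mulVec_injective_iff_isUnit.mpr
    ((isUnit_iff_isUnit_det g).mpr hg.isUnit)
  have hT : ∀ i (X : Matrix (Fin 3) (Fin 3) ℝ), X *ᵥ p i = r i • (X * g) *ᵥ p' i := by
    intro i X
    rw [hp, mulVec_smul, mulVec_mulVec]
  refine ⟨fun i => r i • q i, (LinearMap.mulRight ℝ g) ∘ₗ T, ?_, ?_, ?_, ?_, ?_, ?_, ?_⟩
  · intro i j k hij hik hjk
    have := h.genPos_left i j k hij hik hjk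
    rw [hp i, hp j, hp k, br_smul, br_mulVec] at this
    exact right_ne_zero_of_mul (right_ne_zero_of_mul this)
  · intro i j k hij hik hjk
    rw [br_smul]
    exact mul_ne_zero (mul_ne_zero (mul_ne_zero (hr i) (hr j)) (hr k))
      (h.genPos_right i j k hij hik hjk)
  · have : g * ∑ i, vecMulVec (p' i) (r i • q i) = 0 := by
      rw [Finset.mul_sum, ← h.rel]
      refine Finset.sum_congr rfl fun i _ => ?_
      rw [mul_vecMulVec, hp, vecMulVec_smul, smul_vecMulVec]
    exact (Matrix.isUnit_iff_isUnit_det g).mpr hg.isUnit |>.mul_right_eq_zero.mp this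
  · intro x hx
    refine h.inj x ?_
    have : T x * g = 0 := hx
    exact (Matrix.isUnit_iff_isUnit_det g).mpr hg.isUnit |>.mul_left_eq_zero.mp this
  · intro i x
    have := h.form i x
    rw [hT, dotProduct_smul] at this
    simpa using this
  · intro i x
    rw [h.mem, hT]
    simp [hr i]
  · intro i x h1 h2
    refine h.cross i x ?_ ?_
    · rw [hT]
      have : (T x * g) *ᵥ p' i = 0 := h1
      rw [this, smul_zero]
    · have e : (r i • q i) ᵥ* (T x * g) = 0 := h2
      rw [smul_vecMul, ← vecMul_vecMul] at e
      have e' := (smul_eq_zero.mp e).resolve_left (hr i)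
      exact vecMul_injective_iff_isUnit.mpr ((isUnit_iff_isUnit_det g).mpr hg.isUnit)
        (e'.trans (zero_vecMul g).symm)

theorem nf_rep {a b c d : ℝ} (h : NFGen a b c d) :
    SixRep (nfL a b c d) (nfP a b c d) (nfQ a b c d) (nfTLin a b c d) where
  genPos_left := nfP_genPos h
  genPos_right := nfQ_genPos h
  rel := nf_rel a b c d
  inj _ hx := nfT_eq_zero h.k0 hx
  form i x := nfT_mem a b c d x i
  mem i x := mem_nfL h i x
  cross i x h1 h2 := by
    by_contra hx
    exact kernel_absurd (nfP_genPos h) (nfQ_genPos h) (nf_rel a b c d) (nf_nonconic h)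
      (fun h0 => hx (nfT_eq_zero h.k0 h0)) (nfT_mem a b c d x) h1 h2

end Representation

section Regions

open Matrix Set

theorem continuousOn_nfV {s : Set ℝ} {a b c d : ℝ → ℝ} (ha : ContinuousOn a s)
    (hb : ContinuousOn b s) (hc : ContinuousOn c s) (hd : ContinuousOn d s) (i : Fin 6) :
    ContinuousOn (fun t => nfV (a t) (b t) (c t) (d t) i) s := by
  rw [continuousOn_pi]
  intro j
  fin_cases i <;> fin_cases j <;> simp [nfV] <;> fun_prop

theorem continuousOn_nfW {s : Set ℝ} {a b c d : ℝ → ℝ} (ha : ContinuousOn a s)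
    (hb : ContinuousOn b s) (hc : ContinuousOn c s) (hd : ContinuousOn d s) (i : Fin 6) :
    ContinuousOn (fun t => nfW (a t) (b t) (c t) (d t) i) s := by
  rw [continuousOn_pi]
  intro j
  fin_cases i <;> fin_cases j <;> simp [nfW] <;> fun_prop

theorem nf_deformation {a b c d : ℝ → ℝ} (ha : ContinuousOn a (Icc 0 1))
    (hb : ContinuousOn b (Icc 0 1)) (hc : ContinuousOn c (Icc 0 1)) (hd : ContinuousOn d (Icc 0 1))
    (h : ∀ t ∈ Icc (0 : ℝ) 1, NFGen (a t) (b t) (c t) (d t)) :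
    SchlafliDeformation (nfL (a 0) (b 0) (c 0) (d 0)) (nfL (a 1) (b 1) (c 1) (d 1)) :=
  ⟨1, 1, fun t => nfL (a t) (b t) (c t) (d t),
    fun i => ⟨_, _, continuousOn_nfV ha hb hc hd i, continuousOn_nfW ha hb hc hd i,
      fun _ _ => rfl⟩,
    fun t ht => nf_isSchlafliSix (h t ht), rfl, rfl⟩

/-- Normal forms of hexagonal sixes. -/
structure IsHex (a b c d : ℝ) : Prop where
  a1 : 1 < a
  ac : a < c
  ab : a < b
  d0 : d < 0
  conic : 0 < b * d * (a - c) + b * c * (1 - a) + d * a * (c - 1)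

/-- Normal forms of bipartite sixes. -/
structure IsBip (a b c d : ℝ) : Prop where
  a1 : 1 < a
  ac : a < c
  b0 : b < 0
  cd : c < d

/-- Normal forms of tripartite sixes. -/
structure IsTri (a b c d : ℝ) : Prop where
  a1 : 1 < a
  ac : a < c
  b0 : b < 0
  d1 : 1 < d
  dc : d < c

/-- Normal forms of icosahedral sixes. -/
structure IsIco (a b c d : ℝ) : Prop where
  a1 : 1 < a
  ac : a < c
  b0 : 0 < b
  b1 : b < 1
  d1 : 1 < d
  dc : d < c
  adbc : b * c < a * d

variable {a b c d : ℝ}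

theorem IsHex.nfGen (h : IsHex a b c d) : NFGen a b c d := by
  obtain ⟨h1, h2, h3, h4, h5⟩ := h
  constructor <;> nlinarith

theorem IsBip.nfGen (h : IsBip a b c d) : NFGen a b c d := by
  obtain ⟨h1, h2, h3, h4⟩ := h
  have i1 : 0 < -b * d * (c - a) := by
    apply mul_pos <;> nlinarith
  have i2 : 0 < -b * c * (a - 1) := by
    apply mul_pos <;> nlinarith
  have i3 : 0 < d * a * (c - 1) := by
    apply mul_pos <;> nlinarith
  constructor <;> first | (apply ne_of_gt; nlinarith) | (apply ne_of_lt; nlinarith)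

theorem IsTri.nfGen (h : IsTri a b c d) : NFGen a b c d := by
  obtain ⟨h1, h2, h3, h4, h5⟩ := h
  have i1 : 0 < -b * d * (c - a) := by
    apply mul_pos <;> nlinarith
  have i2 : 0 < -b * c * (a - 1) := by
    apply mul_pos <;> nlinarith
  have i3 : 0 < d * a * (c - 1) := by
    apply mul_pos <;> nlinarith
  constructor <;> first | (apply ne_of_gt; nlinarith) | (apply ne_of_lt; nlinarith)

theorem IsIco.nfGen (h : IsIco a b c d) : NFGen a b c d := by
  obtain ⟨h1, h2, h3, h4, h5, h6, h7⟩ := h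
  have i1 : 0 < d * (a - b) * (c - a) := by
    apply mul_pos <;> nlinarith
  have i2 : 0 < (a * d - b * c) * (a - 1) := by
    apply mul_pos <;> nlinarith
  constructor <;> first | (apply ne_of_gt; nlinarith) | (apply ne_of_lt; nlinarith)

theorem seg_lt {x y x' y' t : ℝ} (h : x < y) (h' : x' < y') (ht : t ∈ Icc (0 : ℝ) 1) :
    (1 - t) * x + t * x' < (1 - t) * y + t * y' := by
  obtain ⟨t0, t1⟩ := ht
  nlinarith [mul_nonneg t0 (sub_nonneg.mpr h'.le), mul_nonneg (sub_nonneg.mpr t1)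
    (sub_nonneg.mpr h.le)]

theorem IsBip.deformation (h : IsBip a b c d) {a' b' c' d' : ℝ} (h' : IsBip a' b' c' d') :
    SchlafliDeformation (nfL a b c d) (nfL a' b' c' d') := by
  have := nf_deformation (a := fun t => (1 - t) * a + t * a') (b := fun t => (1 - t) * b + t * b')
    (c := fun t => (1 - t) * c + t * c') (d := fun t => (1 - t) * d + t * d')
    (by fun_prop) (by fun_prop) (by fun_prop) (by fun_prop) fun t ht => by
      apply IsBip.nfGen
      constructor
      · linarith [seg_lt h.a1 h'.a1 ht]
      · exact seg_lt h.ac h'.ac ht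
      · linarith [seg_lt h.b0 h'.b0 ht]
      · exact seg_lt h.cd h'.cd ht
  simpa using this

theorem IsTri.deformation (h : IsTri a b c d) {a' b' c' d' : ℝ} (h' : IsTri a' b' c' d') :
    SchlafliDeformation (nfL a b c d) (nfL a' b' c' d') := by
  have := nf_deformation (a := fun t => (1 - t) * a + t * a') (b := fun t => (1 - t) * b + t * b')
    (c := fun t => (1 - t) * c + t * c') (d := fun t => (1 - t) * d + t * d')
    (by fun_prop) (by fun_prop) (by fun_prop) (by fun_prop) fun t ht => by
      apply IsTri.nfGen
      constructor
      · linarith [seg_lt h.a1 h'.a1 ht]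
      · exact seg_lt h.ac h'.ac ht
      · linarith [seg_lt h.b0 h'.b0 ht]
      · linarith [seg_lt h.d1 h'.d1 ht]
      · exact seg_lt h.dc h'.dc ht
  simpa using this

theorem IsIco.exists_param (h : IsIco a b c d) : ∃ x y u v : ℝ, 0 < x ∧ x < y ∧ y < 1 ∧ 0 < u ∧
    u < y ∧ x < v ∧ v < 1 ∧ u < v ∧ a = 1 / y ∧ b = u / y ∧ c = 1 / x ∧ d = v / x := by
  obtain ⟨h1, h2, h3, h4, h5, h6, h7⟩ := h
  have ha : 0 < a := by linarith
  have hc : 0 < c := by linarith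
  refine ⟨1 / c, 1 / a, b / a, d / c, by positivity, one_div_lt_one_div_of_lt ha h2, ?_,
    by positivity, ?_, ?_, ?_, ?_, by field_simp, by field_simp, by field_simp, by field_simp⟩
  · rw [div_lt_one ha]; exact h1
  · gcongr
  · gcongr
  · rw [div_lt_one hc]; exact h6
  · rw [div_lt_div_iff₀ ha hc]; linarith

theorem isIco_of_param {x y u v : ℝ} (hx : 0 < x) (hxy : x < y) (hy : y < 1) (hu : 0 < u)
    (huy : u < y) (hxv : x < v) (hv : v < 1) (huv : u < v) :
    IsIco (1 / y) (u / y) (1 / x) (v / x) := by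
  have hy0 : 0 < y := by linarith
  refine ⟨(one_lt_div hy0).mpr hy, one_div_lt_one_div_of_lt hx hxy, by positivity,
    (div_lt_one hy0).mpr huy, (one_lt_div hx).mpr hxv, by gcongr, ?_⟩
  rw [div_mul_div_comm, div_mul_div_comm]
  exact div_lt_div_of_pos_right (by linarith) (by positivity)

theorem IsIco.deformation (h : IsIco a b c d) {a' b' c' d' : ℝ} (h' : IsIco a' b' c' d') :
    SchlafliDeformation (nfL a b c d) (nfL a' b' c' d') := by
  obtain ⟨x, y, u, v, h1, h2, h3, h4, h5, h6, h7, h8, rfl, rfl, rfl, rfl⟩ := h.exists_param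
  obtain ⟨x', y', u', v', h1', h2', h3', h4', h5', h6', h7', h8', rfl, rfl, rfl, rfl⟩ :=
    h'.exists_param
  have px : ∀ t ∈ Icc (0 : ℝ) 1, 0 < (1 - t) * x + t * x' := fun t ht => by
    linarith [seg_lt h1 h1' ht]
  have py : ∀ t ∈ Icc (0 : ℝ) 1, 0 < (1 - t) * y + t * y' := fun t ht => by
    linarith [px t ht, seg_lt h2 h2' ht]
  have cx : ContinuousOn (fun t : ℝ => (1 - t) * x + t * x') (Icc 0 1) := by fun_prop
  have cy : ContinuousOn (fun t : ℝ => (1 - t) * y + t * y') (Icc 0 1) := by fun_prop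
  have cu : ContinuousOn (fun t : ℝ => (1 - t) * u + t * u') (Icc 0 1) := by fun_prop
  have cv : ContinuousOn (fun t : ℝ => (1 - t) * v + t * v') (Icc 0 1) := by fun_prop
  have := nf_deformation (continuousOn_const.div cy fun t ht => (py t ht).ne')
    (cu.div cy fun t ht => (py t ht).ne') (continuousOn_const.div cx fun t ht => (px t ht).ne')
    (cv.div cx fun t ht => (px t ht).ne') fun t ht => by
      apply IsIco.nfGen
      refine isIco_of_param (px t ht) (seg_lt h2 h2' ht) ?_ ?_ (seg_lt h5 h5' ht)
        (seg_lt h6 h6' ht) ?_ (seg_lt h8 h8' ht)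
      · linarith [seg_lt h3 h3' ht]
      · linarith [seg_lt h4 h4' ht]
      · linarith [seg_lt h7 h7' ht]
  simpa using this

theorem IsHex.exists_param (h : IsHex a b c d) : ∃ x y u v : ℝ, 0 < x ∧ 0 < y ∧ 1 < v ∧
    x + y < u - v ∧ a = u / (u - 1) ∧ b = u / x ∧ c = v / (v - 1) ∧ d = -v / y := by
  obtain ⟨h1, h2, h3, h4, h5⟩ := h
  have ha : 0 < a - 1 := by linarith
  have hc : 0 < c - 1 := by linarith
  have ha0 : 0 < a := by linarith
  have hc0 : 0 < c := by linarith
  have hb0 : 0 < b := by linarith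
  have hd0 : d ≠ 0 := h4.ne
  have ea : a / (a - 1) - 1 = 1 / (a - 1) := by field_simp; ring
  have ec : c / (c - 1) - 1 = 1 / (c - 1) := by field_simp; ring
  refine ⟨a / (a - 1) / b, c / (c - 1) / -d, a / (a - 1), c / (c - 1), by positivity, ?_, ?_, ?_,
    ?_, ?_, ?_, ?_⟩
  · have : 0 < -d := by linarith
    positivity
  · rw [one_lt_div hc]; linarith
  · have e : a / (a - 1) - c / (c - 1) - (a / (a - 1) / b + c / (c - 1) / -d) =
        (b * d * (a - c) + b * c * (1 - a) + d * a * (c - 1)) /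
          ((a - 1) * (c - 1) * b * -d) := by
      field_simp
      ring
    have : 0 < -d := by linarith
    have : 0 < (b * d * (a - c) + b * c * (1 - a) + d * a * (c - 1)) /
          ((a - 1) * (c - 1) * b * -d) := by positivity
    linarith
  · rw [ea]; field_simp
  · field_simp
  · rw [ec]; field_simp
  · field_simp

theorem isHex_of_param {x y u v : ℝ} (hx : 0 < x) (hy : 0 < y) (hv : 1 < v)
    (huv : x + y < u - v) : IsHex (u / (u - 1)) (u / x) (v / (v - 1)) (-v / y) := by
  have hu : 0 < u - 1 := by linarith
  have hv' : 0 < v - 1 := by linarith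
  have hu0 : 0 < u := by linarith
  have hv0 : 0 < v := by linarith
  refine ⟨(one_lt_div hu).mpr (by linarith), ?_, ?_, ?_, ?_⟩
  · rw [div_lt_div_iff₀ hu hv']
    nlinarith
  · exact div_lt_div_of_pos_left hu0 hx (by linarith)
  · rw [neg_div]
    exact neg_neg_of_pos (by positivity)
  · have e : u / x * (-v / y) * (u / (u - 1) - v / (v - 1)) +
        u / x * (v / (v - 1)) * (1 - u / (u - 1)) + -v / y * (u / (u - 1)) * (v / (v - 1) - 1) =
        u * v * (u - v - (x + y)) / (x * y * (u - 1) * (v - 1)) := by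
      field_simp
      ring
    rw [e]
    have : 0 < u - v - (x + y) := by linarith
    positivity

theorem IsHex.deformation (h : IsHex a b c d) {a' b' c' d' : ℝ} (h' : IsHex a' b' c' d') :
    SchlafliDeformation (nfL a b c d) (nfL a' b' c' d') := by
  obtain ⟨x, y, u, v, h1, h2, h3, h4, rfl, rfl, rfl, rfl⟩ := h.exists_param
  obtain ⟨x', y', u', v', h1', h2', h3', h4', rfl, rfl, rfl, rfl⟩ := h'.exists_param
  have px : ∀ t ∈ Icc (0 : ℝ) 1, 0 < (1 - t) * x + t * x' := fun t ht => by
    linarith [seg_lt h1 h1' ht]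
  have py : ∀ t ∈ Icc (0 : ℝ) 1, 0 < (1 - t) * y + t * y' := fun t ht => by
    linarith [seg_lt h2 h2' ht]
  have pv : ∀ t ∈ Icc (0 : ℝ) 1, 0 < (1 - t) * v + t * v' - 1 := fun t ht => by
    linarith [seg_lt h3 h3' ht]
  have pu : ∀ t ∈ Icc (0 : ℝ) 1, 0 < (1 - t) * u + t * u' - 1 := fun t ht => by
    linarith [seg_lt h4 h4' ht, px t ht, py t ht, pv t ht]
  have cx : ContinuousOn (fun t : ℝ => (1 - t) * x + t * x') (Icc 0 1) := by fun_prop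
  have cy : ContinuousOn (fun t : ℝ => (1 - t) * y + t * y') (Icc 0 1) := by fun_prop
  have cu : ContinuousOn (fun t : ℝ => (1 - t) * u + t * u') (Icc 0 1) := by fun_prop
  have cv : ContinuousOn (fun t : ℝ => (1 - t) * v + t * v') (Icc 0 1) := by fun_prop
  have := nf_deformation (cu.div (cu.sub continuousOn_const) fun t ht => (pu t ht).ne')
    (cu.div cx fun t ht => (px t ht).ne')
    (cv.div (cv.sub continuousOn_const) fun t ht => (pv t ht).ne')
    (cv.neg.div cy fun t ht => (py t ht).ne') fun t ht => by
      apply IsHex.nfGen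
      refine isHex_of_param (px t ht) (py t ht) ?_ ?_
      · linarith [pv t ht]
      · linarith [seg_lt h4 h4' ht]
  simpa using this

end Regions

section Samples

open Matrix

theorem det2_eq (v w x y : V4) : det2 v w x y =
    (v 0 * w 1 - v 1 * w 0) * (x 2 * y 3 - x 3 * y 2) -
    (v 0 * w 2 - v 2 * w 0) * (x 1 * y 3 - x 3 * y 1) +
    (v 0 * w 3 - v 3 * w 0) * (x 1 * y 2 - x 2 * y 1) +
    (v 1 * w 2 - v 2 * w 1) * (x 0 * y 3 - x 3 * y 0) -
    (v 1 * w 3 - v 3 * w 1) * (x 0 * y 2 - x 2 * y 0) +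
    (v 2 * w 3 - v 3 * w 2) * (x 0 * y 1 - x 1 * y 0) := by
  simp [det2, det_succ_row_zero, Fin.sum_univ_succ, Fin.succAbove]
  ring

/-- The sum of the linking numbers predicted by a table of signs. -/
def tableSgn (s : Fin 6 → Fin 6 → ℤ) (m : Fin 6) : ℤ :=
  ∑ i : Fin 5, ∑ j : Fin 5, ∑ k : Fin 5, if i < j ∧ j < k then
    s (m.succAbove i) (m.succAbove j) * s (m.succAbove i) (m.succAbove k) *
      s (m.succAbove j) (m.succAbove k) else 0

theorem sign_linkProd_of_table {x y z : ℝ} {s t u : ℤ} (hs : s ^ 2 = 1) (ht : t ^ 2 = 1)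
    (hu : u ^ 2 = 1) (hx : 0 < s * x) (hy : 0 < t * y) (hz : 0 < u * z) :
    Real.sign (x * y * z) = (s * t * u : ℤ) := by
  have hp : 0 < ((s * t * u : ℤ) : ℝ) * (x * y * z) := by
    have := mul_pos (mul_pos hx hy) hz
    push_cast
    linarith
  have h1 : (s * t * u) ^ 2 = 1 := by rw [mul_pow, mul_pow, hs, ht, hu]; rfl
  rcases mul_self_eq_one_iff.mp ((sq (s * t * u)).symm.trans h1) with h | h
  · rw [h, Int.cast_one, one_mul] at hp
    rw [h, Real.sign_of_pos hp, Int.cast_one]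
  · rw [h, Int.cast_neg, Int.cast_one, neg_one_mul, neg_pos] at hp
    rw [h, Real.sign_of_neg hp, Int.cast_neg, Int.cast_one]

theorem sgnOf_nfL {a b c d : ℝ} (s : Fin 6 → Fin 6 → ℤ) (h1 : ∀ i j, s i j ^ 2 = 1)
    (h : ∀ i j, i < j → 0 < (s i j : ℝ) * det2 (nfV a b c d i) (nfW a b c d i)
      (nfV a b c d j) (nfW a b c d j)) (m : Fin 6) :
    sgnOf (nfL a b c d ∘ m.succAbove) = tableSgn s m := by
  rw [tableSgn, sgnOf]
  push_cast
  refine Finset.sum_congr rfl fun i _ => Finset.sum_congr rfl fun j _ =>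
    Finset.sum_congr rfl fun k _ => ?_
  split_ifs with hh
  · have hij := Fin.strictMono_succAbove m hh.1
    have hjk := Fin.strictMono_succAbove m hh.2
    rw [← Int.cast_mul, ← Int.cast_mul, ← sign_linkProd_of_table (h1 _ _) (h1 _ _) (h1 _ _)
      (h _ _ hij) (h _ _ (hij.trans hjk)) (h _ _ hjk)]
    exact lk_eq (![nfV a b c d (m.succAbove i), nfW a b c d (m.succAbove i),
      nfV a b c d (m.succAbove j), nfW a b c d (m.succAbove j),
      nfV a b c d (m.succAbove k), nfW a b c d (m.succAbove k)]) rfl rfl rfl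
  · rfl

def hexTable : Fin 6 → Fin 6 → ℤ :=
  ![![1, 1, 1, -1, -1, 1], ![1, 1, -1, 1, 1, -1], ![1, 1, 1, 1, 1, -1], ![1, 1, 1, 1, -1, 1],
    ![1, 1, 1, 1, 1, 1], ![1, 1, 1, 1, 1, 1]]

def bipTable : Fin 6 → Fin 6 → ℤ :=
  ![![1, 1, 1, -1, -1, 1], ![1, 1, 1, 1, 1, 1], ![1, 1, 1, 1, 1, 1], ![1, 1, 1, 1, -1, 1],
    ![1, 1, 1, 1, 1, 1], ![1, 1, 1, 1, 1, 1]]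

def triTable : Fin 6 → Fin 6 → ℤ :=
  ![![1, -1, 1, -1, -1, 1], ![1, 1, -1, -1, 1, 1], ![1, 1, 1, 1, 1, 1], ![1, 1, 1, 1, -1, 1],
    ![1, 1, 1, 1, 1, -1], ![1, 1, 1, 1, 1, 1]]

def icoTable : Fin 6 → Fin 6 → ℤ :=
  ![![1, -1, -1, -1, -1, -1], ![1, 1, -1, -1, 1, 1], ![1, 1, 1, 1, 1, -1], ![1, 1, 1, 1, -1, 1],
    ![1, 1, 1, 1, 1, -1], ![1, 1, 1, 1, 1, 1]]

theorem sgnOf_hex (m : Fin 6) : sgnOf (nfL 2 8 5 (-5) ∘ m.succAbove) = tableSgn hexTable m := by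
  refine sgnOf_nfL _ (by decide) (fun i j hij => ?_) m
  fin_cases i <;> fin_cases j <;> (try exact absurd hij (by decide)) <;>
    simp [hexTable, det2_eq, nfV, nfW] <;> norm_num

theorem sgnOf_bip (m : Fin 6) : sgnOf (nfL 2 (-1) 3 4 ∘ m.succAbove) = tableSgn bipTable m := by
  refine sgnOf_nfL _ (by decide) (fun i j hij => ?_) m
  fin_cases i <;> fin_cases j <;> (try exact absurd hij (by decide)) <;>
    simp [bipTable, det2_eq, nfV, nfW] <;> norm_num

theorem sgnOf_tri (m : Fin 6) : sgnOf (nfL 2 (-1) 3 2 ∘ m.succAbove) = tableSgn triTable m := by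
  refine sgnOf_nfL _ (by decide) (fun i j hij => ?_) m
  fin_cases i <;> fin_cases j <;> (try exact absurd hij (by decide)) <;>
    simp [triTable, det2_eq, nfV, nfW] <;> norm_num

theorem sgnOf_ico (m : Fin 6) : sgnOf (nfL 2 (1 / 2) 4 3 ∘ m.succAbove) = tableSgn icoTable m := by
  refine sgnOf_nfL _ (by decide) (fun i j hij => ?_) m
  fin_cases i <;> fin_cases j <;> (try exact absurd hij (by decide)) <;>
    simp [icoTable, det2_eq, nfV, nfW] <;> norm_num

theorem tableSgn_hex (m : Fin 6) : |tableSgn hexTable m| = 10 := by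
  revert m
  decide +kernel

theorem tableSgn_bip (m : Fin 6) : |tableSgn bipTable m| = 4 := by
  revert m
  decide +kernel

theorem tableSgn_tri (m : Fin 6) : |tableSgn triTable m| = 2 := by
  revert m
  decide +kernel

theorem tableSgn_ico (m : Fin 6) : |tableSgn icoTable m| = 0 := by
  revert m
  decide +kernel

end Samples

section NormalForm

open Matrix

variable {a b c d : ℝ} {L : Fin 6 → PLine} {q : Fin 6 → Fin 3 → ℝ}
  {T : V4 →ₗ[ℝ] Matrix (Fin 3) (Fin 3) ℝ}

/-- The genericity conditions that do not involve the conic through the six points. -/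
theorem nf_conditions_of_genPos (h : GenPos (nfP a b c d)) :
    (a ≠ 0 ∧ b ≠ 0 ∧ c ≠ 0 ∧ d ≠ 0) ∧ (a - 1 ≠ 0 ∧ b - 1 ≠ 0 ∧ c - 1 ≠ 0 ∧ d - 1 ≠ 0) ∧
      (a - b ≠ 0 ∧ c - d ≠ 0 ∧ a - c ≠ 0 ∧ b - d ≠ 0) ∧ a * d - b * c ≠ 0 ∧ nfD a b c d ≠ 0 := by
  have h024 := h 0 2 4 (by decide) (by decide) (by decide)
  have h025 := h 0 2 5 (by decide) (by decide) (by decide)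
  have h014 := h 0 1 4 (by decide) (by decide) (by decide)
  have h015 := h 0 1 5 (by decide) (by decide) (by decide)
  have h234 := h 2 3 4 (by decide) (by decide) (by decide)
  have h235 := h 2 3 5 (by decide) (by decide) (by decide)
  have h134 := h 1 3 4 (by decide) (by decide) (by decide)
  have h135 := h 1 3 5 (by decide) (by decide) (by decide)
  have h245 := h 2 4 5 (by decide) (by decide) (by decide)
  have h145 := h 1 4 5 (by decide) (by decide) (by decide)
  have h034 := h 0 3 4 (by decide) (by decide) (by decide)
  have h035 := h 0 3 5 (by decide) (by decide) (by decide)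
  have h045 := h 0 4 5 (by decide) (by decide) (by decide)
  have h345 := h 3 4 5 (by decide) (by decide) (by decide)
  simp [br, nfP] at h024 h025 h014 h015 h234 h235 h134 h135 h245 h145 h034 h035 h045 h345
  simp only [nfD]
  refine ⟨⟨?_, ?_, ?_, ?_⟩, ⟨?_, ?_, ?_, ?_⟩, ⟨?_, ?_, ?_, ?_⟩, ?_, ?_⟩ <;> grind

/-- The change of basis of the second plane bringing a representation to the normal form. -/
theorem SixRep.exists_basis (h : SixRep L (nfP a b c d) q T) :
    ∃ g : Matrix (Fin 3) (Fin 3) ℝ, g.det ≠ 0 ∧ ∀ i, q i = nfQ a b c d i ᵥ* g := by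
  have hD := (nf_conditions_of_genPos h.genPos_left).2.2.2.2
  have hrel : ∀ i j, ∑ l, nfP a b c d l i * q l j = 0 := by
    intro i j
    have := congrFun (congrFun h.rel i) j
    simpa [Matrix.sum_apply, vecMulVec_apply] using this
  have hq : ∀ i, q i = nfQ a b c d i ᵥ* Matrix.of
      fun i j => -(nfD a b c d)⁻¹ * (![q 0 j, q 1 j, q 2 j] : Fin 3 → ℝ) i := by
    intro i
    ext j
    have h0 := hrel 0 j
    have h1 := hrel 1 j
    have h2 := hrel 2 j
    have hi : nfD a b c d * (nfD a b c d)⁻¹ = 1 := mul_inv_cancel₀ hD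
    simp [Fin.sum_univ_six, nfP] at h0 h1 h2
    generalize (nfD a b c d)⁻¹ = e at *
    simp only [nfD] at hi
    fin_cases i <;> simp [vecMul, dotProduct, Fin.sum_univ_three, nfQ, nfD] <;> grind
  refine ⟨_, ?_, hq⟩
  intro h0
  have := h.genPos_right 0 1 2 (by decide) (by decide) (by decide)
  rw [det_fin_three] at h0
  refine this ?_
  simp [br]
  have hi : nfD a b c d * (nfD a b c d)⁻¹ = 1 := mul_inv_cancel₀ hD
  simp at h0
  generalize (nfD a b c d)⁻¹ = e at *
  grind

/-- The normal form of a representation. -/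
theorem SixRep.exists_map (h : SixRep L (nfP a b c d) q T) :
    NFGen a b c d ∧ ∃ A : V4 →ₗ[ℝ] V4, LinearMap.det A ≠ 0 ∧ ∀ i, L i = (nfL a b c d i).map A := by
  obtain ⟨⟨a0, b0, c0, d0⟩, ⟨a1, b1, c1, d1⟩, ⟨ab, cd, ac, bd⟩, adbc, hD⟩ :=
    nf_conditions_of_genPos h.genPos_left
  have hk : nfK a b c d ≠ 0 := mul_ne_zero (mul_ne_zero adbc bd) (by grind)
  obtain ⟨g, hg, hq⟩ := h.exists_basis
  have hgu : IsUnit g := (isUnit_iff_isUnit_det g).mpr hg.isUnit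
  have hex : ∀ x, ∃ y, nfT a b c d y = g * T x := fun x => nfT_surj hD hk fun i => by
    have := h.form i x
    rwa [hq, ← dotProduct_mulVec, mulVec_mulVec] at this
  choose f hf using hex
  have hinj : ∀ y, nfTLin a b c d y = 0 → y = 0 := fun y hy => nfT_eq_zero hk hy
  have hinj' : ∀ y z, nfT a b c d y = nfT a b c d z → y = z := fun y z hyz =>
    sub_eq_zero.mp (hinj _ (by rw [map_sub, sub_eq_zero]; exact hyz))
  have hlin : ∀ (s : ℝ) (x y : V4), f (s • x + y) = s • f x + f y := fun s x y => hinj' _ _ <| by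
    have := (nfTLin a b c d).map_add (s • f x) (f y)
    rw [map_smul] at this
    rw [hf, map_add, map_smul, mul_add, mul_smul_comm, ← hf, ← hf]
    exact this.symm
  let B : V4 →ₗ[ℝ] V4 :=
    { toFun := f
      map_add' := fun x y => by simpa using hlin 1 x y
      map_smul' := fun s x => by
        have h0 : f 0 = 0 := by simpa using hlin 1 0 0
        simpa [h0] using hlin s x 0 }
  have hB : Function.Injective B := (injective_iff_map_eq_zero B).mpr fun x hx => by
    refine h.inj x (hgu.mul_right_eq_zero.mp ?_)
    have hx' : f x = 0 := hx
    rw [← hf, hx']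
    exact (nfTLin a b c d).map_zero
  let E := LinearEquiv.ofInjectiveEndo B hB
  have hE : ∀ y, g * T (E.symm y) = nfT a b c d y := fun y => by
    rw [← hf]
    exact congrArg _ (E.apply_symm_apply y)
  have hEmul : ∀ y i, T (E.symm y) *ᵥ nfP a b c d i = 0 ↔
      nfT a b c d y *ᵥ nfP a b c d i = 0 := by
    intro y i
    rw [← hE, ← mulVec_mulVec]
    refine ⟨fun h => by rw [h, mulVec_zero], fun h => ?_⟩
    exact mulVec_injective_iff_isUnit.mpr hgu (h.trans (mulVec_zero g).symm)
  have conic : b * d * (a - c) + b * c * (1 - a) + d * a * (c - 1) ≠ 0 := by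
    intro h0
    set y : V4 := ![a - b, b - a, c - d, d - c] with hy
    have := h.cross 3 (E.symm y) ((hEmul y 3).mpr ?_) ?_
    · have := congrFun (E.symm.map_eq_zero_iff.mp this) 0
      exact ab this
    · ext i
      fin_cases i <;> simp [hy, nfT, nfN, nfM, nfP, mulVec, dotProduct, Fin.sum_univ_three] <;> ring
    · rw [hq, vecMul_vecMul, hE]
      ext i
      fin_cases i <;>
        simp [hy, nfT, nfN, nfM, nfK, nfQ, vecMul, dotProduct, Fin.sum_univ_three]
      · ring
      · linear_combination
          -((a * d - b * c) * ((a - 1) * (d - 1) - (b - 1) * (c - 1))) * h0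
      · linear_combination
          (a * d - b * c) * ((a - 1) * (d - 1) - (b - 1) * (c - 1)) * h0
  have hgen : NFGen a b c d :=
    ⟨a0, b0, c0, d0, a1, b1, c1, d1, ab, cd, ac, bd, adbc, hD, conic⟩
  refine ⟨hgen, E.symm, E.symm.isUnit_det'.ne_zero, fun i => ?_⟩
  ext x
  rw [h.mem, mem_map]
  constructor
  · intro hx
    refine ⟨E x, (mem_nfL hgen i _).mpr ((hEmul _ _).mp ?_), E.symm_apply_apply x⟩
    rwa [E.symm_apply_apply]
  · rintro ⟨y, hy, rfl⟩
    exact (hEmul _ _).mpr ((mem_nfL hgen i _).mp hy)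

/-- Projectively equivalent configurations are coarsely equivalent. -/
theorem schlafliCoarse_of_map {L L' : Fin 6 → PLine} {A : V4 →ₗ[ℝ] V4} (hA : LinearMap.det A ≠ 0)
    (σ : Equiv.Perm (Fin 6)) (h : ∀ i, L' (σ i) = (L i).map A) : SchlafliCoarse L' L := by
  have h' : ∀ i, L' i = (L (σ.symm i)).map A := fun i => by simpa using h (σ.symm i)
  rcases lt_or_gt_of_ne hA with hneg | hpos
  · exact .symm _ _ (.rel _ _ (Or.inr ⟨σ.symm, A, hneg, h'⟩))
  · let R : V4 →ₗ[ℝ] V4 := toLin' (diagonal ![-1, 1, 1, 1])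
    have hR : LinearMap.det R < 0 := by simp [R, Fin.prod_univ_four]
    have hRR : R ∘ₗ R = LinearMap.id := by
      rw [← toLin'_mul, diagonal_mul_diagonal, ← toLin'_one]
      congr 1
      ext i j
      fin_cases i <;> fin_cases j <;> simp
    refine .trans _ (fun i => (L' i).map R) _ (.rel _ _ (Or.inr ⟨1, R, hR, fun i => rfl⟩))
      (.symm _ _ (.rel _ _ (Or.inr ⟨σ.symm, R ∘ₗ A, ?_, fun i => ?_⟩)))
    · rw [LinearMap.det_comp]
      exact mul_neg_of_neg_of_pos hR hpos
    · change (L' i).map R = _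
      rw [h', ← Submodule.map_comp]
      rfl

/-- Passing to other representatives of the six points. -/
theorem SixRep.coarse {p : Fin 6 → Fin 3 → ℝ} (h : SixRep L p q T) (σ : Equiv.Perm (Fin 6))
    {g : Matrix (Fin 3) (Fin 3) ℝ} (hg : g.det ≠ 0) {r : Fin 6 → ℝ} (hr : ∀ i, r i ≠ 0)
    (hp : ∀ i, p (σ i) = r i • g *ᵥ nfP a b c d i) :
    NFGen a b c d ∧ SchlafliCoarse L (nfL a b c d) := by
  obtain ⟨q', T', h'⟩ := (h.comp σ).changeBasis hg hr hp
  obtain ⟨hgen, A, hA, hL⟩ := h'.exists_map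
  exact ⟨hgen, schlafliCoarse_of_map hA σ hL⟩

end NormalForm

section Normalisation

open Matrix

/-- The coordinates of the last two points in the projective frame given by the first four. -/
noncomputable def frA (p : Fin 6 → Fin 3 → ℝ) : ℝ :=
  br (p 0) (p 4) (p 2) * br (p 3) (p 1) (p 2) / (br (p 0) (p 3) (p 2) * br (p 4) (p 1) (p 2))

noncomputable def frB (p : Fin 6 → Fin 3 → ℝ) : ℝ :=
  br (p 0) (p 5) (p 2) * br (p 3) (p 1) (p 2) / (br (p 0) (p 3) (p 2) * br (p 5) (p 1) (p 2))

noncomputable def frC (p : Fin 6 → Fin 3 → ℝ) : ℝ :=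
  br (p 0) (p 1) (p 4) * br (p 3) (p 1) (p 2) / (br (p 0) (p 1) (p 3) * br (p 4) (p 1) (p 2))

noncomputable def frD (p : Fin 6 → Fin 3 → ℝ) : ℝ :=
  br (p 0) (p 1) (p 5) * br (p 3) (p 1) (p 2) / (br (p 0) (p 1) (p 3) * br (p 5) (p 1) (p 2))

theorem br_cramer (x y z w : Fin 3 → ℝ) :
    br x y z • w = br w y z • x + br x w z • y + br x y w • z := by
  ext i
  fin_cases i <;> simp [br] <;> ring

theorem exists_frame {p : Fin 6 → Fin 3 → ℝ} (h : GenPos p) :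
    ∃ g : Matrix (Fin 3) (Fin 3) ℝ, g.det ≠ 0 ∧ ∃ r : Fin 6 → ℝ, (∀ i, r i ≠ 0) ∧
      ∀ i, p i = r i • g *ᵥ nfP (frA p) (frB p) (frC p) (frD p) i := by
  have h012 := h 0 1 2 (by decide) (by decide) (by decide)
  have h312 := h 3 1 2 (by decide) (by decide) (by decide)
  have h032 := h 0 3 2 (by decide) (by decide) (by decide)
  have h013 := h 0 1 3 (by decide) (by decide) (by decide)
  have h412 := h 4 1 2 (by decide) (by decide) (by decide)
  have h512 := h 5 1 2 (by decide) (by decide) (by decide)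
  have c3 := br_cramer (p 0) (p 1) (p 2) (p 3)
  have c4 := br_cramer (p 0) (p 1) (p 2) (p 4)
  have c5 := br_cramer (p 0) (p 1) (p 2) (p 5)
  refine ⟨Matrix.of fun i j => ![br (p 3) (p 1) (p 2) * p 0 i, br (p 0) (p 3) (p 2) * p 1 i,
    br (p 0) (p 1) (p 3) * p 2 i] j, ?_,
    ![(br (p 3) (p 1) (p 2))⁻¹, (br (p 0) (p 3) (p 2))⁻¹, (br (p 0) (p 1) (p 3))⁻¹,
      (br (p 0) (p 1) (p 2))⁻¹, br (p 4) (p 1) (p 2) / (br (p 3) (p 1) (p 2) * br (p 0) (p 1) (p 2)),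
      br (p 5) (p 1) (p 2) / (br (p 3) (p 1) (p 2) * br (p 0) (p 1) (p 2))], ?_, ?_⟩
  · have e := mul_ne_zero (mul_ne_zero (mul_ne_zero h312 h032) h013) h012
    convert e using 1
    rw [det_fin_three]
    generalize br (p 3) (p 1) (p 2) = x
    generalize br (p 0) (p 3) (p 2) = y
    generalize br (p 0) (p 1) (p 3) = z
    simp [br]
    ring
  · intro i
    fin_cases i <;> simp [h012, h312, h032, h013, h412, h512]
  · intro i
    simp only [frA, frB, frC, frD]
    generalize br (p 0) (p 1) (p 2) = x at *
    generalize br (p 3) (p 1) (p 2) = y at *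
    generalize br (p 0) (p 3) (p 2) = z at *
    generalize br (p 0) (p 1) (p 3) = w at *
    generalize br (p 4) (p 1) (p 2) = s at *
    generalize br (p 5) (p 1) (p 2) = t at *
    ext j
    have c3 := congrFun c3 j
    have c4 := congrFun c4 j
    have c5 := congrFun c5 j
    simp at c3 c4 c5
    fin_cases i <;> simp [nfP] <;> field_simp <;> grind

theorem SixRep.frame {L : Fin 6 → PLine} {p q : Fin 6 → Fin 3 → ℝ}
    {T : V4 →ₗ[ℝ] Matrix (Fin 3) (Fin 3) ℝ} (h : SixRep L p q T) (σ : Equiv.Perm (Fin 6)) :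
    NFGen (frA (p ∘ σ)) (frB (p ∘ σ)) (frC (p ∘ σ)) (frD (p ∘ σ)) ∧
      SchlafliCoarse L (nfL (frA (p ∘ σ)) (frB (p ∘ σ)) (frC (p ∘ σ)) (frD (p ∘ σ))) := by
  obtain ⟨g, hg, r, hr, hp⟩ := exists_frame (h.comp σ).genPos_left
  exact h.coarse σ hg hr hp

end Normalisation

section Chirotope

open Matrix

/-- The chirotope of a point configuration: `true` records a negative bracket. -/
noncomputable def chirotope (p : Fin 6 → Fin 3 → ℝ) (i j k : Fin 6) : Bool :=
  decide (br (p i) (p j) (p k) < 0)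

/-- The alternating extension of a sign function on increasing triples. -/
def altSign (t : Fin 6 → Fin 6 → Fin 6 → Bool) (i j k : Fin 6) : Bool :=
  if i < j ∧ j < k then t i j k
  else if i < k ∧ k < j then !t i k j
  else if j < i ∧ i < k then !t j i k
  else if j < k ∧ k < i then t j k i
  else if k < i ∧ i < j then t k i j
  else if k < j ∧ j < i then !t k j i
  else false

theorem decide_lt_zero_of_pos {x : ℝ} (hx : 0 < x) : decide (x < 0) = false :=
  decide_eq_false hx.not_gt

theorem decide_lt_zero_of_neg {x : ℝ} (hx : x < 0) : decide (x < 0) = true := decide_eq_true hx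

theorem decide_neg_lt {x : ℝ} (hx : x ≠ 0) : decide (-x < 0) = !decide (x < 0) := by
  rcases lt_or_gt_of_ne hx with h | h
  · rw [decide_lt_zero_of_neg h, decide_lt_zero_of_pos (neg_pos.mpr h), Bool.not_true]
  · rw [decide_lt_zero_of_pos h, decide_lt_zero_of_neg (neg_lt_zero.mpr h), Bool.not_false]

theorem decide_mul_lt {x y : ℝ} (hx : x ≠ 0) (hy : y ≠ 0) :
    decide (x * y < 0) = (decide (x < 0) ^^ decide (y < 0)) := by
  rcases lt_or_gt_of_ne hx with h | h <;> rcases lt_or_gt_of_ne hy with h' | h'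
  · rw [decide_lt_zero_of_neg h, decide_lt_zero_of_neg h',
      decide_lt_zero_of_pos (mul_pos_of_neg_of_neg h h'), Bool.xor_self]
  · rw [decide_lt_zero_of_neg h, decide_lt_zero_of_pos h',
      decide_lt_zero_of_neg (mul_neg_of_neg_of_pos h h'), Bool.xor_false]
  · rw [decide_lt_zero_of_pos h, decide_lt_zero_of_neg h',
      decide_lt_zero_of_neg (mul_neg_of_pos_of_neg h h'), Bool.false_xor]
  · rw [decide_lt_zero_of_pos h, decide_lt_zero_of_pos h', decide_lt_zero_of_pos (mul_pos h h'),
      Bool.xor_self]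

theorem chirotope_swap_left {p : Fin 6 → Fin 3 → ℝ} (hp : GenPos p) {i j k : Fin 6} (hij : i ≠ j)
    (hik : i ≠ k) (hjk : j ≠ k) : chirotope p j i k = !chirotope p i j k := by
  rw [chirotope, br_swap_left, decide_neg_lt (hp i j k hij hik hjk), chirotope]

theorem chirotope_swap_right {p : Fin 6 → Fin 3 → ℝ} (hp : GenPos p) {i j k : Fin 6} (hij : i ≠ j)
    (hik : i ≠ k) (hjk : j ≠ k) : chirotope p i k j = !chirotope p i j k := by
  rw [chirotope, br_swap_right, decide_neg_lt (hp i j k hij hik hjk), chirotope]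

theorem chirotope_eq {p : Fin 6 → Fin 3 → ℝ} (hp : GenPos p) {t : Fin 6 → Fin 6 → Fin 6 → Bool}
    (ht : ∀ i j k, i < j → j < k → chirotope p i j k = t i j k) {i j k : Fin 6} (hij : i ≠ j)
    (hik : i ≠ k) (hjk : j ≠ k) : chirotope p i j k = altSign t i j k := by
  rcases lt_or_gt_of_ne hij with h1 | h1 <;> rcases lt_or_gt_of_ne hik with h2 | h2 <;>
    rcases lt_or_gt_of_ne hjk with h3 | h3
  · rw [ht _ _ _ h1 h3]
    grind [altSign]
  · rw [chirotope_swap_right hp hik hij hjk.symm, ht _ _ _ h2 h3]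
    grind [altSign]
  · exact absurd (h1.trans h3) h2.not_gt
  · rw [chirotope_swap_right hp hik hij hjk.symm, chirotope_swap_left hp hik.symm hjk.symm hij,
      ht _ _ _ h2 h1]
    grind [altSign]
  · rw [chirotope_swap_left hp hij.symm hjk hik, ht _ _ _ h1 h2]
    grind [altSign]
  · exact absurd (h2.trans h3) h1.not_gt
  · rw [chirotope_swap_left hp hij.symm hjk hik, chirotope_swap_right hp hjk hij.symm hik.symm,
      ht _ _ _ h3 h2]
    grind [altSign]
  · rw [chirotope_swap_left hp hij.symm hjk hik, chirotope_swap_right hp hjk hij.symm hik.symm,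
      chirotope_swap_left hp hjk.symm hik.symm hij.symm, ht _ _ _ h3 h1]
    grind [altSign]

/-- Compatibility of a chirotope with a three-term Grassmann–Plücker relation. -/
def gpCompat (s : Fin 6 → Fin 6 → Fin 6 → Bool) (i j k l m : Fin 6) : Prop :=
  ¬((s i j k ^^ s i l m) = (!(s i j l ^^ s i k m)) ∧
    (s i j k ^^ s i l m) = (s i j m ^^ s i k l))

instance (s : Fin 6 → Fin 6 → Fin 6 → Bool) (i j k l m : Fin 6) :
    Decidable (gpCompat s i j k l m) := by
  unfold gpCompat
  infer_instance

theorem chirotope_gpCompat {p : Fin 6 → Fin 3 → ℝ} (hp : GenPos p) {i j k l m : Fin 6}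
    (hij : i ≠ j) (hik : i ≠ k) (hil : i ≠ l) (him : i ≠ m) (hjk : j ≠ k) (hjl : j ≠ l)
    (hjm : j ≠ m) (hkl : k ≠ l) (hkm : k ≠ m) (hlm : l ≠ m) :
    gpCompat (chirotope p) i j k l m := by
  have h1 := hp i j k hij hik hjk
  have h2 := hp i l m hil him hlm
  have h3 := hp i j l hij hil hjl
  have h4 := hp i k m hik him hkm
  have h5 := hp i j m hij him hjm
  have h6 := hp i k l hik hil hkl
  have hr : br (p i) (p j) (p k) * br (p i) (p l) (p m) - br (p i) (p j) (p l) *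
      br (p i) (p k) (p m) + br (p i) (p j) (p m) * br (p i) (p k) (p l) = 0 := by
    simp only [br]
    ring
  simp only [gpCompat, chirotope]
  rw [← decide_mul_lt h1 h2, ← decide_mul_lt h3 h4, ← decide_mul_lt h5 h6]
  have n1 := mul_ne_zero h1 h2
  have n2 := mul_ne_zero h3 h4
  have n3 := mul_ne_zero h5 h6
  generalize br (p i) (p j) (p k) * br (p i) (p l) (p m) = x at *
  generalize br (p i) (p j) (p l) * br (p i) (p k) (p m) = y at *
  generalize br (p i) (p j) (p m) * br (p i) (p k) (p l) = z at *
  rintro ⟨e1, e2⟩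
  rcases lt_or_gt_of_ne n1 with h | h
  · rw [decide_lt_zero_of_neg h] at e1 e2
    have hz := of_decide_eq_true e2.symm
    have hy : ¬ y < 0 := by simpa using e1
    linarith
  · rw [decide_lt_zero_of_pos h] at e1 e2
    have hz := of_decide_eq_false e2.symm
    have hy : y < 0 := by simpa using e1
    linarith

end Chirotope

section FrameSigns

open Matrix

theorem decide_mul_four {x y z w : ℝ} (hx : x ≠ 0) (hy : y ≠ 0) (hz : z ≠ 0) (hw : w ≠ 0) :
    decide (x * y * z * w < 0) =
      (decide (x < 0) ^^ decide (y < 0) ^^ decide (z < 0) ^^ decide (w < 0)) := by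
  rw [decide_mul_lt (mul_ne_zero (mul_ne_zero hx hy) hz) hw,
    decide_mul_lt (mul_ne_zero hx hy) hz, decide_mul_lt hx hy]

theorem decide_mul_six {x y z w u v : ℝ} (hx : x ≠ 0) (hy : y ≠ 0) (hz : z ≠ 0) (hw : w ≠ 0)
    (hu : u ≠ 0) (hv : v ≠ 0) :
    decide (x * y * z * w * u * v < 0) =
      (decide (x < 0) ^^ decide (y < 0) ^^ decide (z < 0) ^^ decide (w < 0) ^^
        decide (u < 0) ^^ decide (v < 0)) := by
  have h4 := mul_ne_zero (mul_ne_zero (mul_ne_zero hx hy) hz) hw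
  rw [decide_mul_lt (mul_ne_zero h4 hu) hv, decide_mul_lt h4 hu, decide_mul_four hx hy hz hw]

theorem pos_of_mul_sq {t q P : ℝ} (h : t * q ^ 2 = P) (hP : P ≠ 0) (h' : decide (P < 0) = false) :
    0 < t :=
  pos_of_mul_pos_left (h ▸ lt_of_le_of_ne (not_lt.mp (of_decide_eq_false h')) hP.symm) (sq_nonneg q)

theorem neg_of_mul_sq {t q P : ℝ} (h : t * q ^ 2 = P) (h' : decide (P < 0) = true) : t < 0 := by
  by_contra ht
  exact absurd (of_decide_eq_true h') (not_lt.mpr (h ▸ mul_nonneg (not_lt.mp ht) (sq_nonneg q)))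

variable {p : Fin 6 → Fin 3 → ℝ}

theorem frA_mul (hp : GenPos p) :
    frA p * (br (p 0) (p 3) (p 2) * br (p 4) (p 1) (p 2)) =
      br (p 0) (p 4) (p 2) * br (p 3) (p 1) (p 2) :=
  div_mul_cancel₀ _ (mul_ne_zero (hp 0 3 2 (by decide) (by decide) (by decide))
    (hp 4 1 2 (by decide) (by decide) (by decide)))

theorem frB_mul (hp : GenPos p) :
    frB p * (br (p 0) (p 3) (p 2) * br (p 5) (p 1) (p 2)) =
      br (p 0) (p 5) (p 2) * br (p 3) (p 1) (p 2) :=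
  div_mul_cancel₀ _ (mul_ne_zero (hp 0 3 2 (by decide) (by decide) (by decide))
    (hp 5 1 2 (by decide) (by decide) (by decide)))

theorem frC_mul (hp : GenPos p) :
    frC p * (br (p 0) (p 1) (p 3) * br (p 4) (p 1) (p 2)) =
      br (p 0) (p 1) (p 4) * br (p 3) (p 1) (p 2) :=
  div_mul_cancel₀ _ (mul_ne_zero (hp 0 1 3 (by decide) (by decide) (by decide))
    (hp 4 1 2 (by decide) (by decide) (by decide)))

theorem frD_mul (hp : GenPos p) :
    frD p * (br (p 0) (p 1) (p 3) * br (p 5) (p 1) (p 2)) =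
      br (p 0) (p 1) (p 5) * br (p 3) (p 1) (p 2) :=
  div_mul_cancel₀ _ (mul_ne_zero (hp 0 1 3 (by decide) (by decide) (by decide))
    (hp 5 1 2 (by decide) (by decide) (by decide)))

theorem frA_sub_one_mul_sq (hp : GenPos p) :
    (frA p - 1) * (br (p 0) (p 3) (p 2) * br (p 4) (p 1) (p 2)) ^ 2 =
      br (p 0) (p 1) (p 2) * br (p 2) (p 3) (p 4) * br (p 0) (p 3) (p 2) * br (p 4) (p 1) (p 2)
        := by
  have hA := frA_mul hp
  have e : br (p 0) (p 4) (p 2) * br (p 3) (p 1) (p 2) - br (p 0) (p 3) (p 2) * br (p 4) (p 1) (p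
    2) = br (p 0) (p 1) (p 2) * br (p 2) (p 3) (p 4) := by
    simp only [br]
    ring
  generalize br (p 0) (p 1) (p 2) = x₁ at *
  generalize br (p 0) (p 3) (p 2) = x₂ at *
  generalize br (p 0) (p 4) (p 2) = x₃ at *
  generalize br (p 2) (p 3) (p 4) = x₄ at *
  generalize br (p 3) (p 1) (p 2) = x₅ at *
  generalize br (p 4) (p 1) (p 2) = x₆ at *
  linear_combination x₂ * x₆ * (hA + e)

theorem frC_sub_frA_mul_sq (hp : GenPos p) :
    (frC p - frA p) * (br (p 0) (p 1) (p 3) * br (p 0) (p 3) (p 2) * br (p 4) (p 1) (p 2)) ^ 2 =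
      br (p 0) (p 3) (p 4) * br (p 0) (p 1) (p 2) * br (p 3) (p 1) (p 2) * br (p 0) (p 1) (p 3) *
        br (p 0) (p 3) (p 2) * br (p 4) (p 1) (p 2) := by
  have hA := frA_mul hp
  have hC := frC_mul hp
  have e : br (p 0) (p 1) (p 4) * br (p 0) (p 3) (p 2) - br (p 0) (p 4) (p 2) * br (p 0) (p 1) (p
    3) = br (p 0) (p 1) (p 2) * br (p 0) (p 3) (p 4) := by
    simp only [br]
    ring
  generalize br (p 0) (p 1) (p 2) = x₁ at *
  generalize br (p 0) (p 1) (p 3) = x₂ at *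
  generalize br (p 0) (p 1) (p 4) = x₃ at *
  generalize br (p 0) (p 3) (p 2) = x₄ at *
  generalize br (p 0) (p 3) (p 4) = x₅ at *
  generalize br (p 0) (p 4) (p 2) = x₆ at *
  generalize br (p 3) (p 1) (p 2) = x₇ at *
  generalize br (p 4) (p 1) (p 2) = x₈ at *
  linear_combination x₂ * x₄ ^ 2 * x₈ * hC - x₂ ^ 2 * x₄ * x₈ * hA + x₂ * x₄ * x₈ * x₇ * e

theorem frB_mul_sq (hp : GenPos p) :
    (frB p) * (br (p 0) (p 3) (p 2) * br (p 5) (p 1) (p 2)) ^ 2 =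
      br (p 0) (p 5) (p 2) * br (p 0) (p 3) (p 2) * br (p 3) (p 1) (p 2) * br (p 5) (p 1) (p 2)
        := by
  have hB := frB_mul hp
  generalize br (p 0) (p 3) (p 2) = x₁ at *
  generalize br (p 0) (p 5) (p 2) = x₂ at *
  generalize br (p 3) (p 1) (p 2) = x₃ at *
  generalize br (p 5) (p 1) (p 2) = x₄ at *
  linear_combination x₁ * x₄ * hB

theorem frD_mul_sq (hp : GenPos p) :
    (frD p) * (br (p 0) (p 1) (p 3) * br (p 5) (p 1) (p 2)) ^ 2 =
      br (p 0) (p 1) (p 5) * br (p 0) (p 1) (p 3) * br (p 3) (p 1) (p 2) * br (p 5) (p 1) (p 2)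
        := by
  have hD := frD_mul hp
  generalize br (p 0) (p 1) (p 3) = x₁ at *
  generalize br (p 0) (p 1) (p 5) = x₂ at *
  generalize br (p 3) (p 1) (p 2) = x₃ at *
  generalize br (p 5) (p 1) (p 2) = x₄ at *
  linear_combination x₁ * x₄ * hD

theorem frB_sub_frA_mul_sq (hp : GenPos p) :
    (frB p - frA p) * (br (p 0) (p 3) (p 2) * br (p 5) (p 1) (p 2) * br (p 4) (p 1) (p 2)) ^ 2 =
      br (p 3) (p 1) (p 2) * br (p 0) (p 3) (p 2) * br (p 2) (p 4) (p 5) * br (p 0) (p 1) (p 2) *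
        br (p 5) (p 1) (p 2) * br (p 4) (p 1) (p 2) := by
  have hA := frA_mul hp
  have hB := frB_mul hp
  have e : br (p 0) (p 5) (p 2) * br (p 4) (p 1) (p 2) - br (p 0) (p 4) (p 2) * br (p 5) (p 1) (p
    2) = br (p 0) (p 1) (p 2) * br (p 2) (p 4) (p 5) := by
    simp only [br]
    ring
  generalize br (p 0) (p 1) (p 2) = x₁ at *
  generalize br (p 0) (p 3) (p 2) = x₂ at *
  generalize br (p 0) (p 4) (p 2) = x₃ at *
  generalize br (p 0) (p 5) (p 2) = x₄ at *
  generalize br (p 2) (p 4) (p 5) = x₅ at *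
  generalize br (p 3) (p 1) (p 2) = x₆ at *
  generalize br (p 4) (p 1) (p 2) = x₇ at *
  generalize br (p 5) (p 1) (p 2) = x₈ at *
  linear_combination x₂ * x₈ * x₇ ^ 2 * hB - x₂ * x₈ ^ 2 * x₇ * hA + x₂ * x₈ * x₇ * x₆ * e

theorem frC_sub_frD_mul_sq (hp : GenPos p) :
    (frC p - frD p) * (br (p 0) (p 1) (p 3) * br (p 5) (p 1) (p 2) * br (p 4) (p 1) (p 2)) ^ 2 =
      br (p 3) (p 1) (p 2) * br (p 0) (p 1) (p 3) * br (p 1) (p 4) (p 5) * br (p 0) (p 1) (p 2) *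
        br (p 5) (p 1) (p 2) * br (p 4) (p 1) (p 2) := by
  have hC := frC_mul hp
  have hD := frD_mul hp
  have e : br (p 0) (p 1) (p 4) * br (p 5) (p 1) (p 2) - br (p 0) (p 1) (p 5) * br (p 4) (p 1) (p
    2) = br (p 0) (p 1) (p 2) * br (p 1) (p 4) (p 5) := by
    simp only [br]
    ring
  generalize br (p 0) (p 1) (p 2) = x₁ at *
  generalize br (p 0) (p 1) (p 3) = x₂ at *
  generalize br (p 0) (p 1) (p 4) = x₃ at *
  generalize br (p 0) (p 1) (p 5) = x₄ at *
  generalize br (p 1) (p 4) (p 5) = x₅ at *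
  generalize br (p 3) (p 1) (p 2) = x₆ at *
  generalize br (p 4) (p 1) (p 2) = x₇ at *
  generalize br (p 5) (p 1) (p 2) = x₈ at *
  linear_combination x₂ * x₈ ^ 2 * x₇ * hC - x₂ * x₈ * x₇ ^ 2 * hD + x₂ * x₈ * x₇ * x₆ * e

theorem frB_sub_one_mul_sq (hp : GenPos p) :
    (frB p - 1) * (br (p 0) (p 3) (p 2) * br (p 5) (p 1) (p 2)) ^ 2 =
      br (p 0) (p 1) (p 2) * br (p 2) (p 3) (p 5) * br (p 0) (p 3) (p 2) * br (p 5) (p 1) (p 2)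
        := by
  have hB := frB_mul hp
  have e : br (p 0) (p 5) (p 2) * br (p 3) (p 1) (p 2) - br (p 0) (p 3) (p 2) * br (p 5) (p 1) (p
    2) = br (p 0) (p 1) (p 2) * br (p 2) (p 3) (p 5) := by
    simp only [br]
    ring
  generalize br (p 0) (p 1) (p 2) = x₁ at *
  generalize br (p 0) (p 3) (p 2) = x₂ at *
  generalize br (p 0) (p 5) (p 2) = x₃ at *
  generalize br (p 2) (p 3) (p 5) = x₄ at *
  generalize br (p 3) (p 1) (p 2) = x₅ at *
  generalize br (p 5) (p 1) (p 2) = x₆ at *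
  linear_combination x₂ * x₆ * (hB + e)

theorem one_sub_frD_mul_sq (hp : GenPos p) :
    (1 - frD p) * (br (p 0) (p 1) (p 3) * br (p 5) (p 1) (p 2)) ^ 2 =
      br (p 0) (p 1) (p 2) * br (p 1) (p 3) (p 5) * br (p 0) (p 1) (p 3) * br (p 5) (p 1) (p 2)
        := by
  have hD := frD_mul hp
  have e : br (p 0) (p 1) (p 3) * br (p 5) (p 1) (p 2) - br (p 0) (p 1) (p 5) * br (p 3) (p 1) (p
    2) = br (p 0) (p 1) (p 2) * br (p 1) (p 3) (p 5) := by
    simp only [br]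
    ring
  generalize br (p 0) (p 1) (p 2) = x₁ at *
  generalize br (p 0) (p 1) (p 3) = x₂ at *
  generalize br (p 0) (p 1) (p 5) = x₃ at *
  generalize br (p 1) (p 3) (p 5) = x₄ at *
  generalize br (p 3) (p 1) (p 2) = x₅ at *
  generalize br (p 5) (p 1) (p 2) = x₆ at *
  linear_combination x₂ * x₆ * (-hD + e)

theorem frA_frD_sub_mul_sq (hp : GenPos p) :
    (frA p * frD p - frB p * frC p) * (br (p 0) (p 3) (p 2) * br (p 0) (p 1) (p 3) * br (p 4) (p
      1) (p 2) * br (p 5) (p 1) (p 2)) ^ 2 =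
      br (p 0) (p 3) (p 2) * br (p 0) (p 1) (p 3) * br (p 4) (p 1) (p 2) * br (p 5) (p 1) (p 2) *
        br (p 0) (p 4) (p 5) * br (p 0) (p 1) (p 2) * br (p 3) (p 1) (p 2) ^ 2 := by
  have hA := frA_mul hp
  have hB := frB_mul hp
  have hC := frC_mul hp
  have hD := frD_mul hp
  have e : br (p 0) (p 4) (p 2) * br (p 0) (p 1) (p 5) - br (p 0) (p 5) (p 2) * br (p 0) (p 1) (p
    4) = br (p 0) (p 1) (p 2) * br (p 0) (p 4) (p 5) := by
    simp only [br]
    ring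
  generalize br (p 0) (p 1) (p 2) = x₁ at *
  generalize br (p 0) (p 1) (p 3) = x₂ at *
  generalize br (p 0) (p 1) (p 4) = x₃ at *
  generalize br (p 0) (p 1) (p 5) = x₄ at *
  generalize br (p 0) (p 3) (p 2) = x₅ at *
  generalize br (p 0) (p 4) (p 2) = x₆ at *
  generalize br (p 0) (p 4) (p 5) = x₇ at *
  generalize br (p 0) (p 5) (p 2) = x₈ at *
  generalize br (p 3) (p 1) (p 2) = x₉ at *
  generalize br (p 4) (p 1) (p 2) = y₁ at *
  generalize br (p 5) (p 1) (p 2) = y₂ at *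
  linear_combination x₅ * y₁ * x₂ * y₂ * (hA * frD p * (x₂ * y₂) + x₆ * x₉ * hD - hB * frC p * (x₂ * y₁) - x₈ * x₉ * hC + x₉ ^ 2 * e)

theorem GenPos.apply (hp : GenPos p) {i j k : Fin 6} (h : i ≠ j ∧ i ≠ k ∧ j ≠ k) :
    br (p i) (p j) (p k) ≠ 0 := hp i j k h.1 h.2.1 h.2.2

theorem one_lt_frA (hp : GenPos p)
    (h : (chirotope p 0 1 2 ^^ chirotope p 2 3 4 ^^ chirotope p 0 3 2 ^^ chirotope p 4 1 2) =
      false) : 1 < frA p := by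
  have h' := (decide_mul_four (hp.apply (by decide)) (hp.apply (by decide))
    (hp.apply (by decide)) (hp.apply (by decide))).trans h
  refine sub_pos.mp (pos_of_mul_sq (frA_sub_one_mul_sq hp) ?_ h')
  repeat' apply mul_ne_zero
  all_goals exact hp.apply (by decide)

theorem frA_lt_frC (hp : GenPos p)
    (h : (chirotope p 0 3 4 ^^ chirotope p 0 1 2 ^^ chirotope p 3 1 2 ^^ chirotope p 0 1 3 ^^
      chirotope p 0 3 2 ^^ chirotope p 4 1 2) = false) : frA p < frC p := by
  have h' := (decide_mul_six (hp.apply (by decide)) (hp.apply (by decide))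
    (hp.apply (by decide)) (hp.apply (by decide))
    (hp.apply (by decide)) (hp.apply (by decide))).trans h
  refine sub_pos.mp (pos_of_mul_sq (frC_sub_frA_mul_sq hp) ?_ h')
  repeat' apply mul_ne_zero
  all_goals exact hp.apply (by decide)

theorem frB_neg (hp : GenPos p)
    (h : (chirotope p 0 5 2 ^^ chirotope p 0 3 2 ^^ chirotope p 3 1 2 ^^ chirotope p 5 1 2) =
      true) : frB p < 0 := by
  have h' := (decide_mul_four (hp.apply (by decide)) (hp.apply (by decide))
    (hp.apply (by decide)) (hp.apply (by decide))).trans h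
  exact (neg_of_mul_sq (frB_mul_sq hp) h')

theorem frB_pos (hp : GenPos p)
    (h : (chirotope p 0 5 2 ^^ chirotope p 0 3 2 ^^ chirotope p 3 1 2 ^^ chirotope p 5 1 2) =
      false) : 0 < frB p := by
  have h' := (decide_mul_four (hp.apply (by decide)) (hp.apply (by decide))
    (hp.apply (by decide)) (hp.apply (by decide))).trans h
  refine (pos_of_mul_sq (frB_mul_sq hp) ?_ h')
  repeat' apply mul_ne_zero
  all_goals exact hp.apply (by decide)

theorem frD_neg (hp : GenPos p)
    (h : (chirotope p 0 1 5 ^^ chirotope p 0 1 3 ^^ chirotope p 3 1 2 ^^ chirotope p 5 1 2) =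
      true) : frD p < 0 := by
  have h' := (decide_mul_four (hp.apply (by decide)) (hp.apply (by decide))
    (hp.apply (by decide)) (hp.apply (by decide))).trans h
  exact (neg_of_mul_sq (frD_mul_sq hp) h')

theorem frA_lt_frB (hp : GenPos p)
    (h : (chirotope p 3 1 2 ^^ chirotope p 0 3 2 ^^ chirotope p 2 4 5 ^^ chirotope p 0 1 2 ^^
      chirotope p 5 1 2 ^^ chirotope p 4 1 2) = false) : frA p < frB p := by
  have h' := (decide_mul_six (hp.apply (by decide)) (hp.apply (by decide))
    (hp.apply (by decide)) (hp.apply (by decide))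
    (hp.apply (by decide)) (hp.apply (by decide))).trans h
  refine sub_pos.mp (pos_of_mul_sq (frB_sub_frA_mul_sq hp) ?_ h')
  repeat' apply mul_ne_zero
  all_goals exact hp.apply (by decide)

theorem frD_lt_frC (hp : GenPos p)
    (h : (chirotope p 3 1 2 ^^ chirotope p 0 1 3 ^^ chirotope p 1 4 5 ^^ chirotope p 0 1 2 ^^
      chirotope p 5 1 2 ^^ chirotope p 4 1 2) = false) : frD p < frC p := by
  have h' := (decide_mul_six (hp.apply (by decide)) (hp.apply (by decide))
    (hp.apply (by decide)) (hp.apply (by decide))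
    (hp.apply (by decide)) (hp.apply (by decide))).trans h
  refine sub_pos.mp (pos_of_mul_sq (frC_sub_frD_mul_sq hp) ?_ h')
  repeat' apply mul_ne_zero
  all_goals exact hp.apply (by decide)

theorem frC_lt_frD (hp : GenPos p)
    (h : (chirotope p 3 1 2 ^^ chirotope p 0 1 3 ^^ chirotope p 1 4 5 ^^ chirotope p 0 1 2 ^^
      chirotope p 5 1 2 ^^ chirotope p 4 1 2) = true) : frC p < frD p := by
  have h' := (decide_mul_six (hp.apply (by decide)) (hp.apply (by decide))
    (hp.apply (by decide)) (hp.apply (by decide))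
    (hp.apply (by decide)) (hp.apply (by decide))).trans h
  exact sub_neg.mp (neg_of_mul_sq (frC_sub_frD_mul_sq hp) h')

theorem frB_lt_one (hp : GenPos p)
    (h : (chirotope p 0 1 2 ^^ chirotope p 2 3 5 ^^ chirotope p 0 3 2 ^^ chirotope p 5 1 2) =
      true) : frB p < 1 := by
  have h' := (decide_mul_four (hp.apply (by decide)) (hp.apply (by decide))
    (hp.apply (by decide)) (hp.apply (by decide))).trans h
  exact sub_neg.mp (neg_of_mul_sq (frB_sub_one_mul_sq hp) h')

theorem one_lt_frD (hp : GenPos p)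
    (h : (chirotope p 0 1 2 ^^ chirotope p 1 3 5 ^^ chirotope p 0 1 3 ^^ chirotope p 5 1 2) =
      true) : 1 < frD p := by
  have h' := (decide_mul_four (hp.apply (by decide)) (hp.apply (by decide))
    (hp.apply (by decide)) (hp.apply (by decide))).trans h
  exact sub_neg.mp (neg_of_mul_sq (one_sub_frD_mul_sq hp) h')

theorem frB_frC_lt (hp : GenPos p)
    (h : (chirotope p 0 3 2 ^^ chirotope p 0 1 3 ^^ chirotope p 4 1 2 ^^ chirotope p 5 1 2 ^^
      chirotope p 0 4 5 ^^ chirotope p 0 1 2) = false) : frB p * frC p < frA p * frD p := by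
  have h' := (decide_mul_six (hp.apply (by decide)) (hp.apply (by decide))
    (hp.apply (by decide)) (hp.apply (by decide))
    (hp.apply (by decide)) (hp.apply (by decide))).trans h
  have h312 : br (p 3) (p 1) (p 2) ≠ 0 := hp.apply (by decide)
  refine sub_pos.mp (pos_of_mul_sq (frA_frD_sub_mul_sq hp) ?_ ?_)
  · refine mul_ne_zero ?_ (pow_ne_zero 2 h312)
    repeat' apply mul_ne_zero
    all_goals exact hp.apply (by decide)
  · have hsq : 0 < br (p 3) (p 1) (p 2) ^ 2 := by positivity
    exact decide_eq_false (not_lt.mpr (mul_nonneg (not_lt.mp (of_decide_eq_false h')) hsq.le))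

end FrameSigns

section Chambers

open Matrix

/-- The sign condition for the frame coordinates to satisfy `1 < a < c`. -/
def mainSigns (s : Fin 6 → Fin 6 → Fin 6 → Bool) : Bool :=
  !(s 0 1 2 ^^ s 2 3 4 ^^ s 0 3 2 ^^ s 4 1 2) &&
    !(s 0 3 4 ^^ s 0 1 2 ^^ s 3 1 2 ^^ s 0 1 3 ^^ s 0 3 2 ^^ s 4 1 2)

/-- The sign condition for the frame coordinates to lie in one of the four chambers, up to the
position with respect to the conic in the hexagonal case. -/
def chamberSigns (s : Fin 6 → Fin 6 → Fin 6 → Bool) : Bool :=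
  let b0 := s 0 5 2 ^^ s 0 3 2 ^^ s 3 1 2 ^^ s 5 1 2
  let cd := s 3 1 2 ^^ s 0 1 3 ^^ s 1 4 5 ^^ s 0 1 2 ^^ s 5 1 2 ^^ s 4 1 2
  let d1 := s 0 1 2 ^^ s 1 3 5 ^^ s 0 1 3 ^^ s 5 1 2
  let hex := (s 0 1 5 ^^ s 0 1 3 ^^ s 3 1 2 ^^ s 5 1 2) &&
    !(s 3 1 2 ^^ s 0 3 2 ^^ s 2 4 5 ^^ s 0 1 2 ^^ s 5 1 2 ^^ s 4 1 2)
  let ico := !b0 && (s 0 1 2 ^^ s 2 3 5 ^^ s 0 3 2 ^^ s 5 1 2) && d1 && !cd &&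
    !(s 0 3 2 ^^ s 0 1 3 ^^ s 4 1 2 ^^ s 5 1 2 ^^ s 0 4 5 ^^ s 0 1 2)
  mainSigns s && (hex || (b0 && cd) || (b0 && d1 && !cd) || ico)

/-- A sign function on increasing triples given by its values in colexicographic order. -/
def tripleTable (l : List Bool) (i j k : Fin 6) : Bool :=
  l.getD (k.val * (k.val - 1) * (k.val - 2) / 6 + j.val * (j.val - 1) / 2 + i.val) false

/-- Relabellings realising `mainSigns`. -/
def mainPerms : List (Fin 6 → Fin 6) :=
  [![0, 1, 2, 3, 4, 5], ![0, 1, 2, 4, 3, 5], ![0, 1, 3, 2, 4, 5], ![0, 1, 3, 4, 2, 5],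
    ![0, 1, 4, 2, 3, 5], ![0, 1, 4, 3, 2, 5], ![0, 2, 1, 3, 4, 5], ![0, 2, 1, 4, 3, 5],
    ![0, 2, 3, 4, 1, 5], ![0, 2, 4, 3, 1, 5], ![0, 3, 1, 4, 2, 5], ![0, 3, 2, 4, 1, 5]]

/-- Relabellings realising `chamberSigns`. -/
def chamberPerms : List (Fin 6 → Fin 6) :=
  [![0, 1, 2, 3, 4, 5], ![0, 3, 4, 1, 2, 5], ![0, 5, 2, 3, 4, 1], ![0, 5, 4, 1, 2, 3],
    ![1, 2, 4, 0, 3, 5], ![1, 0, 3, 2, 4, 5], ![1, 3, 2, 0, 5, 4], ![1, 4, 0, 2, 5, 3],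
    ![2, 5, 3, 1, 0, 4], ![0, 2, 3, 1, 5, 4], ![0, 2, 3, 5, 1, 4], ![0, 4, 1, 3, 5, 2],
    ![1, 2, 5, 0, 3, 4], ![1, 5, 3, 2, 4, 0], ![1, 5, 4, 0, 3, 2], ![2, 0, 5, 1, 4, 3]]

theorem exists_mainPerm : ∀ x₁ x₂ x₃ x₄ x₅ : Bool, ∃ σ ∈ mainPerms, mainSigns fun i j k =>
    altSign (tripleTable [false, false, true, false, x₁, x₂, false, x₃, x₄, x₅])
      (σ i) (σ j) (σ k) := by
  decide +kernel

theorem exists_chamberPerm : ∀ x₁ x₂ x₃ x₄ x₅ x₆ x₇ x₈ x₉ : Bool,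
    gpCompat (altSign (tripleTable [false, false, true, false, false, true, false, false, true,
      false, x₁, x₂, false, x₃, x₄, x₅, x₆, x₇, x₈, x₉])) 0 1 2 4 5 →
    gpCompat (altSign (tripleTable [false, false, true, false, false, true, false, false, true,
      false, x₁, x₂, false, x₃, x₄, x₅, x₆, x₇, x₈, x₉])) 2 1 3 4 5 →
    ∃ σ ∈ chamberPerms, chamberSigns fun i j k =>
      altSign (tripleTable [false, false, true, false, false, true, false, false, true,
        false, x₁, x₂, false, x₃, x₄, x₅, x₆, x₇, x₈, x₉]) (σ i) (σ j) (σ k) := by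
  decide +kernel

theorem injective_of_forall_ne {σ : Fin 6 → Fin 6} (h : ∀ i j, i < j → σ i ≠ σ j) :
    Function.Injective σ := fun i j hij => by
  rcases lt_trichotomy i j with hlt | rfl | hlt
  · exact absurd hij (h i j hlt)
  · rfl
  · exact absurd hij.symm (h j i hlt)

theorem mainPerms_injective : ∀ σ ∈ mainPerms, Function.Injective σ ∧ σ 5 = 5 := by
  simp only [mainPerms, List.forall_mem_cons, List.not_mem_nil, false_imp_iff, implies_true,
    and_true]
  refine ⟨?_, ?_, ?_, ?_, ?_, ?_, ?_, ?_, ?_, ?_, ?_, ?_⟩ <;>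
    exact ⟨injective_of_forall_ne (by decide), rfl⟩

theorem chamberPerms_injective : ∀ σ ∈ chamberPerms, Function.Injective σ := by
  simp only [chamberPerms, List.forall_mem_cons, List.not_mem_nil, false_imp_iff, implies_true,
    and_true]
  refine ⟨?_, ?_, ?_, ?_, ?_, ?_, ?_, ?_, ?_, ?_, ?_, ?_, ?_, ?_, ?_, ?_⟩ <;>
    exact injective_of_forall_ne (by decide)

theorem altSign_congr {t t' : Fin 6 → Fin 6 → Fin 6 → Bool} {P : Fin 6 → Prop}
    (h : ∀ i j k, i < j → j < k → P k → t i j k = t' i j k) {i j k : Fin 6} (hi : P i) (hj : P j)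
    (hk : P k) : altSign t i j k = altSign t' i j k := by
  unfold altSign
  split_ifs <;> grind

theorem mainSigns_congr {s s' : Fin 6 → Fin 6 → Fin 6 → Bool}
    (h : ∀ i j k, i ≠ j ∧ i ≠ k ∧ j ≠ k ∧ i ≠ 5 ∧ j ≠ 5 ∧ k ≠ 5 → s i j k = s' i j k) :
    mainSigns s = mainSigns s' := by
  simp (discharger := decide) only [mainSigns, h]

theorem chamberSigns_congr {s s' : Fin 6 → Fin 6 → Fin 6 → Bool}
    (h : ∀ i j k, i ≠ j ∧ i ≠ k ∧ j ≠ k → s i j k = s' i j k) :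
    chamberSigns s = chamberSigns s' := by
  simp (discharger := decide) only [chamberSigns, mainSigns, h]

theorem gpCompat_congr {s s' : Fin 6 → Fin 6 → Fin 6 → Bool}
    (h : ∀ i j k, i ≠ j ∧ i ≠ k ∧ j ≠ k → s i j k = s' i j k) {i j k l m : Fin 6}
    (hd : [i, j, k, l, m].Nodup) (hs : gpCompat s i j k l m) : gpCompat s' i j k l m := by
  simp only [List.nodup_cons, List.mem_cons, not_or, List.not_mem_nil] at hd
  unfold gpCompat at *
  rwa [h i j k (by tauto), h i l m (by tauto), h i j l (by tauto), h i k m (by tauto),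
    h i j m (by tauto), h i k l (by tauto)] at hs

end Chambers

section Classification

open Matrix

theorem eq_tripleTable (s : Fin 6 → Fin 6 → Fin 6 → Bool) :
    ∀ i j k, i < j → j < k → s i j k = tripleTable [s 0 1 2, s 0 1 3, s 0 2 3, s 1 2 3, s 0 1 4,
      s 0 2 4, s 1 2 4, s 0 3 4, s 1 3 4, s 2 3 4, s 0 1 5, s 0 2 5, s 1 2 5, s 0 3 5, s 1 3 5,
      s 2 3 5, s 0 4 5, s 1 4 5, s 2 4 5, s 3 4 5] i j k := by
  intro i j k hij hjk
  fin_cases i <;> fin_cases j <;> (try exact absurd hij (by decide)) <;> fin_cases k <;>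
    first | exact absurd hjk (by decide) | rfl

theorem eq_tripleTable_of_ne (s : Fin 6 → Fin 6 → Fin 6 → Bool) :
    ∀ i j k, i < j → j < k → k ≠ 5 → s i j k = tripleTable [s 0 1 2, s 0 1 3, s 0 2 3, s 1 2 3,
      s 0 1 4, s 0 2 4, s 1 2 4, s 0 3 4, s 1 3 4, s 2 3 4] i j k := by
  intro i j k hij hjk hk
  fin_cases i <;> fin_cases j <;> (try exact absurd hij (by decide)) <;> fin_cases k <;>
    first | exact absurd hjk (by decide) | exact absurd rfl hk | rfl

theorem chirotope_eq_false {p : Fin 6 → Fin 3 → ℝ} {i j k : Fin 6} {x : ℝ}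
    (h : br (p i) (p j) (p k) = x) (hx : 0 < x) : chirotope p i j k = false := by
  rw [chirotope, h, decide_lt_zero_of_pos hx]

theorem chirotope_eq_true {p : Fin 6 → Fin 3 → ℝ} {i j k : Fin 6} {x : ℝ}
    (h : br (p i) (p j) (p k) = x) (hx : x < 0) : chirotope p i j k = true := by
  rw [chirotope, h, decide_lt_zero_of_neg hx]

theorem exists_mainSigns {p : Fin 6 → Fin 3 → ℝ} (hp : GenPos p)
    (h012 : chirotope p 0 1 2 = false) (h013 : chirotope p 0 1 3 = false)
    (h023 : chirotope p 0 2 3 = true) (h123 : chirotope p 1 2 3 = false)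
    (h124 : chirotope p 1 2 4 = false) :
    ∃ σ : Equiv.Perm (Fin 6), mainSigns (chirotope (p ∘ σ)) = true := by
  obtain ⟨σ, hσ, h⟩ := exists_mainPerm (chirotope p 0 1 4) (chirotope p 0 2 4) (chirotope p 0 3 4)
    (chirotope p 1 3 4) (chirotope p 2 3 4)
  obtain ⟨hinj, h5⟩ := mainPerms_injective σ hσ
  refine ⟨Equiv.ofBijective σ (Finite.injective_iff_bijective.mp hinj), ?_⟩
  rw [← h]
  refine mainSigns_congr fun i j k hd => ?_
  have hne : ∀ i, i ≠ 5 → σ i ≠ 5 := fun i hi => h5 ▸ hinj.ne hi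
  have hij := hinj.ne hd.1
  have hik := hinj.ne hd.2.1
  have hjk := hinj.ne hd.2.2.1
  refine (chirotope_eq hp (t := chirotope p) (fun _ _ _ _ _ => rfl) hij hik hjk).trans ?_
  refine altSign_congr (P := fun k => k ≠ 5) ?_ (hne _ hd.2.2.2.1) (hne _ hd.2.2.2.2.1)
    (hne _ hd.2.2.2.2.2)
  have := eq_tripleTable_of_ne (chirotope p)
  rwa [h012, h013, h023, h123, h124] at this

theorem exists_chamberSigns {p : Fin 6 → Fin 3 → ℝ} (hp : GenPos p)
    (h012 : chirotope p 0 1 2 = false) (h013 : chirotope p 0 1 3 = false)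
    (h023 : chirotope p 0 2 3 = true) (h123 : chirotope p 1 2 3 = false)
    (h014 : chirotope p 0 1 4 = false) (h024 : chirotope p 0 2 4 = true)
    (h124 : chirotope p 1 2 4 = false) (h034 : chirotope p 0 3 4 = false)
    (h134 : chirotope p 1 3 4 = true) (h234 : chirotope p 2 3 4 = false)
    (h125 : chirotope p 1 2 5 = false) :
    ∃ σ : Equiv.Perm (Fin 6), chamberSigns (chirotope (p ∘ σ)) = true := by
  have ht := eq_tripleTable (chirotope p)
  rw [h012, h013, h023, h123, h014, h024, h124, h034, h134, h234, h125] at ht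
  have hc := fun i j k (hd : i ≠ j ∧ i ≠ k ∧ j ≠ k) => chirotope_eq hp ht hd.1 hd.2.1 hd.2.2
  obtain ⟨σ, hσ, h⟩ := exists_chamberPerm _ _ _ _ _ _ _ _ _
    (gpCompat_congr hc (by decide) (chirotope_gpCompat hp (by decide) (by decide) (by decide)
      (by decide) (by decide) (by decide) (by decide) (by decide) (by decide) (by decide)))
    (gpCompat_congr hc (by decide) (chirotope_gpCompat hp (by decide) (by decide) (by decide)
      (by decide) (by decide) (by decide) (by decide) (by decide) (by decide) (by decide)))
  have hinj := chamberPerms_injective σ hσ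
  refine ⟨Equiv.ofBijective σ (Finite.injective_iff_bijective.mp hinj), ?_⟩
  rw [← h]
  exact chamberSigns_congr fun i j k hd => hc _ _ _
    ⟨hinj.ne hd.1, hinj.ne hd.2.1, hinj.ne hd.2.2⟩

theorem lt_of_mainSigns {p : Fin 6 → Fin 3 → ℝ} (hp : GenPos p)
    (h : mainSigns (chirotope p) = true) : 1 < frA p ∧ frA p < frC p := by
  simp only [mainSigns, Bool.and_eq_true, Bool.not_eq_true'] at h
  exact ⟨one_lt_frA hp h.1, frA_lt_frC hp h.2⟩

theorem chamber_of_chamberSigns {p : Fin 6 → Fin 3 → ℝ} (hp : GenPos p)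
    (h : chamberSigns (chirotope p) = true) :
    1 < frA p ∧ frA p < frC p ∧ ((frA p < frB p ∧ frD p < 0) ∨
      IsBip (frA p) (frB p) (frC p) (frD p) ∨ IsTri (frA p) (frB p) (frC p) (frD p) ∨
      IsIco (frA p) (frB p) (frC p) (frD p)) := by
  simp only [chamberSigns, Bool.and_eq_true, Bool.or_eq_true, Bool.not_eq_true'] at h
  obtain ⟨hm, h⟩ := h
  obtain ⟨h1, h2⟩ := lt_of_mainSigns hp hm
  refine ⟨h1, h2, ?_⟩
  rcases h with ((⟨h3, h4⟩ | ⟨h3, h4⟩) | ⟨⟨h3, h4⟩, h5⟩) | ⟨⟨⟨⟨h3, h4⟩, h5⟩, h6⟩, h7⟩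
  · exact Or.inl ⟨frA_lt_frB hp h4, frD_neg hp h3⟩
  · exact Or.inr (Or.inl ⟨h1, h2, frB_neg hp h3, frC_lt_frD hp h4⟩)
  · exact Or.inr (Or.inr (Or.inl ⟨h1, h2, frB_neg hp h3, one_lt_frD hp h4, frD_lt_frC hp h5⟩))
  · exact Or.inr (Or.inr (Or.inr ⟨h1, h2, frB_pos hp h3, frB_lt_one hp h4, one_lt_frD hp h5,
      frD_lt_frC hp h6, frB_frC_lt hp h7⟩))

theorem exists_isHex {a b c d : ℝ} (h : NFGen a b c d) (h1 : 1 < a) (h2 : a < c) (h3 : a < b)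
    (h4 : d < 0) : ∃ a' b' c' d', IsHex a' b' c' d' ∧ SchlafliCoarse (nfL a b c d)
      (nfL a' b' c' d') := by
  rcases lt_or_gt_of_ne h.conic with hK | hK
  · let σ : Equiv.Perm (Fin 6) := ⟨![1, 0, 4, 5, 2, 3], ![1, 0, 4, 5, 2, 3], by decide, by decide⟩
    refine ⟨_, _, _, _, ?_, ((nf_rep h).frame σ).2⟩
    have hA : frA (nfP a b c d ∘ σ) = (b * c - a * d) / (a * (c - d)) := by
      simp [frA, σ, nfP, br]
      grind
    have hB : frB (nfP a b c d ∘ σ) = (c - 1) * (b * c - a * d) / ((c - d) * (c - a)) := by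
      simp [frB, σ, nfP, br]
      grind
    have hC : frC (nfP a b c d ∘ σ) = (b * c - a * d) / (a * -d) := by
      simp [frC, σ, nfP, br]
      grind
    have hD : frD (nfP a b c d ∘ σ) = -((b * c - a * d) / (-d * (c - a))) := by
      simp [frD, σ, nfP, br]
      grind
    rw [hA, hB, hC, hD]
    have ha : 0 < a := by linarith
    have hc : 0 < c := by linarith
    have hu : 0 < c - d := by linarith
    have he : 0 < -d := by linarith
    have hf : 0 < c - a := by linarith
    have hW : a * (c - d) < b * c - a * d := by nlinarith
    have hW0 : 0 < b * c - a * d := by nlinarith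
    refine ⟨?_, ?_, ?_, ?_, ?_⟩
    · rwa [one_lt_div (by positivity)]
    · exact div_lt_div_of_pos_left hW0 (by positivity) (by nlinarith)
    · rw [div_lt_div_iff₀ (by positivity) (by positivity)]
      have : 0 < (b * c - a * d) * (c - d) * (c * (a - 1)) :=
        mul_pos (by positivity) (mul_pos hc (by linarith))
      nlinarith
    · exact neg_neg_of_pos (by positivity)
    · have : 0 < -(b * d * (a - c) + b * c * (1 - a) + d * a * (c - 1)) *
          ((b * c - a * d) * c / (a * (c - d) * -d * (c - a))) ^ 2 :=
        mul_pos (by linarith) (by positivity)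
      refine this.trans_eq ?_
      have h5 := ha.ne'
      have h6 := hu.ne'
      have h7 := hf.ne'
      have h8 := h.d0
      field_simp
      ring
  · exact ⟨a, b, c, d, ⟨h1, h2, h3, h4, hK⟩, .refl _⟩

theorem exists_one_lt {a b c d : ℝ} (h : NFGen a b c d) :
    ∃ a' b' c' d', NFGen a' b' c' d' ∧ 1 < a' ∧ a' < c' ∧
      SchlafliCoarse (nfL a b c d) (nfL a' b' c' d') := by
  have hp := nfP_genPos h
  obtain ⟨σ, hσ⟩ := exists_mainSigns hp
    (chirotope_eq_false (x := 1) (by simp [nfP, br]) one_pos)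
    (chirotope_eq_false (x := 1) (by simp [nfP, br]) one_pos)
    (chirotope_eq_true (x := -1) (by simp [nfP, br]) (by norm_num))
    (chirotope_eq_false (x := 1) (by simp [nfP, br]) one_pos)
    (chirotope_eq_false (x := 1) (by simp [nfP, br]) one_pos)
  obtain ⟨h1, h2⟩ := lt_of_mainSigns ((nf_rep h).comp σ).genPos_left hσ
  obtain ⟨h3, h4⟩ := (nf_rep h).frame σ
  exact ⟨_, _, _, _, h3, h1, h2, h4⟩

theorem exists_chamber {a b c d : ℝ} (h : NFGen a b c d) (h1 : 1 < a) (h2 : a < c) :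
    ∃ a' b' c' d', (IsHex a' b' c' d' ∨ IsBip a' b' c' d' ∨ IsTri a' b' c' d' ∨
      IsIco a' b' c' d') ∧ SchlafliCoarse (nfL a b c d) (nfL a' b' c' d') := by
  have hp := nfP_genPos h
  obtain ⟨σ, hσ⟩ := exists_chamberSigns hp
    (chirotope_eq_false (x := 1) (by simp [nfP, br]) one_pos)
    (chirotope_eq_false (x := 1) (by simp [nfP, br]) one_pos)
    (chirotope_eq_true (x := -1) (by simp [nfP, br]) (by norm_num))
    (chirotope_eq_false (x := 1) (by simp [nfP, br]) one_pos)
    (chirotope_eq_false (x := c) (by simp [nfP, br]) (by linarith))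
    (chirotope_eq_true (x := -a) (by simp [nfP, br]) (by linarith))
    (chirotope_eq_false (x := 1) (by simp [nfP, br]) one_pos)
    (chirotope_eq_false (x := c - a) (by simp [nfP, br]) (by linarith))
    (chirotope_eq_true (x := 1 - c) (by simp [nfP, br]) (by linarith))
    (chirotope_eq_false (x := a - 1) (by simp [nfP, br]) (by linarith))
    (chirotope_eq_false (x := 1) (by simp [nfP, br]) one_pos)
  obtain ⟨h1, h2, h3⟩ := chamber_of_chamberSigns ((nf_rep h).comp σ).genPos_left hσ
  obtain ⟨h4, h5⟩ := (nf_rep h).frame σ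
  rcases h3 with ⟨h6, h7⟩ | h3
  · obtain ⟨a', b', c', d', h8, h9⟩ := exists_isHex h4 h1 h2 h6 h7
    exact ⟨a', b', c', d', Or.inl h8, h5.trans _ _ _ h9⟩
  · exact ⟨_, _, _, _, Or.inr h3, h5⟩

/-- Representatives of the four coarse classes. -/
noncomputable def sample : Fin 4 → Fin 6 → PLine :=
  ![nfL 2 8 5 (-5), nfL 2 (-1) 3 4, nfL 2 (-1) 3 2, nfL 2 (1 / 2) 4 3]

theorem isHex_sample : IsHex 2 8 5 (-5) := by constructor <;> norm_num

theorem isBip_sample : IsBip 2 (-1) 3 4 := by constructor <;> norm_num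

theorem isTri_sample : IsTri 2 (-1) 3 2 := by constructor <;> norm_num

theorem isIco_sample : IsIco 2 (1 / 2) 4 3 := by constructor <;> norm_num

theorem SixRep.exists_coarse_sample {L : Fin 6 → PLine} {p q : Fin 6 → Fin 3 → ℝ}
    {T : V4 →ₗ[ℝ] Matrix (Fin 3) (Fin 3) ℝ} (h : SixRep L p q T) :
    ∃ k, SchlafliCoarse L (sample k) := by
  obtain ⟨h1, h2⟩ := h.frame 1
  obtain ⟨_, _, _, _, h3, h4, h5, h6⟩ := exists_one_lt h1
  obtain ⟨_, _, _, _, h7, h8⟩ := exists_chamber h3 h4 h5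
  have h9 := (h2.trans _ _ _ h6).trans _ _ _ h8
  rcases h7 with h7 | h7 | h7 | h7
  · exact ⟨0, h9.trans _ _ _ (.rel _ _ (Or.inl (h7.deformation isHex_sample)))⟩
  · exact ⟨1, h9.trans _ _ _ (.rel _ _ (Or.inl (h7.deformation isBip_sample)))⟩
  · exact ⟨2, h9.trans _ _ _ (.rel _ _ (Or.inl (h7.deformation isTri_sample)))⟩
  · exact ⟨3, h9.trans _ _ _ (.rel _ _ (Or.inl (h7.deformation isIco_sample)))⟩

end Classification

section EigenData

open Matrix

/-- Eigenvalues of the three matrices whose graphs, together with the three coordinate lines,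
form a Schläfli six. -/
structure EigenData {K : Type*} [Field K] (α β γ δ ε ζ : K) : Prop where
  α0 : α ≠ 0
  β0 : β ≠ 0
  γ0 : γ ≠ 0
  δ0 : δ ≠ 0
  ε0 : ε ≠ 0
  ζ0 : ζ ≠ 0
  α1 : α - 1 ≠ 0
  β1 : β - 1 ≠ 0
  γ1 : γ - 1 ≠ 0
  δ1 : δ - 1 ≠ 0
  ε1 : ε - 1 ≠ 0
  ζ1 : ζ - 1 ≠ 0
  αβ : α - β ≠ 0
  γδ : γ - δ ≠ 0
  εζ : ε - ζ ≠ 0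
  αγ : α - γ ≠ 0
  βδ : β - δ ≠ 0
  αζ : α - ζ ≠ 0
  βε : β - ε ≠ 0
  γε : γ - ε ≠ 0
  δζ : δ - ζ ≠ 0
  prod : α * δ * ε = β * γ * ζ
  prod_sub : (α - 1) * (δ - 1) * (ε - 1) = (β - 1) * (γ - 1) * (ζ - 1)

variable {α β γ δ ε ζ : ℝ}

theorem EigenData.nfGen (h : EigenData α β γ δ ε ζ) :
    NFGen (ε / γ) ((ε - 1) / (γ - 1)) (ζ / α) ((ζ - 1) / (α - 1)) := by
  obtain ⟨α0, β0, γ0, δ0, ε0, ζ0, α1, β1, γ1, δ1, ε1, ζ1, αβ, γδ, εζ, αγ, βδ, αζ, βε, γε, δζ, h0,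
    h1⟩ := h
  have e1 : ε / γ - 1 = (ε - γ) / γ := by grind
  have e2 : (ε - 1) / (γ - 1) - 1 = (ε - γ) / (γ - 1) := by grind
  have e3 : ζ / α - 1 = (ζ - α) / α := by grind
  have e4 : (ζ - 1) / (α - 1) - 1 = (ζ - α) / (α - 1) := by grind
  have εγ : ε - γ ≠ 0 := by grind
  have ζα : ζ - α ≠ 0 := by grind
  constructor
  · exact div_ne_zero ε0 γ0
  · exact div_ne_zero ε1 γ1
  · exact div_ne_zero ζ0 α0
  · exact div_ne_zero ζ1 α1
  · exact e1 ▸ div_ne_zero εγ γ0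
  · exact e2 ▸ div_ne_zero εγ γ1
  · exact e3 ▸ div_ne_zero ζα α0
  · exact e4 ▸ div_ne_zero ζα α1
  · grind
  · grind
  · rw [div_sub_div _ _ γ0 α0]
    refine div_ne_zero (fun h => ?_) (mul_ne_zero γ0 α0)
    have : γ * ζ * (β - δ) = 0 := by linear_combination δ * h - h0
    simp_all
  · rw [div_sub_div _ _ γ1 α1]
    refine div_ne_zero (fun h => ?_) (mul_ne_zero γ1 α1)
    have : (γ - 1) * (ζ - 1) * (β - δ) = 0 := by linear_combination (δ - 1) * h - h1
    simp_all
  · rw [div_mul_div_comm, div_mul_div_comm,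
      div_sub_div _ _ (mul_ne_zero γ0 α1) (mul_ne_zero γ1 α0)]
    refine div_ne_zero (fun h => ?_) (mul_ne_zero (mul_ne_zero γ0 α1) (mul_ne_zero γ1 α0))
    have : γ * ζ * (α - 1) * (ε - 1) * (δ - β) = 0 := by
      linear_combination δ * (β - 1) * h - (ζ - 1) * (γ - 1) * (β - 1) * h0 + β * γ * ζ * h1
    have : δ - β ≠ 0 := by grind
    simp_all
  · rw [e1, e2, e3, e4, div_mul_div_comm, div_mul_div_comm,
      div_sub_div _ _ (mul_ne_zero γ0 α1) (mul_ne_zero γ1 α0)]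
    refine div_ne_zero (fun h => ?_) (mul_ne_zero (mul_ne_zero γ0 α1) (mul_ne_zero γ1 α0))
    have : (ε - γ) * (ζ - α) * (α - γ) = 0 := by linear_combination -h
    simp_all
  · have e : (ε - 1) / (γ - 1) * ((ζ - 1) / (α - 1)) * (ε / γ - ζ / α) +
        (ε - 1) / (γ - 1) * (ζ / α) * (1 - ε / γ) + (ζ - 1) / (α - 1) * (ε / γ) * (ζ / α - 1) =
        (ζ - α) * (ε - ζ) * (ε - γ) / (γ * (γ - 1) * (α * (α - 1))) := by
      field_simp
      ring
    rw [e]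
    exact div_ne_zero (mul_ne_zero (mul_ne_zero ζα εζ) εγ)
      (mul_ne_zero (mul_ne_zero γ0 γ1) (mul_ne_zero α0 α1))

/-- The linear map exhibiting the six lines with given eigenvalues as a `SixRep`. -/
noncomputable def eigenT (α β γ δ ε ζ : ℝ) : V4 →ₗ[ℝ] Matrix (Fin 3) (Fin 3) ℝ where
  toFun x := diagonal ![-(δ * (β - 1) * ((γ - 1) * α) / (ζ * (ε - 1) * (β - δ) ^ 2)),
      α * (α - 1) / (α - ζ) ^ 2, -(γ * (γ - 1) / (γ - ε) ^ 2)] *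
    !![0, x 3 - δ * x 1, -(x 3 - β * x 1); -(x 2 - ζ * x 0), 0, x 2 - α * x 0;
      x 2 - x 3 - ε * (x 0 - x 1), -(x 2 - x 3 - γ * (x 0 - x 1)), 0]
  map_add' x y := by
    rw [← mul_add]
    congr 1
    ext i j
    fin_cases i <;> fin_cases j <;> simp <;> ring
  map_smul' r x := by
    rw [RingHom.id_apply, ← Matrix.mul_smul]
    congr 1
    ext i j
    fin_cases i <;> fin_cases j <;> simp <;> ring

theorem EigenData.form (h : EigenData α β γ δ ε ζ) (i : Fin 6) (x : V4) :
    nfQ (ε / γ) ((ε - 1) / (γ - 1)) (ζ / α) ((ζ - 1) / (α - 1)) i ⬝ᵥ eigenT α β γ δ ε ζ x *ᵥ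
      nfP (ε / γ) ((ε - 1) / (γ - 1)) (ζ / α) ((ζ - 1) / (α - 1)) i = 0 := by
  obtain ⟨α0, β0, γ0, δ0, ε0, ζ0, α1, β1, γ1, δ1, ε1, ζ1, αβ, γδ, εζ, αγ, βδ, αζ, βε, γε, δζ, h0,
    h1⟩ := h
  have e1 : ε / γ * ((ζ - 1) / (α - 1)) - (ε - 1) / (γ - 1) * (ζ / α) =
      ζ * (ε - 1) * (δ - β) / (δ * (β - 1) * ((γ - 1) * α)) := by
    rw [div_mul_div_comm, div_mul_div_comm, div_sub_div _ _ (mul_ne_zero γ0 α1)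
      (mul_ne_zero γ1 α0), div_eq_div_iff (by positivity) (by positivity)]
    linear_combination (γ - 1) * α * ((ζ - 1) * (γ - 1) * (β - 1) * h0 - β * γ * ζ * h1)
  have e2 : ζ / α - (ζ - 1) / (α - 1) = (α - ζ) / (α * (α - 1)) := by
    field_simp
    ring
  have e3 : (ε - 1) / (γ - 1) - ε / γ = (ε - γ) / (γ * (γ - 1)) := by
    field_simp
    ring
  have e4 : (ε - 1) / (γ - 1) - (ζ - 1) / (α - 1) = (ζ - 1) * (β - δ) / ((δ - 1) * (α - 1)) := by
    rw [div_sub_div _ _ γ1 α1, div_eq_div_iff (mul_ne_zero γ1 α1) (mul_ne_zero δ1 α1)]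
    linear_combination (α - 1) * h1
  have e5 : ζ / α - ε / γ = ζ * (δ - β) / (δ * α) := by
    rw [div_sub_div _ _ α0 γ0, div_eq_div_iff (mul_ne_zero α0 γ0) (mul_ne_zero δ0 α0)]
    linear_combination -α * h0
  have e6 : (ζ - 1) / (α - 1) - 1 = (ζ - α) / (α - 1) := by
    field_simp
    ring
  have e7 : 1 - (ε - 1) / (γ - 1) = (γ - ε) / (γ - 1) := by
    field_simp
    ring
  have e8 : 1 - ζ / α = (α - ζ) / α := by
    field_simp
  have e9 : ε / γ - 1 = (ε - γ) / γ := by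
    field_simp
  fin_cases i
  · simp [nfQ, nfP, eigenT, dotProduct, mulVec, Fin.sum_univ_three]
  · simp [nfQ, nfP, eigenT, dotProduct, mulVec, Fin.sum_univ_three]
  · simp [nfQ, nfP, eigenT, dotProduct, mulVec, Fin.sum_univ_three]
  · simp [nfQ, nfP, eigenT, dotProduct, mulVec, Fin.sum_univ_three, e1, e2, e3]
    field_simp
    ring
  · simp [nfQ, nfP, eigenT, dotProduct, mulVec, Fin.sum_univ_three, e4, e6, e7]
    field_simp
    linear_combination (ζ - 1) * (β - 1) * (γ - 1) * (δ * x 1 - x 3) * (α - ζ) ^ 2 * (γ - ε) * h0 +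
      ζ * γ * (β - δ) * (α - ζ) ^ 2 * (γ - ε) * x 3 * h1
  · simp [nfQ, nfP, eigenT, dotProduct, mulVec, Fin.sum_univ_three, e5, e8, e9]
    field_simp
    linear_combination (δ - β) * (α - ζ) * (γ - ε) ^ 2 * (β * x 1 - x 3) * h1

/-- The six lines, in the coordinates given by the first two, with given eigenvalues. -/
noncomputable def eigenL (α β γ δ ε ζ : ℝ) (i : Fin 6) : PLine :=
  LinearMap.ker ((Matrix.mulVecBilin ℝ ℝ).flip
    (nfP (ε / γ) ((ε - 1) / (γ - 1)) (ζ / α) ((ζ - 1) / (α - 1)) i) ∘ₗ eigenT α β γ δ ε ζ)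

theorem mem_eigenL_iff (i : Fin 6) (x : V4) : x ∈ eigenL α β γ δ ε ζ i ↔
    eigenT α β γ δ ε ζ x *ᵥ
      nfP (ε / γ) ((ε - 1) / (γ - 1)) (ζ / α) ((ζ - 1) / (α - 1)) i = 0 := by
  simp [eigenL, LinearMap.mem_ker]

theorem EigenData.mulVec_iff (h : EigenData α β γ δ ε ζ) (x : V4) (p : Fin 3 → ℝ) :
    eigenT α β γ δ ε ζ x *ᵥ p = 0 ↔
      !![0, x 3 - δ * x 1, -(x 3 - β * x 1); -(x 2 - ζ * x 0), 0, x 2 - α * x 0;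
      x 2 - x 3 - ε * (x 0 - x 1), -(x 2 - x 3 - γ * (x 0 - x 1)), 0] *ᵥ p = 0 := by
  simp only [eigenT, LinearMap.coe_mk, AddHom.coe_mk, ← mulVec_mulVec]
  constructor
  · intro h0
    refine (mulVec_injective_iff_isUnit.mpr ?_ : Function.Injective _) (h0.trans (mulVec_zero _).symm)
    rw [isUnit_iff_isUnit_det, isUnit_iff_ne_zero, det_diagonal, Fin.prod_univ_three]
    obtain ⟨α0, β0, γ0, δ0, ε0, ζ0, α1, β1, γ1, δ1, ε1, ζ1, αβ, γδ, εζ, αγ, βδ, αζ, βε, γε, δζ, -,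
      -⟩ := h
    simp only [cons_val]
    have t (r : ℝ) (hr : r ≠ 0) := pow_ne_zero 2 hr
    exact mul_ne_zero (mul_ne_zero (neg_ne_zero.mpr (div_ne_zero (mul_ne_zero (mul_ne_zero δ0 β1)
      (mul_ne_zero γ1 α0)) (mul_ne_zero (mul_ne_zero ζ0 ε1) (t _ βδ))))
      (div_ne_zero (mul_ne_zero α0 α1) (t _ αζ)))
      (neg_ne_zero.mpr (div_ne_zero (mul_ne_zero γ0 γ1) (t _ γε)))
  · intro h0
    rw [h0, mulVec_zero]

theorem EigenData.mem_zero (h : EigenData α β γ δ ε ζ) (x : V4) :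
    x ∈ eigenL α β γ δ ε ζ 0 ↔ x 2 = ζ * x 0 ∧ x 3 = (ζ - ε) * x 0 + ε * x 1 := by
  rw [mem_eigenL_iff, h.mulVec_iff]
  simp [nfP, funext_iff, Fin.forall_fin_succ]
  grind

theorem EigenData.mem_one (h : EigenData α β γ δ ε ζ) (x : V4) :
    x ∈ eigenL α β γ δ ε ζ 1 ↔ x 2 = γ * x 0 + (δ - γ) * x 1 ∧ x 3 = δ * x 1 := by
  rw [mem_eigenL_iff, h.mulVec_iff]
  simp [nfP, funext_iff, Fin.forall_fin_succ]
  grind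

theorem EigenData.mem_two (h : EigenData α β γ δ ε ζ) (x : V4) :
    x ∈ eigenL α β γ δ ε ζ 2 ↔ x 2 = α * x 0 ∧ x 3 = β * x 1 := by
  rw [mem_eigenL_iff, h.mulVec_iff]
  simp [nfP, funext_iff, Fin.forall_fin_succ]
  grind

theorem EigenData.mem_three (h : EigenData α β γ δ ε ζ) (x : V4) :
    x ∈ eigenL α β γ δ ε ζ 3 ↔ x 0 = 0 ∧ x 1 = 0 := by
  rw [mem_eigenL_iff, h.mulVec_iff]
  obtain ⟨α0, β0, γ0, δ0, ε0, ζ0, α1, β1, γ1, δ1, ε1, ζ1, αβ, γδ, εζ, αγ, βδ, αζ, βε, γε, δζ, h0,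
    h1⟩ := h
  have key : !![0, x 3 - δ * x 1, -(x 3 - β * x 1); -(x 2 - ζ * x 0), 0, x 2 - α * x 0;
      x 2 - x 3 - ε * (x 0 - x 1), -(x 2 - x 3 - γ * (x 0 - x 1)), 0] *ᵥ
      nfP (ε / γ) ((ε - 1) / (γ - 1)) (ζ / α) ((ζ - 1) / (α - 1)) 3 =
      ![(β - δ) * x 1, -((α - ζ) * x 0),
        (γ - ε) * (x 0 - x 1)] := by
    ext j
    fin_cases j
    · simp [nfP, mulVec, dotProduct, Fin.sum_univ_three]
      ring
    · simp [nfP, mulVec, dotProduct, Fin.sum_univ_three]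
      ring
    · simp [nfP, mulVec, dotProduct, Fin.sum_univ_three]
      ring
  rw [key]
  constructor
  · intro h2
    have f0 := congrFun h2 0
    have f1 := congrFun h2 1
    simp [βδ, αζ] at f0 f1
    grind
  · intro h2
    ext j
    fin_cases j <;> simp <;> grind

theorem EigenData.mem_four (h : EigenData α β γ δ ε ζ) (x : V4) :
    x ∈ eigenL α β γ δ ε ζ 4 ↔ x 2 = 0 ∧ x 3 = 0 := by
  rw [mem_eigenL_iff, h.mulVec_iff]
  obtain ⟨α0, β0, γ0, δ0, ε0, ζ0, α1, β1, γ1, δ1, ε1, ζ1, αβ, γδ, εζ, αγ, βδ, αζ, βε, γε, δζ, h0,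
    h1⟩ := h
  have key : !![0, x 3 - δ * x 1, -(x 3 - β * x 1); -(x 2 - ζ * x 0), 0, x 2 - α * x 0;
      x 2 - x 3 - ε * (x 0 - x 1), -(x 2 - x 3 - γ * (x 0 - x 1)), 0] *ᵥ
      nfP (ε / γ) ((ε - 1) / (γ - 1)) (ζ / α) ((ζ - 1) / (α - 1)) 4 =
      ![ζ * (β - δ) / (δ * α) * x 3, -((α - ζ) / α * x 2),
        (γ - ε) / γ * (x 2 - x 3)] := by
    ext j
    fin_cases j
    · simp [nfP, mulVec, dotProduct, Fin.sum_univ_three]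
      field_simp
      linear_combination (x 3 - δ * x 1) * h0
    · simp [nfP, mulVec, dotProduct, Fin.sum_univ_three]
      field_simp
      ring
    · simp [nfP, mulVec, dotProduct, Fin.sum_univ_three]
      field_simp
      ring
  rw [key]
  constructor
  · intro h2
    have f0 := congrFun h2 0
    have f1 := congrFun h2 1
    simp [α0, δ0, ζ0, βδ, αζ] at f0 f1
    grind
  · intro h2
    ext j
    fin_cases j <;> simp <;> grind

theorem EigenData.mem_five (h : EigenData α β γ δ ε ζ) (x : V4) :
    x ∈ eigenL α β γ δ ε ζ 5 ↔ x 2 = x 0 ∧ x 3 = x 1 := by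
  rw [mem_eigenL_iff, h.mulVec_iff]
  obtain ⟨α0, β0, γ0, δ0, ε0, ζ0, α1, β1, γ1, δ1, ε1, ζ1, αβ, γδ, εζ, αγ, βδ, αζ, βε, γε, δζ, h0,
    h1⟩ := h
  have key : !![0, x 3 - δ * x 1, -(x 3 - β * x 1); -(x 2 - ζ * x 0), 0, x 2 - α * x 0;
      x 2 - x 3 - ε * (x 0 - x 1), -(x 2 - x 3 - γ * (x 0 - x 1)), 0] *ᵥ
      nfP (ε / γ) ((ε - 1) / (γ - 1)) (ζ / α) ((ζ - 1) / (α - 1)) 5 =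
      ![(ζ - 1) * (β - δ) / ((δ - 1) * (α - 1)) * (x 3 - x 1), -((α - ζ) / (α - 1) * (x 2 - x 0)),
        (γ - ε) / (γ - 1) * (x 2 - x 3 - (x 0 - x 1))] := by
    ext j
    fin_cases j
    · simp [nfP, mulVec, dotProduct, Fin.sum_univ_three]
      field_simp
      linear_combination (x 3 - δ * x 1) * h1
    · simp [nfP, mulVec, dotProduct, Fin.sum_univ_three]
      field_simp
      ring
    · simp [nfP, mulVec, dotProduct, Fin.sum_univ_three]
      field_simp
      ring
  rw [key]
  constructor
  · intro h2
    have f0 := congrFun h2 0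
    have f1 := congrFun h2 1
    simp [δ1, ζ1, α1, βδ, αζ] at f0 f1
    grind
  · intro h2
    ext j
    fin_cases j <;> simp <;> grind

theorem EigenData.sixRep (h : EigenData α β γ δ ε ζ) :
    SixRep (eigenL α β γ δ ε ζ) (nfP (ε / γ) ((ε - 1) / (γ - 1)) (ζ / α) ((ζ - 1) / (α - 1)))
      (nfQ (ε / γ) ((ε - 1) / (γ - 1)) (ζ / α) ((ζ - 1) / (α - 1))) (eigenT α β γ δ ε ζ) where
  genPos_left := nfP_genPos h.nfGen
  genPos_right := nfQ_genPos h.nfGen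
  rel := nf_rel ..
  inj := inj h
  form := h.form
  mem := mem_eigenL_iff
  cross i x hp hq := by
    by_contra hx
    exact kernel_absurd (nfP_genPos h.nfGen) (nfQ_genPos h.nfGen) (nf_rel ..)
      (nf_nonconic h.nfGen) (fun h0 => hx (inj h x h0)) (fun i => h.form i x) hp hq
where
  inj (h : EigenData α β γ δ ε ζ) (x : V4) (hx : eigenT α β γ δ ε ζ x = 0) : x = 0 := by
    have h3 := (h.mem_three x).mp (by rw [mem_eigenL_iff, hx, zero_mulVec])
    have h4 := (h.mem_four x).mp (by rw [mem_eigenL_iff, hx, zero_mulVec])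
    ext i
    fin_cases i
    · exact h3.1
    · exact h3.2
    · exact h4.1
    · exact h4.2

end EigenData

section Polar

open MvPolynomial

/-- The trilinear form with given coefficients. -/
def triForm {K : Type*} [Field K] {n : ℕ} (c : Fin n → Fin n → Fin n → K) :
    (Fin n → K) →ₗ[K] (Fin n → K) →ₗ[K] (Fin n → K) →ₗ[K] K :=
  ∑ i, ∑ j, ∑ k, (LinearMap.proj (R := K) (φ := fun _ : Fin n => K) i).smulRight
    ((LinearMap.proj (R := K) (φ := fun _ : Fin n => K) j).smulRight
      (c i j k • LinearMap.proj (R := K) (φ := fun _ : Fin n => K) k))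

theorem triForm_apply {K : Type*} [Field K] {n : ℕ} (c : Fin n → Fin n → Fin n → K)
    (x y z : Fin n → K) : triForm c x y z = ∑ i, ∑ j, ∑ k, c i j k * x i * y j * z k := by
  simp only [triForm, LinearMap.sum_apply, LinearMap.smulRight_apply, LinearMap.smul_apply,
    LinearMap.proj_apply, smul_eq_mul]
  refine Finset.sum_congr rfl fun i _ => Finset.sum_congr rfl fun j _ =>
    Finset.sum_congr rfl fun k _ => ?_
  ring

theorem triForm_swap_left {K : Type*} [Field K] {n : ℕ} {c : Fin n → Fin n → Fin n → K}
    (hc : ∀ i j k, c i j k = c j i k) (x y z : Fin n → K) : triForm c x y z = triForm c y x z := by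
  rw [triForm_apply, triForm_apply, Finset.sum_comm]
  refine Finset.sum_congr rfl fun i _ => Finset.sum_congr rfl fun j _ =>
    Finset.sum_congr rfl fun k _ => ?_
  rw [hc]
  ring

theorem triForm_swap_right {K : Type*} [Field K] {n : ℕ} {c : Fin n → Fin n → Fin n → K}
    (hc : ∀ i j k, c i j k = c i k j) (x y z : Fin n → K) : triForm c x y z = triForm c x z y := by
  rw [triForm_apply, triForm_apply]
  refine Finset.sum_congr rfl fun i _ => ?_
  rw [Finset.sum_comm]
  refine Finset.sum_congr rfl fun j _ => Finset.sum_congr rfl fun k _ => ?_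
  rw [hc]
  ring

theorem pderiv_pderiv_comm {K : Type*} [Field K] {n : ℕ} (i j : Fin n)
    (p : MvPolynomial (Fin n) K) : pderiv i (pderiv j p) = pderiv j (pderiv i p) := by
  ext m
  simp only [coeff_pderiv, Finsupp.add_apply, add_right_comm m]
  by_cases h : i = j
  · rw [h]
  · simp [h, Ne.symm h]
    ring

theorem eval_eq_coeff_zero {K : Type*} [Field K] {n : ℕ} {p : MvPolynomial (Fin n) K}
    (hp : p.IsHomogeneous 0) (z : Fin n → K) : eval z p = coeff 0 p := by
  have h := totalDegree_eq_zero_iff_eq_C.mp (Nat.le_zero.mp hp.totalDegree_le)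
  conv_lhs => rw [h]
  exact eval_C _

theorem euler_eval {K : Type*} [Field K] {n d : ℕ} {p : MvPolynomial (Fin n) K}
    (hp : p.IsHomogeneous d) (z : Fin n → K) : ∑ i, z i * eval z (pderiv i p) = d * eval z p := by
  have := congrArg (eval z) hp.sum_X_mul_pderiv
  simpa using this

/-- The coefficients of the polarisation of a cubic form. -/
noncomputable def polarCoeff {K : Type*} [Field K] {n : ℕ} (p : MvPolynomial (Fin n) K)
    (i j k : Fin n) : K :=
  coeff 0 (pderiv i (pderiv j (pderiv k p)))

theorem polarCoeff_swap_left {K : Type*} [Field K] {n : ℕ} (p : MvPolynomial (Fin n) K)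
    (i j k : Fin n) : polarCoeff p i j k = polarCoeff p j i k := by
  rw [polarCoeff, pderiv_pderiv_comm, polarCoeff]

theorem polarCoeff_swap_right {K : Type*} [Field K] {n : ℕ} (p : MvPolynomial (Fin n) K)
    (i j k : Fin n) : polarCoeff p i j k = polarCoeff p i k j := by
  rw [polarCoeff, pderiv_pderiv_comm j k, polarCoeff]

theorem two_mul_eval_pderiv {K : Type*} [Field K] {n : ℕ} {p : MvPolynomial (Fin n) K}
    (hp : p.IsHomogeneous 3) (k : Fin n) (z : Fin n → K) :
    2 * eval z (pderiv k p) = triForm (polarCoeff p) z z (Pi.single k 1) := by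
  have h1 := euler_eval (hp.pderiv (i := k)) z
  push_cast at h1
  rw [← h1, triForm_apply, Finset.sum_comm]
  refine Finset.sum_congr rfl fun j _ => ?_
  have h2 := euler_eval ((hp.pderiv (i := k)).pderiv (i := j)) z
  norm_num at h2
  rw [← h2, Finset.mul_sum]
  refine Finset.sum_congr rfl fun i _ => ?_
  rw [eval_eq_coeff_zero (((hp.pderiv (i := k)).pderiv (i := j)).pderiv (i := i)),
    Finset.sum_eq_single k (fun l _ hl => by simp [hl]) (by simp), polarCoeff, Pi.single_eq_same]
  ring

theorem six_mul_eval {K : Type*} [Field K] {n : ℕ} {p : MvPolynomial (Fin n) K}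
    (hp : p.IsHomogeneous 3) (z : Fin n → K) :
    6 * eval z p = triForm (polarCoeff p) z z z := by
  have h1 := euler_eval hp z
  have h2 : z = ∑ k, z k • Pi.single k (1 : K) := by
    ext l
    simp [Finset.sum_apply, Pi.single_apply]
  calc 6 * eval z p = 2 * ((3 : ℕ) * eval z p) := by push_cast; ring
    _ = triForm (polarCoeff p) z z (∑ k, z k • Pi.single k (1 : K)) := by
      rw [← h1, Finset.mul_sum, map_sum]
      refine Finset.sum_congr rfl fun k _ => ?_
      rw [mul_left_comm, two_mul_eval_pderiv hp, map_smul, smul_eq_mul]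
    _ = _ := by rw [← h2]

theorem triForm_ofReal {n : ℕ} (c : Fin n → Fin n → Fin n → ℝ) (x y z : Fin n → ℝ) :
    triForm (fun i j k => (c i j k : ℂ)) (fun i => (x i : ℂ)) (fun i => (y i : ℂ))
      (fun i => (z i : ℂ)) = (triForm c x y z : ℝ) := by
  simp only [triForm_apply]
  push_cast
  rfl

theorem ofReal_add_smul_eq_zero {n : ℕ} {a b : Fin n → ℝ}
    (h : (fun i => (a i : ℂ)) + Complex.I • (fun i => (b i : ℂ)) = 0) : a = 0 ∧ b = 0 := by
  constructor <;> ext i <;> have := congrFun h i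
  · simpa using congrArg Complex.re this
  · simpa using congrArg Complex.im this

/-- A symmetric trilinear form whose associated cubic hypersurface is nonsingular over the complex
numbers. -/
structure SmoothCubic {W : Type*} [AddCommGroup W] [Module ℝ W]
    (Φ : W →ₗ[ℝ] W →ₗ[ℝ] W →ₗ[ℝ] ℝ) : Prop where
  swap_left : ∀ x y z, Φ x y z = Φ y x z
  swap_right : ∀ x y z, Φ x y z = Φ x z y
  smooth : ∀ a b, (a ≠ 0 ∨ b ≠ 0) → ∃ y, Φ a a y ≠ Φ b b y ∨ Φ a b y ≠ 0

theorem IsSchlafliSix.exists_smoothCubic {L : Fin 6 → PLine} (h : IsSchlafliSix L) :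
    ∃ Φ : V4 →ₗ[ℝ] V4 →ₗ[ℝ] V4 →ₗ[ℝ] ℝ, SmoothCubic Φ ∧ ∀ i, ∀ x ∈ L i, Φ x x x = 0 := by
  obtain ⟨-, F, -, hF, hL, hs⟩ := h
  have hl := triForm_swap_left (polarCoeff_swap_left F)
  have hr := triForm_swap_right (polarCoeff_swap_right F)
  refine ⟨triForm (polarCoeff F), ⟨hl, hr, fun a b hab => ?_⟩, fun i x hx => ?_⟩
  · set G := MvPolynomial.map (algebraMap ℝ ℂ) F with hG
    have hGh : G.IsHomogeneous 3 := hF.map _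
    have hc : polarCoeff G = fun i j k => ((polarCoeff F i j k : ℝ) : ℂ) := by
      funext i j k
      simp only [polarCoeff, hG, pderiv_map, coeff_map]
      rfl
    set z : Fin 4 → ℂ := (fun i => (a i : ℂ)) + Complex.I • (fun i => (b i : ℂ)) with hzd
    have hz : z ≠ 0 := fun h0 => by
      have := ofReal_add_smul_eq_zero h0
      tauto
    have hd : ∃ j, eval z (pderiv j G) ≠ 0 := by
      by_cases h0 : eval z G = 0
      · obtain ⟨j, hj⟩ := hs z hz h0
        exact ⟨j, by rwa [hG, pderiv_map]⟩
      · by_contra! h1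
        have := euler_eval hGh z
        simp [h1, h0] at this
    obtain ⟨j, hj⟩ := hd
    refine ⟨Pi.single j 1, ?_⟩
    by_contra! h1
    apply hj
    have h2 := two_mul_eval_pderiv hGh j z
    have he : (Pi.single j 1 : Fin 4 → ℂ) = fun i => ((Pi.single j 1 : V4) i : ℂ) := by
      ext i
      by_cases h : i = j
      · subst h; simp
      · simp [h]
    rw [he, hc, hzd] at h2
    simp only [map_add, map_smul, LinearMap.add_apply, LinearMap.smul_apply, triForm_ofReal,
      hl b a, h1.1, h1.2, smul_eq_mul] at h2
    have h3 : (2 : ℂ) * eval z (pderiv j G) = 0 := by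
      rw [h2, Complex.ofReal_zero]
      linear_combination (Complex.ofReal (triForm (polarCoeff F) b b (Pi.single j 1))) * Complex.I_sq
    simpa using h3
  · rw [← six_mul_eval hF, hL i x hx, mul_zero]

end Polar

section GraphLines

/-- The plane area of two vectors. -/
def wedge {K : Type*} [Field K] (u v : Fin 2 → K) : K := u 0 * v 1 - u 1 * v 0

section Wedge

variable {K : Type*} [Field K] {u v : Fin 2 → K}

theorem eq_smul_add_smul (h : wedge u v ≠ 0) (x : Fin 2 → K) :
    x = (wedge x v / wedge u v) • u + (wedge u x / wedge u v) • v := by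
  ext i
  rw [Pi.add_apply, Pi.smul_apply, Pi.smul_apply, smul_eq_mul, smul_eq_mul, div_mul_eq_mul_div,
    div_mul_eq_mul_div, ← add_div, eq_div_iff h]
  fin_cases i <;> simp only [wedge, Fin.zero_eta, Fin.mk_one] <;> ring

theorem wedge_smul_add (u v : Fin 2 → K) (s t p q : K) :
    wedge (s • u + t • v) (p • u + q • v) = (s * q - t * p) * wedge u v := by
  simp [wedge]
  ring

theorem exists_wedge_ne_zero (h : u ≠ 0) : ∃ v, wedge u v ≠ 0 := by
  by_contra! h'
  apply h
  ext i
  have h0 := h' ![0, 1]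
  have h1 := h' ![1, 0]
  simp [wedge] at h0 h1
  fin_cases i <;> simp [h0, h1]

theorem ne_zero_of_wedge (h : wedge u v ≠ 0) : u ≠ 0 := by
  rintro rfl
  simp [wedge] at h

theorem wedge_swap (u v : Fin 2 → K) : wedge v u = -wedge u v := by
  simp [wedge]
  ring

theorem eq_zero_of_smul_add_smul (h : wedge u v ≠ 0) {s t : K} (hst : s • u + t • v = 0) :
    s = 0 ∧ t = 0 := by
  have h1 := wedge_smul_add u v s t 0 1
  have h2 := wedge_smul_add u v 1 0 s t
  rw [hst] at h1 h2
  simp [wedge] at h1 h2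
  simp [wedge] at h
  tauto

theorem exists_eq_smul_of_wedge (hu : u ≠ 0) (h : wedge u v = 0) : ∃ c : K, v = c • u := by
  obtain ⟨w, hw⟩ := exists_wedge_ne_zero hu
  have hv := eq_smul_add_smul hw v
  rw [h, zero_div, zero_smul, add_zero] at hv
  exact ⟨_, hv⟩

end Wedge

/-- The two mixed parts of a cubic form on `V × V` vanishing on both factors, whose cubic hypersurface
is nonsingular and contains the diagonal. -/
structure MixedCubic {K : Type*} [Field K]
    (α β : (Fin 2 → K) →ₗ[K] (Fin 2 → K) →ₗ[K] (Fin 2 → K) →ₗ[K] K) : Prop where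
  swap_left : ∀ x y z, α x y z = α y x z
  swap_right : ∀ x y z, β x y z = β x z y
  smooth : ∀ x y, (x ≠ 0 ∨ y ≠ 0) →
    (∃ z, 2 * α x z y + β z y y ≠ 0) ∨ ∃ z, α x x z + 2 * β x y z ≠ 0
  diag : ∀ x, α x x x + β x x x = 0

/-- The graph of the endomorphism lies on the cubic and avoids both factors and the diagonal. -/
structure GraphLine {K : Type*} [Field K]
    (α β : (Fin 2 → K) →ₗ[K] (Fin 2 → K) →ₗ[K] (Fin 2 → K) →ₗ[K] K)
    (M : (Fin 2 → K) →ₗ[K] (Fin 2 → K)) : Prop where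
  mem : ∀ x, α x x (M x) + β x (M x) (M x) = 0
  inj : ∀ x, M x = 0 → x = 0
  inj_one : ∀ x, M x = x → x = 0

variable {K : Type*} [Field K]
  {α β : (Fin 2 → K) →ₗ[K] (Fin 2 → K) →ₗ[K] (Fin 2 → K) →ₗ[K] K}
  {M : (Fin 2 → K) →ₗ[K] (Fin 2 → K)} {u v : Fin 2 → K}

theorem GraphLine.eigenvalue_ne_zero (hM : GraphLine α β M) {x : Fin 2 → K} (hx : x ≠ 0) {c : K}
    (h : M x = c • x) : c ≠ 0 := by
  rintro rfl
  exact hx (hM.inj x (by rw [h, zero_smul]))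

theorem GraphLine.eigenvalue_sub_one_ne_zero (hM : GraphLine α β M) {x : Fin 2 → K} (hx : x ≠ 0)
    {c : K} (h : M x = c • x) : c - 1 ≠ 0 := by
  intro hc
  rw [sub_eq_zero.mp hc, one_smul] at h
  exact hx (hM.inj_one x h)

theorem GraphLine.cubic_eq_zero (hM : GraphLine α β M) (hαβ : MixedCubic α β) (hu : u ≠ 0) {c : K}
    (h : M u = c • u) : α u u u = 0 ∧ β u u u = 0 := by
  have h0 := hM.eigenvalue_ne_zero hu h
  have h1 := hM.eigenvalue_sub_one_ne_zero hu h
  have h2 := hM.mem u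
  have h3 := hαβ.diag u
  simp only [h, map_smul, LinearMap.smul_apply, smul_eq_mul] at h2
  constructor <;> grind

variable [CharZero K]

theorem MixedCubic.polar (hαβ : MixedCubic α β) (hM : ∀ x, α x x (M x) + β x (M x) (M x) = 0)
    (u v : Fin 2 → K) :
    α u u (M v) + 2 * α u v (M u) + β v (M u) (M u) + 2 * β u (M u) (M v) = 0 := by
  have h1 := hM (u + v)
  have h2 := hM (u - v)
  have h3 := hM v
  simp only [map_add, map_sub, LinearMap.add_apply, LinearMap.sub_apply, hαβ.swap_left v u,
    hαβ.swap_right _ (M v) (M u)] at h1 h2 h3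
  have h4 : (2 : K) ≠ 0 := two_ne_zero
  grind

theorem MixedCubic.ne_zero_of_cubic_eq_zero (hαβ : MixedCubic α β) (huv : wedge u v ≠ 0)
    (h : α u u u = 0) : α u u v + 2 * α u v u ≠ 0 := by
  intro h0
  have hβ : β u u u = 0 := by simpa [h] using hαβ.diag u
  have h1 := hαβ.polar (M := LinearMap.id) hαβ.diag u v
  simp only [LinearMap.id_apply] at h1
  have hz := eq_smul_add_smul huv
  have hu := ne_zero_of_wedge huv
  by_cases hAB : α u v u = 0 ∧ β v u u = 0
  · rcases hαβ.smooth u 0 (Or.inl hu) with ⟨z, hz'⟩ | ⟨z, hz'⟩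
    · simp at hz'
    · rw [hz z] at hz'
      simp only [map_add, map_smul, smul_eq_mul, map_zero, LinearMap.zero_apply] at hz'
      grind
  · rcases hαβ.smooth (β v u u • u) ((-2 * α u v u) • u) (by
      by_contra! h2
      have h3 : (2 : K) ≠ 0 := two_ne_zero
      have := smul_eq_zero.mp h2.1
      have := smul_eq_zero.mp h2.2
      grind) with ⟨z, hz'⟩ | ⟨z, hz'⟩
    all_goals
      rw [hz z] at hz'
      simp only [map_add, map_smul, smul_eq_mul, LinearMap.add_apply, LinearMap.smul_apply] at hz'
      grind

theorem GraphLine.eigenvalue_ne (hM : GraphLine α β M) (hαβ : MixedCubic α β)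
    (huv : wedge u v ≠ 0) {c d m : K} (hu : M u = c • u) (hv : M v = d • v + m • u) : c ≠ d := by
  rintro rfl
  have hu0 := ne_zero_of_wedge huv
  have h0 := hM.eigenvalue_ne_zero hu0 hu
  have h1 := hM.eigenvalue_sub_one_ne_zero hu0 hu
  obtain ⟨h2, h3⟩ := hM.cubic_eq_zero hαβ hu0 hu
  have h4 := hαβ.ne_zero_of_cubic_eq_zero huv h2
  have h5 := hαβ.polar hM.mem u v
  have h6 := hαβ.polar (M := LinearMap.id) hαβ.diag u v
  simp only [LinearMap.id_apply] at h6
  simp only [hu, hv, map_add, map_smul, smul_eq_mul, LinearMap.smul_apply] at h5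
  have h7 : c * (c - 1) * (α u u v + 2 * α u v u) = 0 := by
    linear_combination -h5 + c * c * h6 + m * h2 + 2 * c * m * h3
  simp_all

end GraphLines

section GraphFrame

variable {K : Type*} [Field K] [CharZero K]
  {α β : (Fin 2 → K) →ₗ[K] (Fin 2 → K) →ₗ[K] (Fin 2 → K) →ₗ[K] K}
  {M : (Fin 2 → K) →ₗ[K] (Fin 2 → K)} {u v : Fin 2 → K}

theorem GraphLine.coefficient_relations (hM : ∀ x, α x x (M x) + β x (M x) (M x) = 0)
    (hαβ : MixedCubic α β) (hu : α u u u = 0) (hv : α v v v = 0) {l m k : K}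
    (hMu : M u = l • u) (hMv : M v = m • v + k • u) :
    α u u v * m + 2 * α u v u * l + 2 * β u u v * l * m + β v u u * l ^ 2 = 0 ∧
    k * (2 * α u v u + 2 * β u u v * m + 2 * β v u u * l) + 2 * α u v v * m + α v v u * l +
      2 * β v u v * l * m + β u v v * m ^ 2 = 0 ∧
    k * (α v v u + 2 * β v u v * m + β v u u * k) = 0 := by
  have h1 := hαβ.polar hM u v
  have h2 := hαβ.polar hM v u
  have h3 := hM v
  have hu' : β u u u = 0 := by simpa [hu] using hαβ.diag u
  have hv' : β v v v = 0 := by simpa [hv] using hαβ.diag v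
  simp only [hMu, hMv, map_add, map_smul, LinearMap.add_apply, LinearMap.smul_apply, smul_eq_mul,
    hαβ.swap_left v u, hαβ.swap_right _ v u, hu, hu', hv, hv'] at h1 h2 h3
  refine ⟨?_, ?_, ?_⟩
  · linear_combination h1
  · linear_combination h2
  · linear_combination h3

theorem GraphLine.exists_eigenvectors [IsAlgClosed K] (hM : GraphLine α β M)
    (hαβ : MixedCubic α β) :
    ∃ u v : Fin 2 → K, wedge u v ≠ 0 ∧ (∃ c : K, M u = c • u) ∧ ∃ c : K, M v = c • v := by
  obtain ⟨c, hc⟩ := Module.End.exists_eigenvalue (K := K) M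
  obtain ⟨u, hu⟩ := hc.exists_hasEigenvector
  obtain ⟨v, huv⟩ := exists_wedge_ne_zero hu.2
  have hMu : M u = c • u := hu.apply_eq_smul
  have hMv := eq_smul_add_smul huv (M v)
  set d := wedge u (M v) / wedge u v
  set m := wedge (M v) v / wedge u v
  rw [add_comm] at hMv
  have hcd := hM.eigenvalue_ne hαβ huv hMu hMv
  refine ⟨u, v + (m / (d - c)) • u, ?_, ⟨c, hMu⟩, d, ?_⟩
  · have := wedge_smul_add u v 1 0 (m / (d - c)) 1
    rw [one_smul, zero_smul, add_zero, one_smul, add_comm] at this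
    rw [this]
    simpa using huv
  · rw [map_add, map_smul, hMu, hMv]
    have h1 : d - c ≠ 0 := sub_ne_zero.mpr hcd.symm
    ext i
    simp only [Pi.add_apply, Pi.smul_apply, smul_eq_mul]
    field_simp
    ring

theorem MixedCubic.exists_roots (hαβ : MixedCubic α β) (huv : wedge u v ≠ 0) (hu : α u u u = 0)
    (hv : α v v v = 0) :
    ∃ r : Fin 3 → Fin 2 → K, (∀ i j, i ≠ j → wedge (r i) (r j) ≠ 0) ∧ r 0 + r 1 + r 2 = 0 ∧
      ∀ x, α x x x = 0 → ∃ i, ∃ c : K, x = c • r i := by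
  have hp := hαβ.ne_zero_of_cubic_eq_zero huv hu
  have hq := hαβ.ne_zero_of_cubic_eq_zero (u := v) (v := u)
    (by rw [wedge_swap]; exact neg_ne_zero.mpr huv) hv
  set p := α u u v + 2 * α u v u with hp'
  set q := α v v u + 2 * α v u v with hq'
  have hpq : p * q * wedge u v ≠ 0 := mul_ne_zero (mul_ne_zero hp hq) huv
  have hw : ∀ a b c d : K, wedge (a • u + b • v) (c • u + d • v) = (a * d - b * c) * wedge u v :=
    wedge_smul_add u v
  refine ⟨![q • u + (0 : K) • v, (0 : K) • u + (-p) • v, (-q) • u + p • v], ?_, ?_, fun x hx => ?_⟩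
  · intro i j hij
    fin_cases i <;> fin_cases j <;> simp only [Fin.zero_eta, Fin.mk_one, Fin.reduceFinMk,
      Matrix.cons_val, hw, ne_eq, not_true] at hij ⊢ <;> intro h0 <;> apply hpq
    all_goals first | linear_combination h0 | linear_combination -h0
  · simp only [Matrix.cons_val]
    module
  · have hxe := eq_smul_add_smul huv x
    set s := wedge x v / wedge u v
    set t := wedge u x / wedge u v
    have h1 : s * t * (s * p + t * q) = 0 := by
      rw [hxe] at hx
      simp only [map_add, map_smul, LinearMap.add_apply, LinearMap.smul_apply, smul_eq_mul, hu,
        hv] at hx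
      rw [hp', hq']
      linear_combination hx - s ^ 2 * t * hαβ.swap_left v u u + s * t ^ 2 * hαβ.swap_left v u v
    rcases mul_eq_zero.mp h1 with h2 | h2
    · rcases mul_eq_zero.mp h2 with h3 | h3
      · refine ⟨1, -t / p, ?_⟩
        rw [hxe, h3]
        ext i
        simp only [Matrix.cons_val, Pi.add_apply, Pi.smul_apply, smul_eq_mul]
        field_simp
        ring
      · refine ⟨0, s / q, ?_⟩
        rw [hxe, h3]
        ext i
        simp only [Matrix.cons_val, Pi.add_apply, Pi.smul_apply, smul_eq_mul]
        field_simp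
        ring
    · refine ⟨2, t / p, ?_⟩
      rw [hxe]
      have h3 : s = - (t * q) / p := by
        field_simp
        linear_combination h2
      ext i
      rw [h3]
      simp only [Matrix.cons_val, Pi.add_apply, Pi.smul_apply, smul_eq_mul]
      field_simp

theorem GraphLine.exists_diagonal [IsAlgClosed K] (hM : GraphLine α β M) (hαβ : MixedCubic α β)
    {r : Fin 3 → Fin 2 → K} (hr : ∀ x, α x x x = 0 → ∃ i, ∃ c : K, x = c • r i) :
    ∃ k, ∀ j, j ≠ k → ∃ c : K, M (r j) = c • r j := by
  obtain ⟨u, v, huv, ⟨c, hc⟩, d, hd⟩ := hM.exists_eigenvectors hαβ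
  have hu := ne_zero_of_wedge huv
  have hv := ne_zero_of_wedge (u := v) (v := u) (by rw [wedge_swap]; exact neg_ne_zero.mpr huv)
  obtain ⟨i, a, ha⟩ := hr u (hM.cubic_eq_zero hαβ hu hc).1
  obtain ⟨j, b, hb⟩ := hr v (hM.cubic_eq_zero hαβ hv hd).1
  have ha0 : a ≠ 0 := by
    rintro rfl
    simp [ha] at hu
  have hb0 : b ≠ 0 := by
    rintro rfl
    simp [hb] at hv
  have hij : i ≠ j := by
    rintro rfl
    apply huv
    rw [ha, hb]
    simp [wedge]
    ring
  have hi : ∃ c : K, M (r i) = c • r i := by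
    refine ⟨c, smul_right_injective _ ha0 ?_⟩
    simp only [← map_smul, ← ha, hc, smul_comm a c]
  have hj : ∃ c : K, M (r j) = c • r j := by
    refine ⟨d, smul_right_injective _ hb0 ?_⟩
    simp only [← map_smul, ← hb, hd, smul_comm b d]
  have key : ∀ i j : Fin 3, i ≠ j → ∃ k, ∀ l, l ≠ k → l = i ∨ l = j := by decide
  obtain ⟨k, hk⟩ := key i j hij
  refine ⟨k, fun l hl => ?_⟩
  rcases hk l hl with rfl | rfl <;> assumption

end GraphFrame

section GraphTriple

theorem cubic_eq_zero_of_four_roots {K : Type*} [Field K] {c₀ c₁ c₂ c₃ x y z w : K}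
    (hxy : x ≠ y) (hxz : x ≠ z) (hxw : x ≠ w) (hyz : y ≠ z) (hyw : y ≠ w) (hzw : z ≠ w)
    (hx : c₀ + c₁ * x + c₂ * x ^ 2 + c₃ * x ^ 3 = 0) (hy : c₀ + c₁ * y + c₂ * y ^ 2 + c₃ * y ^ 3 = 0)
    (hz : c₀ + c₁ * z + c₂ * z ^ 2 + c₃ * z ^ 3 = 0) (hw : c₀ + c₁ * w + c₂ * w ^ 2 + c₃ * w ^ 3 = 0)
    (t : K) : c₀ + c₁ * t + c₂ * t ^ 2 + c₃ * t ^ 3 = 0 := by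
  have h3 : c₃ = 0 := by grind
  have h2 : c₂ = 0 := by grind
  have h1 : c₁ = 0 := by grind
  grind

theorem resultant_eq_zero_of_relations {K : Type*} [Field K] {a₀₁ a₁₀ a₁₁ a₂₀ b₀₁ b₀₂ b₁₀ b₁₁ l m k : K}
    (hl : l ≠ 0) (hm : m ≠ 0) (h1 : a₀₁ * m + a₁₀ * l + b₀₁ * l * m + b₁₀ * l ^ 2 = 0)
    (h2 : k * (a₁₀ + b₀₁ * m + 2 * b₁₀ * l) + a₁₁ * m + a₂₀ * l + b₁₁ * l * m + b₀₂ * m ^ 2 = 0)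
    (h3 : k * (a₂₀ + b₁₁ * m + b₁₀ * k) = 0) :
    a₀₁ * (a₂₀ + b₁₁ * m) ^ 2 - (a₁₀ + b₀₁ * m) * (a₁₁ + b₀₂ * m) * (a₂₀ + b₁₁ * m) +
      b₁₀ * m * (a₁₁ + b₀₂ * m) ^ 2 = 0 := by
  rcases mul_eq_zero.mp h3 with hk | hk <;> grind

theorem resultant_eq_zero_of_four_roots {K : Type*} [Field K] {a₀₁ a₁₀ a₁₁ a₂₀ b₀₁ b₀₂ b₁₀ b₁₁ : K}
    {x y z w : K} (hxy : x ≠ y) (hxz : x ≠ z) (hxw : x ≠ w) (hyz : y ≠ z) (hyw : y ≠ w) (hzw : z ≠ w)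
    (h : ∀ m, m = x ∨ m = y ∨ m = z ∨ m = w → a₀₁ * (a₂₀ + b₁₁ * m) ^ 2 -
      (a₁₀ + b₀₁ * m) * (a₁₁ + b₀₂ * m) * (a₂₀ + b₁₁ * m) + b₁₀ * m * (a₁₁ + b₀₂ * m) ^ 2 = 0) (m : K) :
    a₀₁ * (a₂₀ + b₁₁ * m) ^ 2 - (a₁₀ + b₀₁ * m) * (a₁₁ + b₀₂ * m) * (a₂₀ + b₁₁ * m) +
      b₁₀ * m * (a₁₁ + b₀₂ * m) ^ 2 = 0 := by
  have expand : ∀ m, a₀₁ * (a₂₀ + b₁₁ * m) ^ 2 -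
      (a₁₀ + b₀₁ * m) * (a₁₁ + b₀₂ * m) * (a₂₀ + b₁₁ * m) + b₁₀ * m * (a₁₁ + b₀₂ * m) ^ 2 =
      (a₀₁ * a₂₀ ^ 2 - a₁₀ * a₁₁ * a₂₀) +
      (2 * a₀₁ * a₂₀ * b₁₁ - b₀₁ * a₁₁ * a₂₀ - a₁₀ * b₀₂ * a₂₀ - a₁₀ * a₁₁ * b₁₁ + b₁₀ * a₁₁ ^ 2) * m +
      (a₀₁ * b₁₁ ^ 2 - b₀₁ * b₀₂ * a₂₀ - b₀₁ * a₁₁ * b₁₁ - a₁₀ * b₀₂ * b₁₁ +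
        2 * b₁₀ * a₁₁ * b₀₂) * m ^ 2 +
      (b₁₀ * b₀₂ ^ 2 - b₀₁ * b₀₂ * b₁₁) * m ^ 3 := fun m => by ring
  simp only [expand] at h ⊢
  exact cubic_eq_zero_of_four_roots hxy hxz hxw hyz hyw hzw (h x (by simp)) (h y (by simp))
    (h z (by simp)) (h w (by simp)) m

theorem ne_of_injective_sub {K : Type*} [Field K] {A B : (Fin 2 → K) →ₗ[K] (Fin 2 → K)}
    {u v : Fin 2 → K} (huv : wedge u v ≠ 0) (h : ∀ x, A x = B x → x = 0) {l l' m m' k : K}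
    (hAu : A u = l • u) (hBu : B u = l' • u) (hAv : A v = m • v + k • u) (hBv : B v = m' • v) :
    m ≠ m' := by
  rintro rfl
  have hl : l' - l ≠ 0 := by
    intro hl
    apply ne_zero_of_wedge huv
    apply h
    rw [hAu, hBu, sub_eq_zero.mp hl]
  have hx := h ((k / (l' - l)) • u + (1 : K) • v) (by
    simp only [map_add, map_smul, hAu, hBu, hAv, hBv]
    ext i
    simp only [Pi.add_apply, Pi.smul_apply, smul_eq_mul]
    field_simp
    ring)
  exact one_ne_zero (eq_zero_of_smul_add_smul huv hx).2

variable {K : Type*} [Field K] [CharZero K]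
  {α β : (Fin 2 → K) →ₗ[K] (Fin 2 → K) →ₗ[K] (Fin 2 → K) →ₗ[K] K}
  {u v : Fin 2 → K}

theorem MixedCubic.leading_ne_zero (hαβ : MixedCubic α β) (huv : wedge u v ≠ 0) (hu : α u u u = 0) :
    α u u v ≠ 0 ∧ β v u u ≠ 0 := by
  have hu' : β u u u = 0 := by simpa [hu] using hαβ.diag u
  have hz := eq_smul_add_smul huv
  have hu0 := ne_zero_of_wedge huv
  constructor
  · rcases hαβ.smooth u 0 (Or.inl hu0) with ⟨z, h⟩ | ⟨z, h⟩
    all_goals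
      rw [hz z] at h
      simp only [map_add, map_smul, smul_eq_mul, map_zero, LinearMap.zero_apply] at h
      grind
  · rcases hαβ.smooth 0 u (Or.inr hu0) with ⟨z, h⟩ | ⟨z, h⟩
    all_goals
      rw [hz z] at h
      simp only [map_add, map_smul, smul_eq_mul, map_zero, LinearMap.zero_apply,
        LinearMap.add_apply, LinearMap.smul_apply] at h
      grind

theorem not_two_codiagonal (hαβ : MixedCubic α β) (huv : wedge u v ≠ 0)
    {M N P : (Fin 2 → K) →ₗ[K] (Fin 2 → K)} (hM : GraphLine α β M) (hN : GraphLine α β N)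
    (hP : GraphLine α β P) (hMN : ∀ x, M x = N x → x = 0) (hPM : ∀ x, P x = M x → x = 0)
    (hPN : ∀ x, P x = N x → x = 0) (hMu : ∃ c : K, M u = c • u) (hMv : ∃ c : K, M v = c • v)
    (hNu : ∃ c : K, N u = c • u) (hNv : ∃ c : K, N v = c • v) (hPu : ∃ c : K, P u = c • u) :
    False := by
  obtain ⟨l₁, hMu⟩ := hMu
  obtain ⟨m₁, hMv⟩ := hMv
  obtain ⟨l₂, hNu⟩ := hNu
  obtain ⟨m₂, hNv⟩ := hNv
  obtain ⟨l₃, hPu⟩ := hPu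
  have hPv := eq_smul_add_smul huv (P v)
  set m₃ := wedge u (P v) / wedge u v
  set k := wedge (P v) v / wedge u v
  rw [add_comm] at hPv
  have hMv' : M v = m₁ • v + (0 : K) • u := by rw [hMv, zero_smul, add_zero]
  have hNv' : N v = m₂ • v + (0 : K) • u := by rw [hNv, zero_smul, add_zero]
  have hiu : (LinearMap.id : (Fin 2 → K) →ₗ[K] (Fin 2 → K)) u = (1 : K) • u := by simp
  have hiv : (LinearMap.id : (Fin 2 → K) →ₗ[K] (Fin 2 → K)) v = (1 : K) • v := by simp
  have hiv' : (LinearMap.id : (Fin 2 → K) →ₗ[K] (Fin 2 → K)) v = (1 : K) • v + (0 : K) • u := by simp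
  have hu0 := ne_zero_of_wedge huv
  have hv0 := ne_zero_of_wedge (u := v) (v := u) (by rw [wedge_swap]; exact neg_ne_zero.mpr huv)
  have hu := (hM.cubic_eq_zero hαβ hu0 hMu).1
  have hv := (hM.cubic_eq_zero hαβ hv0 hMv).1
  have h12 := ne_of_injective_sub huv hMN hMu hNu hMv' hNv
  have h31 := ne_of_injective_sub huv hPM hPu hMu hPv hMv
  have h32 := ne_of_injective_sub huv hPN hPu hNu hPv hNv
  have h10 := ne_of_injective_sub huv hM.inj_one hMu hiu hMv' hiv
  have h20 := ne_of_injective_sub huv hN.inj_one hNu hiu hNv' hiv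
  have h30 := ne_of_injective_sub huv hP.inj_one hPu hiu hPv hiv
  have hm₃ : m₃ ≠ 0 := ne_of_injective_sub huv (B := 0) hP.inj hPu (l' := 0) (by simp) hPv (by simp)
  obtain ⟨a1, a2, a3⟩ := GraphLine.coefficient_relations hM.mem hαβ hu hv hMu hMv'
  obtain ⟨b1, b2, b3⟩ := GraphLine.coefficient_relations hN.mem hαβ hu hv hNu hNv'
  obtain ⟨c1, c2, c3⟩ := GraphLine.coefficient_relations hP.mem hαβ hu hv hPu hPv
  obtain ⟨d1, d2, d3⟩ := GraphLine.coefficient_relations (M := LinearMap.id) hαβ.diag hαβ hu hv hiu hiv'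
  have e1 := resultant_eq_zero_of_relations (hM.eigenvalue_ne_zero hu0 hMu)
    (hM.eigenvalue_ne_zero hv0 hMv) a1 a2 a3
  have e2 := resultant_eq_zero_of_relations (hN.eigenvalue_ne_zero hu0 hNu)
    (hN.eigenvalue_ne_zero hv0 hNv) b1 b2 b3
  have e3 := resultant_eq_zero_of_relations (hP.eigenvalue_ne_zero hu0 hPu) hm₃ c1 c2 c3
  have e0 := resultant_eq_zero_of_relations one_ne_zero one_ne_zero d1 d2 d3
  obtain ⟨f1, -⟩ := hαβ.leading_ne_zero huv hu
  obtain ⟨-, f2⟩ := hαβ.leading_ne_zero (u := v) (v := u)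
    (by rw [wedge_swap]; exact neg_ne_zero.mpr huv) hv
  have hv' : β v v v = 0 := by simpa [hv] using hαβ.diag v
  have hz := eq_smul_add_smul huv
  clear a1 a2 a3 b1 b2 b3 c1 c2 c3 d1 d2 d3
  have key := resultant_eq_zero_of_four_roots h12 h31.symm h10 h32.symm h20 h30
    (fun m hm => by rcases hm with rfl | rfl | rfl | rfl <;> assumption)
  have g := key (-(2 * α u v v) / β u v v)
  have g1 : 2 * α u v v + β u v v * (-(2 * α u v v) / β u v v) = 0 := by field_simp; ring
  rw [g1] at g
  simp only [mul_zero, zero_mul, sub_zero, ne_eq, OfNat.ofNat_ne_zero, not_false_eq_true, zero_pow,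
    add_zero, mul_eq_zero, f1, false_or, pow_eq_zero_iff] at g
  rcases hαβ.smooth (β u v v • v) ((-(2 * α u v v)) • v) (by
    left
    exact smul_ne_zero f2 hv0) with ⟨z, h⟩ | ⟨z, h⟩
  all_goals
    rw [hz z] at h
    simp only [map_add, map_smul, smul_eq_mul, LinearMap.add_apply, LinearMap.smul_apply,
      hαβ.swap_left v u, hαβ.swap_right _ v u, hv, hv'] at h
    apply h
    field_simp at g
    grind

end GraphTriple

section EigenFrame

variable {K : Type*} [Field K] [CharZero K]
  {α β : (Fin 2 → K) →ₗ[K] (Fin 2 → K) →ₗ[K] (Fin 2 → K) →ₗ[K] K}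

theorem exists_diagonal_perm [IsAlgClosed K] (hαβ : MixedCubic α β)
    {N : Fin 3 → (Fin 2 → K) →ₗ[K] (Fin 2 → K)} (hN : ∀ i, GraphLine α β (N i))
    (hNN : ∀ i j, i ≠ j → ∀ x, N i x = N j x → x = 0) :
    ∃ (σ : Equiv.Perm (Fin 3)) (r : Fin 3 → Fin 2 → K), (∀ i j, i ≠ j → wedge (r i) (r j) ≠ 0) ∧
      r 0 + r 1 + r 2 = 0 ∧ ∀ i j, j ≠ i → ∃ c : K, N (σ i) (r j) = c • r j := by
  obtain ⟨u, v, huv, ⟨c, hc⟩, d, hd⟩ := (hN 0).exists_eigenvectors hαβ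
  have hu0 := ne_zero_of_wedge huv
  have hv0 := ne_zero_of_wedge (u := v) (v := u) (by rw [wedge_swap]; exact neg_ne_zero.mpr huv)
  obtain ⟨r, hr, hr0, hrc⟩ := hαβ.exists_roots huv ((hN 0).cubic_eq_zero hαβ hu0 hc).1
    ((hN 0).cubic_eq_zero hαβ hv0 hd).1
  choose τ hτ using fun i => (hN i).exists_diagonal hαβ hrc
  have hinj : Function.Injective τ := by
    intro i j hij
    by_contra hne
    have h1 : ∀ i j : Fin 3, i ≠ j → ∃ k, k ≠ i ∧ k ≠ j := by decide
    have h2 : ∀ s t : Fin 3, ∃ a b, a ≠ b ∧ a ≠ s ∧ a ≠ t ∧ b ≠ s := by decide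
    obtain ⟨k, hki, hkj⟩ := h1 i j hne
    obtain ⟨a, b, hab, has, hat, hbs⟩ := h2 (τ i) (τ k)
    exact not_two_codiagonal hαβ (hr a b hab) (hN i) (hN j) (hN k) (hNN i j hne) (hNN k i hki)
      (hNN k j hkj) (hτ i a has) (hτ i b hbs) (hτ j a (hij ▸ has)) (hτ j b (hij ▸ hbs)) (hτ k a hat)
  let ρ := Equiv.ofBijective τ (Finite.injective_iff_bijective.mp hinj)
  refine ⟨ρ.symm, r, hr, hr0, fun i j hj => hτ _ j ?_⟩
  rw [show τ (ρ.symm i) = i from ρ.apply_symm_apply i]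
  exact hj

theorem exists_eigenFrame [IsAlgClosed K] (hαβ : MixedCubic α β)
    {N : Fin 3 → (Fin 2 → K) →ₗ[K] (Fin 2 → K)} (hN : ∀ i, GraphLine α β (N i))
    (hNN : ∀ i j, i ≠ j → ∀ x, N i x = N j x → x = 0) :
    ∃ (σ : Equiv.Perm (Fin 3)) (u v : Fin 2 → K) (a b c d e f : K), wedge u v ≠ 0 ∧
      N (σ 2) u = a • u ∧ N (σ 2) v = b • v ∧ N (σ 1) u = c • u ∧ N (σ 1) (u + v) = d • (u + v) ∧
      N (σ 0) v = e • v ∧ N (σ 0) (u + v) = f • (u + v) := by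
  obtain ⟨σ, r, hr, hr0, h⟩ := exists_diagonal_perm hαβ hN hNN
  have hr2 : r 0 + r 1 = -r 2 := eq_neg_of_add_eq_zero_left hr0
  obtain ⟨a, ha⟩ := h 2 0 (by decide)
  obtain ⟨b, hb⟩ := h 2 1 (by decide)
  obtain ⟨c, hc⟩ := h 1 0 (by decide)
  obtain ⟨d, hd⟩ := h 1 2 (by decide)
  obtain ⟨e, he⟩ := h 0 1 (by decide)
  obtain ⟨f, hf⟩ := h 0 2 (by decide)
  refine ⟨σ, r 0, r 1, a, b, c, d, e, f, hr 0 1 (by decide), ha, hb, hc, ?_, he, ?_⟩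
  · rw [hr2, map_neg, hd, smul_neg]
  · rw [hr2, map_neg, hf, smul_neg]

theorem frame_relations {K : Type*} [Field K] {a b c d e f a₀₁ a₁₀ a₁₁ a₂₀ b₀₁ b₀₂ b₁₀ b₁₁ : K}
    (i₁ : a₀₁ + a₁₀ + b₀₁ + b₁₀ = 0) (i₂ : a₁₁ + a₂₀ + b₁₁ + b₀₂ = 0)
    (i₃ : a₀₁ + a₁₀ + a₁₁ + a₂₀ = 0)
    (n₁ : a₀₁ * b + a₁₀ * a + b₀₁ * a * b + b₁₀ * a ^ 2 = 0)
    (n₁' : a₁₁ * b + a₂₀ * a + b₁₁ * a * b + b₀₂ * b ^ 2 = 0)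
    (n₂ : a₀₁ * d + a₁₀ * c + b₀₁ * c * d + b₁₀ * c ^ 2 = 0)
    (n₂' : (d - c) * (a₁₀ + b₀₁ * d + 2 * b₁₀ * c) + a₁₁ * d + a₂₀ * c + b₁₁ * c * d +
      b₀₂ * d ^ 2 = 0)
    (n₂'' : a₂₀ + b₁₁ * d + b₁₀ * (d - c) = 0)
    (n₃ : a₂₀ * f + a₁₁ * e + b₁₁ * e * f + b₀₂ * e ^ 2 = 0)
    (n₃' : (f - e) * (a₁₁ + b₁₁ * f + 2 * b₀₂ * e) + a₁₀ * f + a₀₁ * e + b₀₁ * e * f +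
      b₁₀ * f ^ 2 = 0)
    (n₃'' : a₀₁ + b₀₁ * f + b₀₂ * (f - e) = 0)
    (ha : a ≠ 0) (hb : b ≠ 0) (hc : c ≠ 0) (hd : d ≠ 0) (he : e ≠ 0) (hf : f ≠ 0)
    (hab : a - b ≠ 0) (hbd : b - d ≠ 0)
    (hce : c - e ≠ 0) (h₀₁ : a₀₁ ≠ 0) (h₁₀ : b₁₀ ≠ 0) (h₂₀ : a₂₀ ≠ 0) (h₀₂ : b₀₂ ≠ 0)
    (hk : a₀₁ + a₁₀ ≠ 0) :
    a * d * e = b * c * f ∧ (a - 1) * (d - 1) * (e - 1) = (b - 1) * (c - 1) * (f - 1) := by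
  obtain ⟨k, hk'⟩ : ∃ k, k = a₀₁ + a₁₀ := ⟨_, rfl⟩
  obtain rfl : a₁₀ = k - a₀₁ := by linear_combination -hk'
  obtain rfl : a₁₁ = -k - a₂₀ := by linear_combination i₃
  obtain rfl : b₀₁ = -k - b₁₀ := by linear_combination i₁
  obtain rfl : b₁₁ = k - b₀₂ := by linear_combination i₂
  rw [← hk'] at hk
  clear hk' i₁ i₂ i₃
  have h1 : b₁₀ * a * e = a₀₁ * b := by grind
  have h2 : b₁₀ * c * f = a₀₁ * d := by grind
  refine ⟨?_, by grind⟩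
  apply mul_left_cancel₀ h₁₀
  linear_combination d * h1 - b * h2

theorem eigenData_of_frame (hαβ : MixedCubic α β) {u v : Fin 2 → K} (huv : wedge u v ≠ 0)
    {M N P : (Fin 2 → K) →ₗ[K] (Fin 2 → K)} (hM : GraphLine α β M) (hN : GraphLine α β N)
    (hP : GraphLine α β P) (hMN : ∀ x, M x = N x → x = 0) (hMP : ∀ x, M x = P x → x = 0)
    (hNP : ∀ x, N x = P x → x = 0) {a b c d e f : K} (hMu : M u = a • u) (hMv : M v = b • v)
    (hNu : N u = c • u) (hNw : N (u + v) = d • (u + v)) (hPv : P v = e • v)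
    (hPw : P (u + v) = f • (u + v)) : EigenData a b c d e f := by
  have hNM : ∀ x, N x = M x → x = 0 := fun x h => hMN x h.symm
  have hPM : ∀ x, P x = M x → x = 0 := fun x h => hMP x h.symm
  have hvu : wedge v u ≠ 0 := by rw [wedge_swap]; exact neg_ne_zero.mpr huv
  have huw : wedge u (u + v) ≠ 0 := by
    have := wedge_smul_add u v 1 0 1 1
    simp only [one_smul, zero_smul, add_zero] at this
    simpa [this] using huv
  have hvw : wedge v (u + v) ≠ 0 := by
    have := wedge_smul_add u v 0 1 1 1
    simp only [one_smul, zero_smul, zero_add] at this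
    simpa [this] using huv
  have hwv : wedge (u + v) v ≠ 0 := by rw [wedge_swap]; exact neg_ne_zero.mpr hvw
  have hu0 := ne_zero_of_wedge huv
  have hv0 := ne_zero_of_wedge hvu
  have hw0 := ne_zero_of_wedge hwv
  have hNv : N v = d • v + (d - c) • u := by
    have : N v = N (u + v) - N u := by rw [map_add]; abel
    rw [this, hNw, hNu]
    module
  have hNv' : N v = c • v + (d - c) • (u + v) := by rw [hNv]; module
  have hPu : P u = f • u + (f - e) • v := by
    have : P u = P (u + v) - P v := by rw [map_add]; abel
    rw [this, hPw, hPv]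
    module
  have hMv' : M v = b • v + (0 : K) • u := by rw [hMv, zero_smul, add_zero]
  have hMu' : M u = a • u + (0 : K) • v := by rw [hMu, zero_smul, add_zero]
  have hNw' : N (u + v) = d • (u + v) + (0 : K) • u := by rw [hNw, zero_smul, add_zero]
  have hNu' : N u = c • u + (0 : K) • (u + v) := by rw [hNu, zero_smul, add_zero]
  have hPw' : P (u + v) = f • (u + v) + (0 : K) • v := by rw [hPw, zero_smul, add_zero]
  have hPv' : P v = e • v + (0 : K) • (u + v) := by rw [hPv, zero_smul, add_zero]
  have hab := sub_ne_zero.mpr (hM.eigenvalue_ne hαβ huv hMu hMv')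
  have hcd := sub_ne_zero.mpr (hN.eigenvalue_ne hαβ huw hNu hNw')
  have hef := sub_ne_zero.mpr (hP.eigenvalue_ne hαβ hvw hPv hPw')
  have hac : a - c ≠ 0 := sub_ne_zero.mpr (by
    rintro rfl
    exact hu0 (hMN u (by rw [hMu, hNu])))
  have hbd := sub_ne_zero.mpr (ne_of_injective_sub huv hNM hNu hMu hNv hMv).symm
  have haf := sub_ne_zero.mpr (ne_of_injective_sub hvu hPM hPv hMv hPu hMu).symm
  have hbe : b - e ≠ 0 := sub_ne_zero.mpr (by
    rintro rfl
    exact hv0 (hMP v (by rw [hMv, hPv])))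
  have hce := sub_ne_zero.mpr (ne_of_injective_sub hwv hNP hNw hPw hNv' hPv)
  have hdf : d - f ≠ 0 := sub_ne_zero.mpr (by
    rintro rfl
    exact hw0 (hNP _ (by rw [hNw, hPw])))
  have ha := hM.eigenvalue_ne_zero hu0 hMu
  have hb := hM.eigenvalue_ne_zero hv0 hMv
  have hc := hN.eigenvalue_ne_zero hu0 hNu
  have hd := hN.eigenvalue_ne_zero hw0 hNw
  have he := hP.eigenvalue_ne_zero hv0 hPv
  have hf := hP.eigenvalue_ne_zero hw0 hPw
  have hu := (hM.cubic_eq_zero hαβ hu0 hMu).1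
  have hv := (hM.cubic_eq_zero hαβ hv0 hMv).1
  have hw := (hN.cubic_eq_zero hαβ hw0 hNw).1
  obtain ⟨g1, g2⟩ := hαβ.leading_ne_zero huv hu
  obtain ⟨g3, g4⟩ := hαβ.leading_ne_zero hvu hv
  have hk := hαβ.ne_zero_of_cubic_eq_zero huv hu
  obtain ⟨m1, m2, -⟩ := GraphLine.coefficient_relations hM.mem hαβ hu hv hMu hMv'
  obtain ⟨n1, n2, n3⟩ := GraphLine.coefficient_relations hN.mem hαβ hu hv hNu hNv
  obtain ⟨p1, p2, p3⟩ := GraphLine.coefficient_relations hP.mem hαβ hv hu hPv hPu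
  obtain ⟨i1, i2, -⟩ := GraphLine.coefficient_relations (M := LinearMap.id) (l := 1) (m := 1) (k := 0)
    hαβ.diag hαβ hu hv (by simp) (by simp)
  have n3' := (mul_eq_zero.mp n3).resolve_left (by rw [← neg_sub]; exact neg_ne_zero.mpr hcd)
  have p3' := (mul_eq_zero.mp p3).resolve_left (by rw [← neg_sub]; exact neg_ne_zero.mpr hef)
  simp only [map_add, LinearMap.add_apply, hu, hv] at hw
  simp only [hαβ.swap_left v u, hαβ.swap_right _ v u] at *
  obtain ⟨r1, r2⟩ := frame_relations (a₀₁ := α u u v) (a₁₀ := 2 * α u v u) (a₁₁ := 2 * α u v v)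
    (a₂₀ := α v v u) (b₀₁ := 2 * β u u v) (b₀₂ := β u v v) (b₁₀ := β v u u) (b₁₁ := 2 * β v u v)
    (a := a) (b := b) (c := c) (d := d) (e := e) (f := f)
    (by linear_combination i1) (by linear_combination i2) (by linear_combination hw)
    (by linear_combination m1) (by linear_combination m2) (by linear_combination n1)
    (by linear_combination n2) (by linear_combination n3') (by linear_combination p1)
    (by linear_combination p2) (by linear_combination p3') ha hb hc hd he hf hab hbd hce
    g1 g2 g3 g4 hk
  exact {
    α0 := ha
    β0 := hb
    γ0 := hc
    δ0 := hd
    ε0 := he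
    ζ0 := hf
    α1 := hM.eigenvalue_sub_one_ne_zero hu0 hMu
    β1 := hM.eigenvalue_sub_one_ne_zero hv0 hMv
    γ1 := hN.eigenvalue_sub_one_ne_zero hu0 hNu
    δ1 := hN.eigenvalue_sub_one_ne_zero hw0 hNw
    ε1 := hP.eigenvalue_sub_one_ne_zero hv0 hPv
    ζ1 := hP.eigenvalue_sub_one_ne_zero hw0 hPw
    αβ := hab
    γδ := hcd
    εζ := hef
    αγ := hac
    βδ := hbd
    αζ := haf
    βε := hbe
    γε := hce
    δζ := hdf
    prod := r1
    prod_sub := r2 }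

end EigenFrame

section Descent

/-- The complexification of a real vector. -/
def complexVec (x : Fin 2 → ℝ) : Fin 2 → ℂ := fun i => (x i : ℂ)

theorem exists_eq_complexVec_add (z : Fin 2 → ℂ) :
    ∃ a b, z = complexVec a + Complex.I • complexVec b := by
  refine ⟨fun i => (z i).re, fun i => (z i).im, funext fun i => ?_⟩
  simp only [complexVec, Pi.add_apply, Pi.smul_apply, smul_eq_mul]
  rw [mul_comm, Complex.re_add_im]

theorem complexVec_add_smul_eq_zero {a b : Fin 2 → ℝ}
    (h : complexVec a + Complex.I • complexVec b = 0) : a = 0 ∧ b = 0 :=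
  ofReal_add_smul_eq_zero h

theorem wedge_complexVec (x y : Fin 2 → ℝ) :
    wedge (complexVec x) (complexVec y) = (wedge x y : ℝ) := by
  simp [wedge, complexVec]

/-- The complexification of a real trilinear form. -/
noncomputable def complexForm (α : (Fin 2 → ℝ) →ₗ[ℝ] (Fin 2 → ℝ) →ₗ[ℝ] (Fin 2 → ℝ) →ₗ[ℝ] ℝ) :
    (Fin 2 → ℂ) →ₗ[ℂ] (Fin 2 → ℂ) →ₗ[ℂ] (Fin 2 → ℂ) →ₗ[ℂ] ℂ :=
  triForm fun i j k => ((α (Pi.single i 1) (Pi.single j 1) (Pi.single k 1) : ℝ) : ℂ)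

/-- The complexification of a real linear map. -/
noncomputable def complexMap (N : (Fin 2 → ℝ) →ₗ[ℝ] (Fin 2 → ℝ)) :
    (Fin 2 → ℂ) →ₗ[ℂ] (Fin 2 → ℂ) :=
  Matrix.toLin' ((LinearMap.toMatrix' N).map Complex.ofRealHom)

theorem complexMap_apply (N : (Fin 2 → ℝ) →ₗ[ℝ] (Fin 2 → ℝ)) (x : Fin 2 → ℝ) :
    complexMap N (complexVec x) = complexVec (N x) := by
  have h : N x = (LinearMap.toMatrix' N).mulVec x := by
    rw [← Matrix.toLin'_apply, Matrix.toLin'_toMatrix']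
  funext i
  rw [h, complexMap, Matrix.toLin'_apply]
  exact (RingHom.map_mulVec Complex.ofRealHom (LinearMap.toMatrix' N) x i).symm

theorem triForm_single {K : Type*} [Field K] {n : ℕ}
    (α : (Fin n → K) →ₗ[K] (Fin n → K) →ₗ[K] (Fin n → K) →ₗ[K] K) :
    triForm (fun i j k => α (Pi.single i 1) (Pi.single j 1) (Pi.single k 1)) = α := by
  refine LinearMap.pi_ext' fun i => LinearMap.ext_ring ?_
  refine LinearMap.pi_ext' fun j => LinearMap.ext_ring ?_
  refine LinearMap.pi_ext' fun k => LinearMap.ext_ring ?_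
  simp [triForm_apply, Pi.single_apply]

theorem complexForm_apply (α : (Fin 2 → ℝ) →ₗ[ℝ] (Fin 2 → ℝ) →ₗ[ℝ] (Fin 2 → ℝ) →ₗ[ℝ] ℝ)
    (x y z : Fin 2 → ℝ) :
    complexForm α (complexVec x) (complexVec y) (complexVec z) = (α x y z : ℝ) := by
  have := triForm_ofReal (fun i j k => α (Pi.single i 1) (Pi.single j 1) (Pi.single k 1)) x y z
  rw [triForm_single] at this
  exact this

theorem eq_zero_of_cubic_eq_zero {V : Type*} [AddCommGroup V] [Module ℝ V]
    (f : V →ₗ[ℝ] V →ₗ[ℝ] V →ₗ[ℝ] ℝ) (hl : ∀ x y z, f x y z = f y x z)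
    (hr : ∀ x y z, f x y z = f x z y) (h : ∀ x, f x x x = 0) (x y z : V) : f x y z = 0 := by
  have h2 : ∀ x y, f x x y = 0 := by
    intro x y
    have h1 := h (x + y)
    have h2 := h (x - y)
    simp only [map_add, map_sub, LinearMap.add_apply, LinearMap.sub_apply, h, hr x y x, hl y x,
      hr y y x] at h1 h2
    linarith [hl y x x, hr x y x, hl y x y, hr y y x]
  have h3 := h2 (x + y) z
  simp only [map_add, LinearMap.add_apply, h2, hl y x] at h3
  linarith

/-- The part of a trilinear form of bidegree `(2, 1)`. -/
def leftPart {K V : Type*} [Field K] [AddCommGroup V] [Module K V]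
    (Ψ : V × V →ₗ[K] V × V →ₗ[K] V × V →ₗ[K] K) : V →ₗ[K] V →ₗ[K] V →ₗ[K] K :=
  (Ψ.compl₁₂ (LinearMap.inl K V V) (LinearMap.inl K V V)).compr₂
    (LinearMap.lcomp K K (LinearMap.inr K V V))

/-- The part of a trilinear form of bidegree `(1, 2)`. -/
def rightPart {K V : Type*} [Field K] [AddCommGroup V] [Module K V]
    (Ψ : V × V →ₗ[K] V × V →ₗ[K] V × V →ₗ[K] K) : V →ₗ[K] V →ₗ[K] V →ₗ[K] K :=
  (Ψ.compl₁₂ (LinearMap.inl K V V) (LinearMap.inr K V V)).compr₂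
    (LinearMap.lcomp K K (LinearMap.inr K V V))

theorem leftPart_apply {K V : Type*} [Field K] [AddCommGroup V] [Module K V]
    (Ψ : V × V →ₗ[K] V × V →ₗ[K] V × V →ₗ[K] K) (x y z : V) :
    leftPart Ψ x y z = Ψ (x, 0) (y, 0) (0, z) := rfl

theorem rightPart_apply {K V : Type*} [Field K] [AddCommGroup V] [Module K V]
    (Ψ : V × V →ₗ[K] V × V →ₗ[K] V × V →ₗ[K] K) (x y z : V) :
    rightPart Ψ x y z = Ψ (x, 0) (0, y) (0, z) := rfl

section Mixed

variable {Ψ : (Fin 2 → ℝ) × (Fin 2 → ℝ) →ₗ[ℝ] (Fin 2 → ℝ) × (Fin 2 → ℝ) →ₗ[ℝ]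
  (Fin 2 → ℝ) × (Fin 2 → ℝ) →ₗ[ℝ] ℝ}

theorem SmoothCubic.apply_eq (hΨ : SmoothCubic Ψ) (hx : ∀ x, Ψ (x, 0) (x, 0) (x, 0) = 0)
    (hy : ∀ y, Ψ (0, y) (0, y) (0, y) = 0) (x y x' y' p q : Fin 2 → ℝ) :
    Ψ (x, y) (x', y') (p, q) = leftPart Ψ x x' q + leftPart Ψ x p y' + leftPart Ψ x' p y +
      rightPart Ψ x y' q + rightPart Ψ x' y q + rightPart Ψ p y y' := by
  have h0 := eq_zero_of_cubic_eq_zero (Ψ.compl₁₂ (LinearMap.inl ℝ _ _) (LinearMap.inl ℝ _ _) |>.compr₂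
    (LinearMap.lcomp ℝ ℝ (LinearMap.inl ℝ (Fin 2 → ℝ) (Fin 2 → ℝ))))
    (fun _ _ _ => hΨ.swap_left _ _ _) (fun _ _ _ => hΨ.swap_right _ _ _) hx x x' p
  have h1 := eq_zero_of_cubic_eq_zero (Ψ.compl₁₂ (LinearMap.inr ℝ _ _) (LinearMap.inr ℝ _ _) |>.compr₂
    (LinearMap.lcomp ℝ ℝ (LinearMap.inr ℝ (Fin 2 → ℝ) (Fin 2 → ℝ))))
    (fun _ _ _ => hΨ.swap_left _ _ _) (fun _ _ _ => hΨ.swap_right _ _ _) hy y y' q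
  change Ψ (x, 0) (x', 0) (p, 0) = 0 at h0
  change Ψ (0, y) (0, y') (0, q) = 0 at h1
  have e : ∀ a b : Fin 2 → ℝ, (a, b) = (a, 0) + (0, b) := fun a b => by simp
  rw [e x y, e x' y', e p q]
  simp only [map_add, LinearMap.add_apply, h0, h1, leftPart_apply, rightPart_apply]
  rw [hΨ.swap_right (x, 0) (0, y') (p, 0), hΨ.swap_left (0, y) (x', 0) (p, 0),
    hΨ.swap_right (x', 0) (0, y) (p, 0), hΨ.swap_left (0, y) (x', 0) (0, q),
    hΨ.swap_right (0, y) (0, y') (p, 0), hΨ.swap_left (0, y) (p, 0) (0, y')]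
  ring

theorem leftPart_swap (hΨ : SmoothCubic Ψ) (x y z : Fin 2 → ℝ) :
    leftPart Ψ x y z = leftPart Ψ y x z := hΨ.swap_left _ _ _

theorem rightPart_swap (hΨ : SmoothCubic Ψ) (x y z : Fin 2 → ℝ) :
    rightPart Ψ x y z = rightPart Ψ x z y := hΨ.swap_right _ _ _

theorem complexForm_swap_left {α : (Fin 2 → ℝ) →ₗ[ℝ] (Fin 2 → ℝ) →ₗ[ℝ] (Fin 2 → ℝ) →ₗ[ℝ] ℝ}
    (h : ∀ x y z, α x y z = α y x z) (x y z : Fin 2 → ℂ) :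
    complexForm α x y z = complexForm α y x z :=
  triForm_swap_left (fun _ _ _ => by rw [h]) x y z

theorem complexForm_swap_right {α : (Fin 2 → ℝ) →ₗ[ℝ] (Fin 2 → ℝ) →ₗ[ℝ] (Fin 2 → ℝ) →ₗ[ℝ] ℝ}
    (h : ∀ x y z, α x y z = α x z y) (x y z : Fin 2 → ℂ) :
    complexForm α x y z = complexForm α x z y :=
  triForm_swap_right (fun _ _ _ => by rw [h]) x y z

theorem complex_cubic_eq_zero
    {α β : (Fin 2 → ℝ) →ₗ[ℝ] (Fin 2 → ℝ) →ₗ[ℝ] (Fin 2 → ℝ) →ₗ[ℝ] ℝ}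
    {N : (Fin 2 → ℝ) →ₗ[ℝ] (Fin 2 → ℝ)} (h : ∀ x, α x x (N x) + β x (N x) (N x) = 0)
    {N' : (Fin 2 → ℂ) →ₗ[ℂ] (Fin 2 → ℂ)}
    (hN' : ∀ x, N' (complexVec x) = complexVec (N x)) (z : Fin 2 → ℂ) :
    complexForm α z z (N' z) + complexForm β z (N' z) (N' z) = 0 := by
  obtain ⟨a, b, rfl⟩ := exists_eq_complexVec_add z
  have h1 := h a
  have h2 := h b
  have h3 := h (a + b)
  have h4 := h (a - b)
  simp only [map_add, map_sub, LinearMap.add_apply, LinearMap.sub_apply] at h3 h4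
  have h5 := congrArg Complex.ofReal h1
  have h6 := congrArg Complex.ofReal h2
  have h7 := congrArg Complex.ofReal h3
  have h8 := congrArg Complex.ofReal h4
  push_cast at h5 h6 h7 h8
  simp only [map_add, map_smul, LinearMap.add_apply, LinearMap.smul_apply, hN', complexForm_apply,
    smul_eq_mul]
  grind [Complex.I_sq]

theorem complexMap_injective {N N' : (Fin 2 → ℝ) →ₗ[ℝ] (Fin 2 → ℝ)}
    (h : ∀ x, N x = N' x → x = 0) {P P' : (Fin 2 → ℂ) →ₗ[ℂ] (Fin 2 → ℂ)}
    (hP : ∀ x, P (complexVec x) = complexVec (N x))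
    (hP' : ∀ x, P' (complexVec x) = complexVec (N' x)) (z : Fin 2 → ℂ) (hz : P z = P' z) :
    z = 0 := by
  obtain ⟨a, b, rfl⟩ := exists_eq_complexVec_add z
  have e : complexVec (N a - N' a) + Complex.I • complexVec (N b - N' b) = 0 := by
    have e' : ∀ x y, complexVec (x - y) = complexVec x - complexVec y := fun x y => by
      ext i
      simp [complexVec]
    rw [e', e', ← hP, ← hP, ← hP', ← hP', smul_sub, ← map_smul, ← map_smul, sub_add_sub_comm,
      ← map_add, ← map_add, hz, sub_self]
  obtain ⟨h1, h2⟩ := complexVec_add_smul_eq_zero e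
  rw [h a (sub_eq_zero.mp h1), h b (sub_eq_zero.mp h2)]
  ext i
  simp [complexVec]

theorem GraphLine.complex
    {α β : (Fin 2 → ℝ) →ₗ[ℝ] (Fin 2 → ℝ) →ₗ[ℝ] (Fin 2 → ℝ) →ₗ[ℝ] ℝ}
    {N : (Fin 2 → ℝ) →ₗ[ℝ] (Fin 2 → ℝ)} (h : GraphLine α β N) :
    GraphLine (complexForm α) (complexForm β) (complexMap N) where
  mem := complex_cubic_eq_zero h.mem (complexMap_apply N)
  inj := fun z hz => complexMap_injective (N := N) (N' := 0) h.inj (complexMap_apply N) (P' := 0)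
    (fun _ => by ext; simp [complexVec]) z hz
  inj_one := fun z hz => complexMap_injective (N := N) (N' := LinearMap.id) h.inj_one
    (complexMap_apply N) (P' := LinearMap.id) (fun _ => rfl) z hz

theorem SmoothCubic.mixedCubic (hΨ : SmoothCubic Ψ) (hx : ∀ x, Ψ (x, 0) (x, 0) (x, 0) = 0)
    (hy : ∀ y, Ψ (0, y) (0, y) (0, y) = 0) (hd : ∀ x, Ψ (x, x) (x, x) (x, x) = 0) :
    MixedCubic (leftPart Ψ) (rightPart Ψ) where
  swap_left := leftPart_swap hΨ
  swap_right := rightPart_swap hΨ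
  diag := fun x => by
    have := hd x
    rw [hΨ.apply_eq hx hy] at this
    linarith
  smooth := fun x y hxy => by
    obtain ⟨⟨p, q⟩, h⟩ := hΨ.smooth (x, y) 0 (Or.inl (by
      rw [Ne, Prod.mk_eq_zero]
      tauto))
    by_contra! h'
    have e1 := h'.1 p
    have e2 := h'.2 q
    rw [hΨ.apply_eq hx hy] at h
    simp only [map_zero, LinearMap.zero_apply, ne_eq, not_true_eq_false, or_false] at h
    exact h (by linear_combination e1 + e2)

theorem SmoothCubic.complex_mixedCubic (hΨ : SmoothCubic Ψ)
    (hx : ∀ x, Ψ (x, 0) (x, 0) (x, 0) = 0) (hy : ∀ y, Ψ (0, y) (0, y) (0, y) = 0)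
    (hd : ∀ x, Ψ (x, x) (x, x) (x, x) = 0) :
    MixedCubic (complexForm (leftPart Ψ)) (complexForm (rightPart Ψ)) where
  swap_left := complexForm_swap_left (leftPart_swap hΨ)
  swap_right := complexForm_swap_right (rightPart_swap hΨ)
  diag := complex_cubic_eq_zero (N := LinearMap.id) (hΨ.mixedCubic hx hy hd).diag
    (N' := LinearMap.id) fun _ => rfl
  smooth := fun x y hxy => by
    obtain ⟨x, x', rfl⟩ := exists_eq_complexVec_add x
    obtain ⟨y, y', rfl⟩ := exists_eq_complexVec_add y
    obtain ⟨⟨p, q⟩, h⟩ := hΨ.smooth (x, y) (x', y') (by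
      by_contra! h0
      simp only [Prod.mk_eq_zero] at h0
      obtain ⟨⟨rfl, rfl⟩, rfl, rfl⟩ := h0
      have : complexVec 0 = 0 := by ext; simp [complexVec]
      simp [this] at hxy)
    by_contra! h'
    have e1 := h'.1 (complexVec p)
    have e2 := h'.2 (complexVec q)
    simp only [map_add, map_smul, LinearMap.add_apply, LinearMap.smul_apply, complexForm_apply,
      smul_eq_mul] at e1 e2
    have e3 := congrArg₂ (· + ·) e1 e2
    have er := congrArg Complex.re e3
    have ei := congrArg Complex.im e3
    simp at er ei
    rw [hΨ.apply_eq hx hy, hΨ.apply_eq hx hy, hΨ.apply_eq hx hy] at h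
    have s1 := leftPart_swap hΨ
    have s2 := rightPart_swap hΨ
    rcases h with h | h
    · exact h (by linarith [s1 x x' q, s1 x p y, s2 x y q])
    · exact h (by linarith [s1 x x' q, s2 p y y'])

end Mixed

theorem wedge_eq_zero_of_common {K : Type*} [Field K] {S T : (Fin 2 → K) →ₗ[K] (Fin 2 → K)}
    {p q x : Fin 2 → K} (hpq : wedge p q ≠ 0) {s t l m : K} (hst : s - t ≠ 0) (hp : S p = s • p)
    (hq : S q = t • q) (hT : wedge q (T q) ≠ 0) (hx : S x = l • x) (hx' : T x = m • x) :
    wedge p x = 0 := by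
  obtain ⟨A, B, rfl⟩ : ∃ A B : K, x = A • p + B • q := ⟨_, _, eq_smul_add_smul hpq x⟩
  have h0 : (A * (s - l)) • p + (B * (t - l)) • q = 0 := by
    simp only [map_add, map_smul, hp, hq] at hx
    rw [← sub_eq_zero] at hx
    rw [← hx]
    module
  obtain ⟨h1, h2⟩ := eq_zero_of_smul_add_smul hpq h0
  have h3 := wedge_smul_add p q 1 0 A B
  simp only [one_smul, zero_smul, add_zero] at h3
  rw [h3]
  by_cases hB : B = 0
  · simp [hB]
  · have hA : A = 0 := by
      have : t - l = 0 := by simpa [hB] using h2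
      refine (mul_eq_zero.mp h1).resolve_right fun h => hst ?_
      linear_combination h - this
    subst hA
    exfalso
    apply hT
    simp only [zero_smul, zero_add, map_smul] at hx'
    rw [smul_comm, (smul_right_injective _ hB).eq_iff] at hx'
    rw [hx']
    simp [wedge]
    ring

theorem exists_ofReal_frame {u v : Fin 2 → ℂ} (huv : wedge u v ≠ 0) (hu : wedge u (star u) = 0)
    (hv : wedge v (star v) = 0) (hw : wedge (u + v) (star (u + v)) = 0) :
    ∃ (k : ℂ) (u' v' : Fin 2 → ℝ), k ≠ 0 ∧ u = k • complexVec u' ∧ v = k • complexVec v' := by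
  have hu0 := ne_zero_of_wedge huv
  have hv0 := ne_zero_of_wedge (u := v) (v := u) (by rw [wedge_swap]; exact neg_ne_zero.mpr huv)
  have hw0 : u + v ≠ 0 := fun h => huv (by
    rw [eq_neg_of_add_eq_zero_left h]
    simp [wedge]
    ring)
  obtain ⟨s, hs⟩ := exists_eq_smul_of_wedge hu0 hu
  obtain ⟨t, ht⟩ := exists_eq_smul_of_wedge hv0 hv
  obtain ⟨r, hr⟩ := exists_eq_smul_of_wedge hw0 hw
  have h0 : (s - r) • u + (t - r) • v = 0 := by
    rw [star_add, hs, ht, ← sub_eq_zero] at hr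
    rw [← hr]
    module
  obtain ⟨h1, h2⟩ := eq_zero_of_smul_add_smul huv h0
  obtain rfl : s = r := sub_eq_zero.mp h1
  obtain rfl : t = s := sub_eq_zero.mp h2
  obtain ⟨j, hj⟩ := Function.ne_iff.mp hu0
  have hj' : u j ≠ 0 := hj
  have key : ∀ x : Fin 2 → ℂ, star x = t • x → x = u j • complexVec fun i => (x i / u j).re := by
    intro x hx
    ext i
    have e1 : (starRingEnd ℂ) (x i) = t * x i := congrFun hx i
    have e2 : (starRingEnd ℂ) (u j) = t * u j := congrFun hs j
    have ht0 : t ≠ 0 := fun h => hj' (by simpa [h] using e2)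
    have e3 : ((x i / u j).re : ℂ) = x i / u j := by
      rw [← Complex.conj_eq_iff_re, map_div₀, e1, e2, mul_div_mul_left _ _ ht0]
    simp only [complexVec, Pi.smul_apply, smul_eq_mul]
    rw [e3, mul_div_cancel₀ _ hj']
  exact ⟨u j, _, _, hj', key u hs, key v ht⟩

theorem complexMap_star (N : (Fin 2 → ℝ) →ₗ[ℝ] (Fin 2 → ℝ)) (x : Fin 2 → ℂ) :
    complexMap N (star x) = star (complexMap N x) := by
  obtain ⟨a, b, rfl⟩ := exists_eq_complexVec_add x
  have h : ∀ y : Fin 2 → ℝ, star (complexVec y) = complexVec y := fun y => by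
    ext i
    simp [complexVec]
  simp only [star_add, star_smul, map_add, map_smul, complexMap_apply, h]

theorem complexMap_star_eq {N : (Fin 2 → ℝ) →ₗ[ℝ] (Fin 2 → ℝ)} {x : Fin 2 → ℂ} {a : ℂ}
    (h : complexMap N x = a • x) : complexMap N (star x) = star a • star x := by
  rw [complexMap_star, h, star_smul]

theorem exists_real_eigenvalue {N : (Fin 2 → ℝ) →ₗ[ℝ] (Fin 2 → ℝ)} {x : Fin 2 → ℝ} (hx : x ≠ 0)
    {k a : ℂ} (hk : k ≠ 0) (h : complexMap N (k • complexVec x) = a • k • complexVec x) :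
    ∃ b : ℝ, N x = b • x := by
  apply exists_eq_smul_of_wedge hx
  rw [map_smul, complexMap_apply, smul_comm, (smul_right_injective _ hk).eq_iff] at h
  rw [← Complex.ofReal_eq_zero, ← wedge_complexVec, h]
  simp [wedge]
  ring

theorem exists_real_eigenFrame
    {Ψ : (Fin 2 → ℝ) × (Fin 2 → ℝ) →ₗ[ℝ] (Fin 2 → ℝ) × (Fin 2 → ℝ) →ₗ[ℝ]
      (Fin 2 → ℝ) × (Fin 2 → ℝ) →ₗ[ℝ] ℝ} (hΨ : SmoothCubic Ψ)
    (hx : ∀ x, Ψ (x, 0) (x, 0) (x, 0) = 0) (hy : ∀ y, Ψ (0, y) (0, y) (0, y) = 0)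
    (hd : ∀ x, Ψ (x, x) (x, x) (x, x) = 0) {N : Fin 3 → (Fin 2 → ℝ) →ₗ[ℝ] (Fin 2 → ℝ)}
    (hN : ∀ i x, Ψ (x, N i x) (x, N i x) (x, N i x) = 0) (hN0 : ∀ i x, N i x = 0 → x = 0)
    (hN1 : ∀ i x, N i x = x → x = 0) (hNN : ∀ i j, i ≠ j → ∀ x, N i x = N j x → x = 0) :
    ∃ (σ : Equiv.Perm (Fin 3)) (u v : Fin 2 → ℝ) (a b c d e f : ℝ), wedge u v ≠ 0 ∧
      EigenData a b c d e f ∧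
      N (σ 2) u = a • u ∧ N (σ 2) v = b • v ∧ N (σ 1) u = c • u ∧ N (σ 1) (u + v) = d • (u + v) ∧
      N (σ 0) v = e • v ∧ N (σ 0) (u + v) = f • (u + v) := by
  have hm := hΨ.mixedCubic hx hy hd
  have hmC := hΨ.complex_mixedCubic hx hy hd
  have hG : ∀ i, GraphLine (leftPart Ψ) (rightPart Ψ) (N i) := fun i =>
    ⟨fun x => by
      have := hN i x
      rw [hΨ.apply_eq hx hy] at this
      linarith, hN0 i, hN1 i⟩
  have hGC := fun i => (hG i).complex
  have hNC : ∀ i j, i ≠ j → ∀ x, complexMap (N i) x = complexMap (N j) x → x = 0 :=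
    fun i j hij => complexMap_injective (hNN i j hij) (complexMap_apply _) (complexMap_apply _)
  obtain ⟨σ, u, v, a, b, c, d, e, f, huv, hMu, hMv, hNu, hNw, hPv, hPw⟩ :=
    exists_eigenFrame hmC hGC hNC
  have hσ : ∀ i j, i ≠ j → σ i ≠ σ j := fun i j h => σ.injective.ne h
  have hE := eigenData_of_frame hmC huv (hGC (σ 2)) (hGC (σ 1)) (hGC (σ 0))
    (hNC _ _ (hσ 2 1 (by decide))) (hNC _ _ (hσ 2 0 (by decide))) (hNC _ _ (hσ 1 0 (by decide)))
    hMu hMv hNu hNw hPv hPw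
  have hvu : wedge v u ≠ 0 := by rw [wedge_swap]; exact neg_ne_zero.mpr huv
  have hwu : wedge (u + v) u ≠ 0 := by
    have := wedge_smul_add u v 1 1 1 0
    simp only [one_smul, zero_smul, add_zero] at this
    simpa [this] using huv
  have hNv : complexMap (N (σ 1)) v = d • v + (d - c) • u := by
    have : complexMap (N (σ 1)) v = complexMap (N (σ 1)) (u + v) - complexMap (N (σ 1)) u := by
      rw [map_add]
      abel
    rw [this, hNw, hNu]
    module
  have hPu : complexMap (N (σ 0)) u = f • u + (f - e) • v := by
    have : complexMap (N (σ 0)) u = complexMap (N (σ 0)) (u + v) - complexMap (N (σ 0)) v := by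
      rw [map_add]
      abel
    rw [this, hPw, hPv]
    module
  have hvN : wedge v (complexMap (N (σ 1)) v) ≠ 0 := by
    have := wedge_smul_add u v 0 1 (d - c) d
    simp only [one_smul, zero_smul, zero_add] at this
    rw [hNv, add_comm, this]
    refine mul_ne_zero ?_ huv
    intro h
    exact hE.γδ (by linear_combination h)
  have huP : wedge u (complexMap (N (σ 0)) u) ≠ 0 := by
    have := wedge_smul_add u v 1 0 f (f - e)
    simp only [one_smul, zero_smul, add_zero] at this
    rw [hPu, this]
    refine mul_ne_zero ?_ huv
    intro h
    exact hE.εζ (by linear_combination -h)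
  have hu := wedge_eq_zero_of_common huv hE.αβ hMu hMv hvN (complexMap_star_eq hMu)
    (complexMap_star_eq hNu)
  have hv := wedge_eq_zero_of_common hvu (by rw [← neg_sub]; exact neg_ne_zero.mpr hE.αβ) hMv hMu huP
    (complexMap_star_eq hMv) (complexMap_star_eq hPv)
  have hw := wedge_eq_zero_of_common hwu (by rw [← neg_sub]; exact neg_ne_zero.mpr hE.γδ) hNw hNu huP
    (complexMap_star_eq hNw) (complexMap_star_eq hPw)
  obtain ⟨k, u, v, hk, rfl, rfl⟩ := exists_ofReal_frame huv hu hv hw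
  have huv' : wedge u v ≠ 0 := by
    rintro h
    apply huv
    have := wedge_complexVec u v
    rw [h] at this
    simp only [wedge, Complex.ofReal_zero, Pi.smul_apply, smul_eq_mul] at this ⊢
    linear_combination k ^ 2 * this
  have huw : wedge (u + v) v ≠ 0 := by
    have := wedge_smul_add u v 1 1 0 1
    simp only [one_smul, zero_smul, zero_add] at this
    simpa [this] using huv'
  have hw0 := ne_zero_of_wedge huw
  have hu0 := ne_zero_of_wedge huv'
  have hv0 := ne_zero_of_wedge (u := v) (v := u) (by rw [wedge_swap]; exact neg_ne_zero.mpr huv')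
  have hadd : k • complexVec u + k • complexVec v = k • complexVec (u + v) := by
    ext i
    simp [complexVec, mul_add]
  rw [hadd] at hNw hPw
  obtain ⟨a, ha⟩ := exists_real_eigenvalue hu0 hk hMu
  obtain ⟨b, hb⟩ := exists_real_eigenvalue hv0 hk hMv
  obtain ⟨c, hc⟩ := exists_real_eigenvalue hu0 hk hNu
  obtain ⟨d, hd'⟩ := exists_real_eigenvalue hw0 hk hNw
  obtain ⟨e, he⟩ := exists_real_eigenvalue hv0 hk hPv
  obtain ⟨f, hf⟩ := exists_real_eigenvalue hw0 hk hPw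
  exact ⟨σ, u, v, a, b, c, d, e, f, huv', eigenData_of_frame hm huv' (hG (σ 2)) (hG (σ 1)) (hG (σ 0))
    (hNN _ _ (hσ 2 1 (by decide))) (hNN _ _ (hσ 2 0 (by decide))) (hNN _ _ (hσ 1 0 (by decide)))
    ha hb hc hd' he hf, ha, hb, hc, hd', he, hf⟩

end Descent

section Coordinates

/-- The real coordinate plane. -/
abbrev V2 : Type := Fin 2 → ℝ

theorem exists_splitting {P Q : PLine} (h : Skew P Q) :
    ∃ E : (V2 × V2) ≃ₗ[ℝ] V4, (∀ x y, E (x, y) ∈ P ↔ y = 0) ∧ ∀ x y, E (x, y) ∈ Q ↔ x = 0 := by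
  obtain ⟨hP, hQ, hPQ⟩ := h
  have hdis : Disjoint P Q := disjoint_iff.mpr hPQ
  have hc : IsCompl P Q := by
    refine ⟨hdis, codisjoint_iff.mpr (Submodule.eq_top_of_finrank_eq ?_)⟩
    have := Submodule.finrank_sup_add_finrank_inf_eq P Q
    rw [hPQ, finrank_bot, hP, hQ] at this
    simpa using this
  have e : ∀ {R : PLine}, IsLine R → Nonempty (V2 ≃ₗ[ℝ] R) := fun {R} hR =>
    FiniteDimensional.nonempty_linearEquiv_of_finrank_eq (by
      rw [show Module.finrank ℝ R = 2 from hR]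
      simp)
  obtain ⟨eP⟩ := e hP
  obtain ⟨eQ⟩ := e hQ
  have hE : ∀ x y, ((eP.prodCongr eQ).trans (Submodule.prodEquivOfIsCompl P Q hc)) (x, y) =
      (eP x : V4) + eQ y := fun x y => by simp
  refine ⟨(eP.prodCongr eQ).trans (Submodule.prodEquivOfIsCompl P Q hc), fun x y => ?_,
    fun x y => ?_⟩
  · rw [hE, P.add_mem_iff_right (eP x).2]
    constructor
    · intro hy
      have := Submodule.disjoint_def.mp hdis _ hy (eQ y).2
      simpa using this
    · rintro rfl
      simp
  · rw [hE, Q.add_mem_iff_left (eQ y).2]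
    constructor
    · intro hx
      have := Submodule.disjoint_def.mp hdis _ (eP x).2 hx
      simpa using this
    · rintro rfl
      simp

theorem exists_graph (E : (V2 × V2) ≃ₗ[ℝ] V4) {R : PLine} (hR : IsLine R)
    (h : ∀ y, E (0, y) ∈ R → y = 0) :
    ∃ N : V2 →ₗ[ℝ] V2, ∀ x y, E (x, y) ∈ R ↔ y = N x := by
  let f : R →ₗ[ℝ] V2 := LinearMap.fst ℝ V2 V2 ∘ₗ E.symm.toLinearMap ∘ₗ R.subtype
  have hinj : Function.Injective f := by
    rw [← LinearMap.ker_eq_bot, LinearMap.ker_eq_bot']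
    intro r hr
    have h1 : E.symm (r : V4) = (0, (E.symm (r : V4)).2) := Prod.ext hr rfl
    have h2 := h (E.symm (r : V4)).2 (by
      rw [← h1, E.apply_symm_apply]
      exact r.2)
    rw [h2] at h1
    have h3 : E.symm (r : V4) = 0 := h1
    simpa using h3
  have hfr : Module.finrank ℝ R = Module.finrank ℝ V2 := by
    rw [show Module.finrank ℝ R = 2 from hR]
    simp
  let g := LinearEquiv.ofInjectiveOfFinrankEq f hinj hfr
  let N : V2 →ₗ[ℝ] V2 :=
    LinearMap.snd ℝ V2 V2 ∘ₗ E.symm.toLinearMap ∘ₗ R.subtype ∘ₗ g.symm.toLinearMap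
  have hN : ∀ x, E (x, N x) ∈ R := by
    intro x
    have h1 : (E.symm (g.symm x : V4)).1 = x := g.apply_symm_apply x
    have h2 : (x, N x) = E.symm (g.symm x : V4) := Prod.ext h1.symm rfl
    rw [h2, E.apply_symm_apply]
    exact (g.symm x).2
  refine ⟨N, fun x y => ⟨fun hy => ?_, fun hy => hy ▸ hN x⟩⟩
  have h1 := R.sub_mem hy (hN x)
  rw [← map_sub] at h1
  exact sub_eq_zero.mp (h _ (by simpa using h1))

theorem Skew.eq_zero {P Q : PLine} (h : Skew P Q) {x : V4} (hP : x ∈ P) (hQ : x ∈ Q) : x = 0 := by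
  have : x ∈ P ⊓ Q := ⟨hP, hQ⟩
  rwa [h.2.2] at this

theorem exists_coordinates {L : Fin 6 → PLine} (h : PairwiseSkew L) :
    ∃ (E : (V2 × V2) ≃ₗ[ℝ] V4) (N : Fin 3 → V2 →ₗ[ℝ] V2), (∀ x y, E (x, y) ∈ L 0 ↔ y = 0) ∧
      (∀ x y, E (x, y) ∈ L 1 ↔ x = 0) ∧ (∀ x y, E (x, y) ∈ L 2 ↔ y = x) ∧
      ∀ (i : Fin 3) x y, E (x, y) ∈ L (Fin.natAdd 3 i) ↔ y = N i x := by
  obtain ⟨E, hP, hQ⟩ := exists_splitting (h 0 1 (by decide))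
  obtain ⟨M, hM⟩ := exists_graph E (h 2 0 (by decide)).1 fun y hy => by
    have := (h 1 2 (by decide)).eq_zero ((hQ 0 y).mpr rfl) hy
    simpa using this
  have hMi : Function.Injective M := by
    rw [← LinearMap.ker_eq_bot, LinearMap.ker_eq_bot']
    intro x hx
    have := (h 0 2 (by decide)).eq_zero ((hP x 0).mpr rfl) ((hM x 0).mpr hx.symm)
    simpa using this
  let M' := LinearEquiv.ofInjectiveEndo M hMi
  let E' := ((LinearEquiv.refl ℝ V2).prodCongr M').trans E
  have hE' : ∀ x y, E' (x, y) = E (x, M y) := fun x y => rfl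
  have hQ' : ∀ x y, E' (x, y) ∈ L 1 ↔ x = 0 := fun x y => by rw [hE', hQ]
  have hne : ∀ i : Fin 3, (1 : Fin 6) ≠ Fin.natAdd 3 i := by decide
  choose N hN using fun i : Fin 3 => exists_graph E' (h 1 (Fin.natAdd 3 i) (hne i)).2.1 fun y hy => by
    have := (h 1 _ (hne i)).eq_zero ((hQ' 0 y).mpr rfl) hy
    simpa using this
  refine ⟨E', N, fun x y => ?_, hQ', fun x y => ?_, hN⟩
  · rw [hE', hP, map_eq_zero_iff M hMi]
  · rw [hE', hM, hMi.eq_iff]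

theorem IsSchlafliSix.exists_coarse_sample {L : Fin 6 → PLine} (h : IsSchlafliSix L) :
    ∃ k, SchlafliCoarse L (sample k) := by
  obtain ⟨E, N, h0, h1, h2, hN⟩ := exists_coordinates h.1
  obtain ⟨Φ, hΦ, hL⟩ := h.exists_smoothCubic
  let Ψ : V2 × V2 →ₗ[ℝ] V2 × V2 →ₗ[ℝ] V2 × V2 →ₗ[ℝ] ℝ :=
    (Φ.compl₁₂ E.toLinearMap E.toLinearMap).compr₂ (LinearMap.lcomp ℝ ℝ E.toLinearMap)
  have hΨΦ : ∀ x y z, Ψ x y z = Φ (E x) (E y) (E z) := fun _ _ _ => rfl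
  have hΨ : SmoothCubic Ψ :=
    { swap_left := fun _ _ _ => hΦ.swap_left _ _ _
      swap_right := fun _ _ _ => hΦ.swap_right _ _ _
      smooth := fun a b hab => by
        obtain ⟨y, hy⟩ := hΦ.smooth (E a) (E b) (by simpa using hab)
        exact ⟨E.symm y, by simpa [hΨΦ] using hy⟩ }
  have hne : ∀ k i : Fin 3, Fin.castAdd 3 k ≠ Fin.natAdd 3 i := by decide
  obtain ⟨σ, u, v, a, b, c, d, e, f, huv, hE, hMu, hMv, hNu, hNw, hPv, hPw⟩ :=
    exists_real_eigenFrame hΨ (fun x => hL 0 _ ((h0 x 0).mpr rfl))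
    (fun y => hL 1 _ ((h1 0 y).mpr rfl)) (fun x => hL 2 _ ((h2 x x).mpr rfl))
    (fun i x => hL _ _ ((hN i x (N i x)).mpr rfl))
    (fun i x hx => by
      have := (h.1 0 _ (hne 0 i)).eq_zero ((h0 x 0).mpr rfl) ((hN i x 0).mpr hx.symm)
      simpa using this)
    (fun i x hx => by
      have := (h.1 2 _ (hne 2 i)).eq_zero ((h2 x x).mpr rfl) ((hN i x x).mpr hx.symm)
      simpa using this)
    (fun i j hij x hx => by
      have := (h.1 (Fin.natAdd 3 i) (Fin.natAdd 3 j) (fun h => hij (Fin.natAdd_injective 3 3 h))).eq_zero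
        ((hN i x (N i x)).mpr rfl) ((hN j x (N i x)).mpr hx)
      simp only [map_eq_zero_iff E E.injective, Prod.mk_eq_zero] at this
      exact this.1)
  let F : V4 →ₗ[ℝ] V2 × V2 :=
    { toFun := fun x => (x 0 • u + x 1 • v, x 2 • u + x 3 • v)
      map_add' := fun x y => by
        ext i <;> simp <;> ring
      map_smul' := fun r x => by
        ext i <;> simp <;> ring }
  let A : V4 →ₗ[ℝ] V4 := E.toLinearMap ∘ₗ F
  have hA : ∀ x, A x = E (x 0 • u + x 1 • v, x 2 • u + x 3 • v) := fun _ => rfl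
  have hinj : Function.Injective A := by
    rw [← LinearMap.ker_eq_bot, LinearMap.ker_eq_bot']
    intro x hx
    rw [hA, map_eq_zero_iff E E.injective, Prod.mk_eq_zero] at hx
    obtain ⟨x0, x1⟩ := eq_zero_of_smul_add_smul huv hx.1
    obtain ⟨x2, x3⟩ := eq_zero_of_smul_add_smul huv hx.2
    ext i
    fin_cases i <;> assumption
  have hsurj : Function.Surjective A := LinearMap.injective_iff_surjective.mp hinj
  have hdet : LinearMap.det A ≠ 0 := (LinearEquiv.isUnit_det' (LinearEquiv.ofInjectiveEndo A hinj)).ne_zero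
  have hcoord : ∀ s t s' t' : ℝ, s • u + t • v = s' • u + t' • v ↔ s = s' ∧ t = t' := by
    refine fun s t s' t' => ⟨fun hst => ?_, by rintro ⟨rfl, rfl⟩; rfl⟩
    have h0 : (s - s') • u + (t - t') • v = 0 := by
      rw [← sub_eq_zero] at hst
      rw [← hst]
      module
    obtain ⟨h1, h2⟩ := eq_zero_of_smul_add_smul huv h0
    exact ⟨sub_eq_zero.mp h1, sub_eq_zero.mp h2⟩
  have hinjτ : ∀ σ : Equiv.Perm (Fin 3), Function.Injective (![Fin.natAdd 3 (σ 0), Fin.natAdd 3 (σ 1),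
      Fin.natAdd 3 (σ 2), 1, 0, 2] : Fin 6 → Fin 6) := by decide
  let τ := Equiv.ofBijective _ (Finite.injective_iff_bijective.mp (hinjτ σ))
  have hτ : ∀ i, L (τ i) = (eigenL a b c d e f i).map A := by
    intro i
    suffices hi : eigenL a b c d e f i = (L (τ i)).comap A by
      rw [hi, Submodule.map_comap_eq_of_surjective hsurj]
    ext x
    rw [Submodule.mem_comap, hA]
    fin_cases i
    · refine (hE.mem_zero x).trans (Iff.trans ?_ (hN (σ 0) _ _).symm)
      have hPu : N (σ 0) u = f • u + (f - e) • v := by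
        have : N (σ 0) u = N (σ 0) (u + v) - N (σ 0) v := by
          rw [map_add]
          abel
        rw [this, hPw, hPv]
        module
      rw [← hcoord, map_add, map_smul, map_smul, hPu, hPv]
      exact Eq.congr_right (by module)
    · refine (hE.mem_one x).trans (Iff.trans ?_ (hN (σ 1) _ _).symm)
      have hNv : N (σ 1) v = (d - c) • u + d • v := by
        have : N (σ 1) v = N (σ 1) (u + v) - N (σ 1) u := by
          rw [map_add]
          abel
        rw [this, hNw, hNu]
        module
      rw [← hcoord, map_add, map_smul, map_smul, hNu, hNv]
      exact Eq.congr_right (by module)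
    · refine (hE.mem_two x).trans (Iff.trans ?_ (hN (σ 2) _ _).symm)
      rw [← hcoord, map_add, map_smul, map_smul, hMu, hMv, smul_smul, smul_smul, mul_comm a, mul_comm b]
    · refine (hE.mem_three x).trans (Iff.trans ?_ (h1 _ _).symm)
      rw [← hcoord, zero_smul, zero_smul, add_zero]
    · refine (hE.mem_four x).trans (Iff.trans ?_ (h0 _ _).symm)
      rw [← hcoord, zero_smul, zero_smul, add_zero]
    · refine (hE.mem_five x).trans (Iff.trans ?_ (h2 _ _).symm)
      rw [← hcoord]
  obtain ⟨k, hk⟩ := hE.sixRep.exists_coarse_sample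
  exact ⟨k, (schlafliCoarse_of_map hdet τ hτ).trans _ _ _ hk⟩

theorem isSchlafliSix_sample (k : Fin 4) : IsSchlafliSix (sample k) := by
  fin_cases k
  · exact nf_isSchlafliSix isHex_sample.nfGen
  · exact nf_isSchlafliSix isBip_sample.nfGen
  · exact nf_isSchlafliSix isTri_sample.nfGen
  · exact nf_isSchlafliSix isIco_sample.nfGen

theorem abs_sgnOf_sample (k : Fin 4) (m : Fin 6) :
    |sgnOf (sample k ∘ m.succAbove)| = ![10, 4, 2, 0] k := by
  fin_cases k
  · exact (congrArg _ (sgnOf_hex m)).trans (by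
      rw [← Int.cast_abs, tableSgn_hex]
      simp)
  · exact (congrArg _ (sgnOf_bip m)).trans (by
      rw [← Int.cast_abs, tableSgn_bip]
      simp)
  · exact (congrArg _ (sgnOf_tri m)).trans (by
      rw [← Int.cast_abs, tableSgn_tri]
      simp)
  · exact (congrArg _ (sgnOf_ico m)).trans (by
      rw [← Int.cast_abs, tableSgn_ico]
      simp)

theorem absSgnSum_sample (k : Fin 4) : absSgnSum (sample k) = 6 * ![10, 4, 2, 0] k :=
  (Finset.sum_congr rfl fun m _ => abs_sgnOf_sample k m).trans (by simp)

end Coordinates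

theorem segre_four_coarse_classes :
    ∃ C : Fin 4 → (Fin 6 → PLine),
      (∀ k, IsSchlafliSix (C k)) ∧
      (∀ k l, k ≠ l → ¬ SchlafliCoarse (C k) (C l)) ∧
      (∀ L : Fin 6 → PLine, IsSchlafliSix L → ∃ k, SchlafliCoarse L (C k)) ∧
      (∀ i : Fin 6, |sgnOf (C 0 ∘ i.succAbove)| = 10) ∧
      (∀ i : Fin 6, |sgnOf (C 1 ∘ i.succAbove)| = 4) ∧
      (∀ i : Fin 6, |sgnOf (C 2 ∘ i.succAbove)| = 2) ∧
      (∀ i : Fin 6, |sgnOf (C 3 ∘ i.succAbove)| = 0) := by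
  refine ⟨sample, isSchlafliSix_sample, fun k l hkl h => ?_, fun L hL => hL.exists_coarse_sample,
    abs_sgnOf_sample 0, abs_sgnOf_sample 1, abs_sgnOf_sample 2, abs_sgnOf_sample 3⟩
  have h1 := absSgnSum_eq_of_coarse h
  rw [absSgnSum_sample, absSgnSum_sample] at h1
  fin_cases k <;> fin_cases l <;> first | exact hkl rfl | norm_num at h1
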